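/- arXiv:math/0507028 — 2 statements merged into one kernel-verified Lean document; each statement's English description precedes it below -/
import Mathlib

section
/- Let H be a complex Hénon map which is uniformly hyperbolic on J*. Then J* has local product structure: there exist ε > 0 and δ > 0 such that for all p, q ∈ J* with ‖p − q‖ < δ, the set W^s_ε(p) ∩ W^u_ε(q) consists of exactly one point, and this point belongs to J*. -/
open Filter Metric Topology Set

noncomputable section

/-- An elementary Hénon map `(z,w) ↦ (P(z) + a·w, b·z)` with `deg P ≥ 2`, `a ≠ 0`, `b ≠ 0`. -/
structure ElemHenon where
  P : Polynomial ℂ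
  a : ℂ
  b : ℂ
  ha : a ≠ 0
  hb : b ≠ 0
  hdeg : 2 ≤ P.natDegree

def ElemHenon.toFun (h : ElemHenon) : ℂ × ℂ → ℂ × ℂ :=
  fun p => (h.P.eval p.1 + h.a * p.2, h.b * p.1)

def ElemHenon.invFun (h : ElemHenon) : ℂ × ℂ → ℂ × ℂ :=
  fun p => (p.2 / h.b, (p.1 - h.P.eval (p.2 / h.b)) / h.a)

/-- A complex Hénon map: a nonempty composition `H = H₁ ∘ ⋯ ∘ Hₙ` of elementary Hénon maps. -/
structure HenonMap where
  comps : List ElemHenon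
  ne : comps ≠ []

/-- The map `H = H₁ ∘ ⋯ ∘ Hₙ`. -/
def HenonMap.toFun (H : HenonMap) : ℂ × ℂ → ℂ × ℂ :=
  H.comps.foldr (fun h f => h.toFun ∘ f) id

/-- The inverse map `H⁻¹ = Hₙ⁻¹ ∘ ⋯ ∘ H₁⁻¹`. -/
def HenonMap.invFun (H : HenonMap) : ℂ × ℂ → ℂ × ℂ :=
  H.comps.foldl (fun f h => h.invFun ∘ f) id

/-- The degree `d = ∏ deg Pᵢ`. -/
def HenonMap.deg (H : HenonMap) : ℕ :=
  (H.comps.map fun h => h.P.natDegree).prod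

/-- The (constant) Jacobian determinant of `H`; each factor contributes `-aᵢbᵢ`. -/
def HenonMap.jacDet (H : HenonMap) : ℂ :=
  (H.comps.map fun h => -(h.a * h.b)).prod

/-- Points with bounded forward orbit. -/
def Kplus (H : HenonMap) : Set (ℂ × ℂ) :=
  {p | Bornology.IsBounded (Set.range fun n : ℕ => H.toFun^[n] p)}

/-- Points with bounded backward orbit. -/
def Kminus (H : HenonMap) : Set (ℂ × ℂ) :=
  {p | Bornology.IsBounded (Set.range fun n : ℕ => H.invFun^[n] p)}

def Jplus (H : HenonMap) : Set (ℂ × ℂ) := frontier (Kplus H)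

def Jminus (H : HenonMap) : Set (ℂ × ℂ) := frontier (Kminus H)

/-- The Julia set `J = J⁺ ∩ J⁻`. -/
def Jset (H : HenonMap) : Set (ℂ × ℂ) := Jplus H ∩ Jminus H

/-- The forward escape function `G⁺(p) = lim d⁻ⁿ log⁺ ‖Hⁿ(p)‖`. -/
def Gplus (H : HenonMap) (p : ℂ × ℂ) : ℝ :=
  limUnder atTop fun n : ℕ => Real.log (max ‖H.toFun^[n] p‖ 1) / (H.deg : ℝ) ^ n

/-- The backward escape function `G⁻(p) = lim d⁻ⁿ log⁺ ‖H⁻ⁿ(p)‖`. -/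
def Gminus (H : HenonMap) (p : ℂ × ℂ) : ℝ :=
  limUnder atTop fun n : ℕ => Real.log (max ‖H.invFun^[n] p‖ 1) / (H.deg : ℝ) ^ n

/-- `p` is a periodic saddle point: `H^k(p) = p` for some `k ≥ 1` and `D(H^k)_p` has
an eigenvalue of modulus `< 1` and an eigenvalue of modulus `> 1`. -/
def IsSaddlePeriodic (H : HenonMap) (p : ℂ × ℂ) : Prop :=
  ∃ k : ℕ, 1 ≤ k ∧ H.toFun^[k] p = p ∧
    ∃ (v₁ v₂ : ℂ × ℂ) (μ₁ μ₂ : ℂ), v₁ ≠ 0 ∧ v₂ ≠ 0 ∧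
      fderiv ℂ (H.toFun^[k]) p v₁ = μ₁ • v₁ ∧
      fderiv ℂ (H.toFun^[k]) p v₂ = μ₂ • v₂ ∧
      ‖μ₁‖ < 1 ∧ 1 < ‖μ₂‖

/-- `J*`: the closure of the set of periodic saddle points. -/
def Jstar (H : HenonMap) : Set (ℂ × ℂ) :=
  closure {p | IsSaddlePeriodic H p}

/-- The stable set of a point. -/
def Ws (H : HenonMap) (p : ℂ × ℂ) : Set (ℂ × ℂ) :=
  {x | Tendsto (fun n : ℕ => dist (H.toFun^[n] x) (H.toFun^[n] p)) atTop (𝓝 0)}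

/-- The unstable set of a point. -/
def Wu (H : HenonMap) (p : ℂ × ℂ) : Set (ℂ × ℂ) :=
  {x | Tendsto (fun n : ℕ => dist (H.invFun^[n] x) (H.invFun^[n] p)) atTop (𝓝 0)}

/-- The stable set of a set. -/
def WsSet (H : HenonMap) (S : Set (ℂ × ℂ)) : Set (ℂ × ℂ) :=
  {x | Tendsto (fun n : ℕ => infDist (H.toFun^[n] x) S) atTop (𝓝 0)}

/-- The unstable set of a set. -/
def WuSet (H : HenonMap) (S : Set (ℂ × ℂ)) : Set (ℂ × ℂ) :=
  {x | Tendsto (fun n : ℕ => infDist (H.invFun^[n] x) S) atTop (𝓝 0)}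

/-- The local stable set of size `ε`. -/
def WsLoc (H : HenonMap) (ε : ℝ) (p : ℂ × ℂ) : Set (ℂ × ℂ) :=
  {x | (∀ n : ℕ, dist (H.toFun^[n] x) (H.toFun^[n] p) ≤ ε) ∧
       Tendsto (fun n : ℕ => dist (H.toFun^[n] x) (H.toFun^[n] p)) atTop (𝓝 0)}

/-- The local unstable set of size `ε`. -/
def WuLoc (H : HenonMap) (ε : ℝ) (p : ℂ × ℂ) : Set (ℂ × ℂ) :=
  {x | (∀ n : ℕ, dist (H.invFun^[n] x) (H.invFun^[n] p) ≤ ε) ∧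
       Tendsto (fun n : ℕ => dist (H.invFun^[n] x) (H.invFun^[n] p)) atTop (𝓝 0)}

/-- A parametrization of the stable manifold of `p`: an injective holomorphic immersion
`Φ : ℂ → ℂ²` with `Φ(0) = p` and image `W^s_p`. -/
def IsStableParam (H : HenonMap) (p : ℂ × ℂ) (Φ : ℂ → ℂ × ℂ) : Prop :=
  Differentiable ℂ Φ ∧ Function.Injective Φ ∧ (∀ z, deriv Φ z ≠ 0) ∧
    Φ 0 = p ∧ Set.range Φ = Ws H p

/-- A parametrization of the unstable manifold of `p`. -/
def IsUnstableParam (H : HenonMap) (p : ℂ × ℂ) (Ψ : ℂ → ℂ × ℂ) : Prop :=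
  Differentiable ℂ Ψ ∧ Function.Injective Ψ ∧ (∀ z, deriv Ψ z ≠ 0) ∧
    Ψ 0 = p ∧ Set.range Ψ = Wu H p

/-- Uniform hyperbolicity of `H` on a compact completely invariant set `S`:
a continuous invariant splitting `ℂ² = E^s_x ⊕ E^u_x` into complex lines, with uniform
contraction on `E^s` and uniform expansion on `E^u`.  Continuity of the line fields is
expressed by the closedness of their total spaces over `S` (equivalent to continuity
for fields of lines of constant dimension over a compact set). -/
def UniformlyHyperbolicOn (H : HenonMap) (S : Set (ℂ × ℂ)) : Prop :=
  IsCompact S ∧ H.toFun '' S = S ∧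
  ∃ (Es Eu : (ℂ × ℂ) → Submodule ℂ (ℂ × ℂ)) (c lam : ℝ),
    0 < c ∧ 0 < lam ∧ lam < 1 ∧
    (∀ x ∈ S, Module.finrank ℂ (Es x) = 1) ∧
    (∀ x ∈ S, Module.finrank ℂ (Eu x) = 1) ∧
    (∀ x ∈ S, IsCompl (Es x) (Eu x)) ∧
    IsClosed {q : (ℂ × ℂ) × (ℂ × ℂ) | q.1 ∈ S ∧ q.2 ∈ Es q.1} ∧
    IsClosed {q : (ℂ × ℂ) × (ℂ × ℂ) | q.1 ∈ S ∧ q.2 ∈ Eu q.1} ∧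
    (∀ x ∈ S, (Es x).map (fderiv ℂ H.toFun x : (ℂ × ℂ) →ₗ[ℂ] (ℂ × ℂ)) = Es (H.toFun x)) ∧
    (∀ x ∈ S, (Eu x).map (fderiv ℂ H.toFun x : (ℂ × ℂ) →ₗ[ℂ] (ℂ × ℂ)) = Eu (H.toFun x)) ∧
    (∀ x ∈ S, ∀ v ∈ Es x, ∀ n : ℕ, 1 ≤ n →
      ‖fderiv ℂ (H.toFun^[n]) x v‖ ≤ (lam ^ n / c) * ‖v‖) ∧
    (∀ x ∈ S, ∀ v ∈ Eu x, ∀ n : ℕ, 1 ≤ n →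
      ‖fderiv ℂ (H.toFun^[n]) x v‖ ≥ (c / lam ^ n) * ‖v‖)

/-- `p ∈ J*` is weakly stably exposed: there are a parametrization `Φ` of `W^s_p` and a
nonempty simply connected open set `V ⊂ ℂ` with `0 ∈ ∂V`, `∂V ⊂ J*_{p,s}` and
`Φ(V) ⊂ K ∖ J*`. -/
def WeaklyStablyExposed (H : HenonMap) (p : ℂ × ℂ) : Prop :=
  ∃ (Φ : ℂ → ℂ × ℂ) (V : Set ℂ), IsStableParam H p Φ ∧
    V.Nonempty ∧ IsOpen V ∧ SimplyConnectedSpace V ∧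
    (0 : ℂ) ∈ frontier V ∧ frontier V ⊆ Φ ⁻¹' Jstar H ∧
    Φ '' V ⊆ (Kplus H ∩ Kminus H) \ Jstar H

/-- `p ∈ J*` is weakly unstably exposed. -/
def WeaklyUnstablyExposed (H : HenonMap) (p : ℂ × ℂ) : Prop :=
  ∃ (Ψ : ℂ → ℂ × ℂ) (V : Set ℂ), IsUnstableParam H p Ψ ∧
    V.Nonempty ∧ IsOpen V ∧ SimplyConnectedSpace V ∧
    (0 : ℂ) ∈ frontier V ∧ frontier V ⊆ Ψ ⁻¹' Jstar H ∧
    Ψ '' V ⊆ (Kplus H ∩ Kminus H) \ Jstar H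

section Contraction

variable {E : Type*} [NormedAddCommGroup E]

/-- The Banach fixed point theorem on a ball of bounded sequences, in coordinates: existence. -/
theorem exists_seq_fixedPoint [CompleteSpace E] {Φ : ℤ → (ℤ → E) → E} {ε : ℝ} (hε : 0 ≤ ε)
    (h0 : ∀ n, ‖Φ n 0‖ ≤ ε / 2)
    (hlip : ∀ v w : ℤ → E, (∀ n, ‖v n‖ ≤ ε) → (∀ n, ‖w n‖ ≤ ε) → ∀ d, (∀ n, ‖v n - w n‖ ≤ d) →
      ∀ n, ‖Φ n v - Φ n w‖ ≤ d / 2) :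
    ∃ v : ℤ → E, (∀ n, ‖v n‖ ≤ ε) ∧ ∀ n, Φ n v = v n := by
  let u : ℕ → ℤ → E := fun k => (fun v n => Φ n v)^[k] 0
  have hu0 : u 0 = 0 := rfl
  have hus : ∀ k n, u (k + 1) n = Φ n (u k) := fun k n => by
    simp only [u, Function.iterate_succ_apply']
  have hbd : ∀ k n, ‖u k n‖ ≤ ε := by
    intro k
    induction k with
    | zero => intro n; simpa [hu0] using hε
    | succ k ih =>
      intro n
      rw [hus]
      have h1 := hlip (u k) 0 ih (fun n => by simpa using hε) ε (fun n => by simpa using ih n) n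
      have h2 := norm_add_le (Φ n (u k) - Φ n 0) (Φ n 0)
      rw [sub_add_cancel] at h2
      linarith [h0 n]
  have hstep : ∀ k n, dist (u k n) (u (k + 1) n) ≤ ε / 2 / 2 ^ k := by
    intro k
    induction k with
    | zero => intro n; rw [hus, hu0, dist_eq_norm]; simpa using h0 n
    | succ k ih =>
      intro n
      rw [hus, hus (k + 1), dist_eq_norm]
      refine (hlip _ _ (hbd _) (hbd _) _ (fun n => by simpa [dist_eq_norm] using ih n) n).trans
        (le_of_eq ?_)
      rw [pow_succ, div_div _ ((2 : ℝ) ^ k) 2]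
  have hcau : ∀ n, ∃ a, Tendsto (fun k => u k n) atTop (𝓝 a) := fun n =>
    cauchySeq_tendsto_of_complete (cauchySeq_of_le_geometric_two fun k => hstep k n)
  choose v hv using hcau
  have hdist : ∀ k n, ‖u k n - v n‖ ≤ ε / 2 ^ k := fun k n => by
    rw [← dist_eq_norm]
    exact dist_le_of_le_geometric_two_of_tendsto (fun k => hstep k n) (hv n) k
  have hvb : ∀ n, ‖v n‖ ≤ ε := fun n =>
    le_of_tendsto (hv n).norm (Eventually.of_forall fun k => hbd k n)
  refine ⟨v, hvb, fun n => tendsto_nhds_unique (f := fun k => u (k + 1) n) ?_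
    ((hv n).comp (tendsto_add_atTop_nat 1))⟩
  rw [tendsto_iff_norm_sub_tendsto_zero]
  have hlim : Tendsto (fun k : ℕ => ε / 2 ^ k / 2) atTop (𝓝 0) := by
    have := (tendsto_pow_atTop_nhds_zero_of_lt_one (r := (1 / 2 : ℝ)) (by norm_num)
      (by norm_num)).const_mul (ε / 2)
    rw [mul_zero] at this
    refine this.congr fun k => ?_
    rw [one_div, inv_pow]
    ring
  refine squeeze_zero (fun _ => norm_nonneg _) (fun k => ?_) hlim
  rw [hus]
  exact hlip _ _ (hbd k) hvb _ (hdist k) n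

/-- The Banach fixed point theorem on a ball of bounded sequences, in coordinates: uniqueness. -/
theorem seq_fixedPoint_unique {Φ : ℤ → (ℤ → E) → E} {ε : ℝ}
    (hlip : ∀ v w : ℤ → E, (∀ n, ‖v n‖ ≤ ε) → (∀ n, ‖w n‖ ≤ ε) → ∀ d, (∀ n, ‖v n - w n‖ ≤ d) →
      ∀ n, ‖Φ n v - Φ n w‖ ≤ d / 2)
    {v w : ℤ → E} (hv : ∀ n, ‖v n‖ ≤ ε) (hw : ∀ n, ‖w n‖ ≤ ε)
    (hfv : ∀ n, Φ n v = v n) (hfw : ∀ n, Φ n w = w n) : v = w := by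
  have key : ∀ k : ℕ, ∀ n, ‖v n - w n‖ ≤ (2 * ε) * (1 / 2) ^ k := by
    intro k
    induction k with
    | zero =>
      intro n
      have := norm_sub_le (v n) (w n)
      simp only [pow_zero, mul_one]
      linarith [hv n, hw n]
    | succ k ih =>
      intro n
      have := hlip v w hv hw _ ih n
      rw [hfv, hfw] at this
      refine this.trans (le_of_eq ?_)
      ring
  funext n
  have hlim : Tendsto (fun k : ℕ => (2 * ε) * (1 / 2 : ℝ) ^ k) atTop (𝓝 0) := by
    simpa using (tendsto_pow_atTop_nhds_zero_of_lt_one (r := (1 / 2 : ℝ)) (by norm_num)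
      (by norm_num)).const_mul (2 * ε)
  have := ge_of_tendsto' hlim fun k => key k n
  exact sub_eq_zero.1 (norm_le_zero_iff.1 this)

end Contraction

section Shadowing

variable {E : Type*} [NormedAddCommGroup E] [NormedSpace ℂ E]

/-- A set `S` which is forward invariant under `g` carries projections `P` onto a stable bundle,
commuting with the derivative `A` of `g` (whose inverse is `B`), such that `g` contracts the range
of `P` and expands the kernel of `P` strongly in one step. The constants `C`, `M` bound `P`, `A`;
`σ` controls the oscillation of `P` at scale `δ`, and `θ` that of the derivative at scale `ε`. -/
structure AdaptedSplitting (g : Equiv.Perm E) (S : Set E) (P A B : E → E →L[ℂ] E)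
    (C M κ σ θ ε δ : ℝ) : Prop where
  mapsTo : ∀ x ∈ S, g x ∈ S
  idem : ∀ x ∈ S, ∀ v, P x (P x v) = P x v
  comm : ∀ x ∈ S, ∀ v, A x (P x v) = P (g x) (A x v)
  left_inv : ∀ x ∈ S, ∀ v, B x (A x v) = v
  right_inv : ∀ x ∈ S, ∀ v, A x (B x v) = v
  contract : ∀ x ∈ S, ∀ v, ‖A x (P x v)‖ ≤ κ * ‖P x v‖
  expand : ∀ x ∈ S, ∀ v, ‖v - P x v‖ ≤ κ * ‖A x (v - P x v)‖
  norm_proj : ∀ x ∈ S, ∀ v, ‖P x v‖ ≤ C * ‖v‖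
  norm_compl : ∀ x ∈ S, ∀ v, ‖v - P x v‖ ≤ C * ‖v‖
  norm_deriv : ∀ x ∈ S, ∀ v, ‖A x v‖ ≤ M * ‖v‖
  osc_proj : ∀ x ∈ S, ∀ y ∈ S, dist x y ≤ δ → ∀ v, ‖P x v - P y v‖ ≤ σ * ‖v‖
  differentiable : Differentiable ℂ g
  osc_deriv : ∀ x ∈ S, ∀ y, dist y x ≤ ε → ‖fderiv ℂ g y - A x‖ ≤ θ
  one_le : 1 ≤ C
  M_nonneg : 0 ≤ M
  κ_nonneg : 0 ≤ κ
  κ_small : κ * C ^ 2 ≤ 1 / 16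
  σ_nonneg : 0 ≤ σ
  σ_small : σ * M ≤ 1 / 16
  σ_lt_one : σ < 1
  θ_nonneg : 0 ≤ θ
  θ_small : C * θ ≤ 1 / 16

namespace AdaptedSplitting

variable {g : Equiv.Perm E} {S : Set E} {P A B : E → E →L[ℂ] E} {C M κ σ θ ε δ : ℝ}

theorem norm_remainder_le (h : AdaptedSplitting g S P A B C M κ σ θ ε δ) {x : E} (hx : x ∈ S)
    {v w : E} (hv : ‖v‖ ≤ ε) (hw : ‖w‖ ≤ ε) :
    ‖g (x + v) - g (x + w) - A x (v - w)‖ ≤ θ * ‖v - w‖ := by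
  have hmem : ∀ u : E, ‖u‖ ≤ ε → x + u ∈ closedBall x ε := fun u hu => by
    rw [mem_closedBall, dist_eq_norm]; simpa using hu
  have key := (convex_closedBall x ε).norm_image_sub_le_of_norm_hasFDerivWithin_le'
    (𝕜 := ℂ) (f := g) (f' := fun y => fderiv ℂ g y) (φ := A x) (C := θ) (s := closedBall x ε)
    (x := x + w) (y := x + v)
    (fun y _ => (h.differentiable y).hasFDerivAt.hasFDerivWithinAt)
    (fun y hy => h.osc_deriv x hx y hy) (hmem w hw) (hmem v hv)
  simpa using key

/-- The inverse of the derivative along the unstable bundle. -/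
theorem norm_inv_compl_le (h : AdaptedSplitting g S P A B C M κ σ θ ε δ) {x : E} (hx : x ∈ S)
    (u : E) :
    P x (B x (u - P (g x) u)) = 0 ∧ ‖B x (u - P (g x) u)‖ ≤ κ * C * ‖u‖ := by
  have hP : P x (B x (u - P (g x) u)) = 0 := by
    have h1 := h.comm x hx (B x (u - P (g x) u))
    have h0 : P (g x) (u - P (g x) u) = 0 := by
      rw [map_sub, h.idem _ (h.mapsTo x hx), sub_self]
    rw [h.right_inv x hx, h0] at h1
    have h2 := congrArg (B x) h1
    rwa [h.left_inv x hx, map_zero] at h2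
  refine ⟨hP, ?_⟩
  have h3 := h.expand x hx (B x (u - P (g x) u))
  rw [hP, sub_zero, h.right_inv x hx] at h3
  have h4 := h.norm_compl _ (h.mapsTo x hx) u
  calc _ ≤ _ := h3
    _ ≤ κ * (C * ‖u‖) := mul_le_mul_of_nonneg_left h4 h.κ_nonneg
    _ = _ := by ring

theorem κ_mul_C (h : AdaptedSplitting g S P A B C M κ σ θ ε δ) : κ * C ≤ 1 / 16 := by
  have := h.one_le
  have := h.κ_small
  have : κ * C * 1 ≤ κ * C * C :=
    mul_le_mul_of_nonneg_left h.one_le (mul_nonneg h.κ_nonneg (by linarith))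
  nlinarith

/-- The operator on sequences of displacements whose fixed points are the orbits shadowing `x`. -/
def shadowOp (g : Equiv.Perm E) (P B : E → E →L[ℂ] E) (x : ℤ → E) (n : ℤ) (v : ℤ → E) : E :=
  let e : E := v (n + 1) - (g (x n + v n) - x (n + 1))
  P (x n) (g (x (n - 1) + v (n - 1)) - x n) +
    B (x n) ((e - P (x (n + 1)) e) - P (g (x n)) (e - P (x (n + 1)) e)) +
    (v n - P (x n) (v n))

theorem shadowOp_lipschitz (h : AdaptedSplitting g S P A B C M κ σ θ ε δ) {x : ℤ → E}
    (hx : ∀ n, x n ∈ S) (hjump : ∀ n, dist (g (x n)) (x (n + 1)) ≤ δ)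
    (v w : ℤ → E) (hv : ∀ n, ‖v n‖ ≤ ε) (hw : ∀ n, ‖w n‖ ≤ ε) (d : ℝ)
    (hd : ∀ n, ‖v n - w n‖ ≤ d) (n : ℤ) :
    ‖shadowOp g P B x n v - shadowOp g P B x n w‖ ≤ d / 2 := by
  have hd0 : 0 ≤ d := (norm_nonneg _).trans (hd 0)
  have hC := h.one_le
  have hC0 : 0 ≤ C := by linarith
  have hrem : ∀ k, ‖g (x k + v k) - g (x k + w k) - A (x k) (v k - w k)‖ ≤ θ * d := fun k =>
    (h.norm_remainder_le (hx k) (hv k) (hw k)).trans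
      (mul_le_mul_of_nonneg_left (hd k) h.θ_nonneg)
  have hA : ∀ k, ‖A (x k) (v k - w k)‖ ≤ M * d := fun k =>
    (h.norm_deriv _ (hx k) _).trans (mul_le_mul_of_nonneg_left (hd k) h.M_nonneg)
  have hosc : ∀ k u, ‖P (g (x k)) u - P (x (k + 1)) u‖ ≤ σ * ‖u‖ := fun k u =>
    h.osc_proj _ (h.mapsTo _ (hx k)) _ (hx _) (hjump k) u
  set r : ℤ → E := fun k => g (x k + v k) - g (x k + w k) - A (x k) (v k - w k) with hr
  set Δ : ℤ → E := fun k => v k - w k with hΔ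
  let L : E →ₗ[ℂ] E := ((B (x n)).comp (ContinuousLinearMap.id ℂ E - P (g (x n)))).toLinearMap
  have hL : ∀ u, L u = B (x n) (u - P (g (x n)) u) := fun u => by simp [L]
  have hLn : ∀ u, ‖L u‖ ≤ κ * C * ‖u‖ := fun u => by
    rw [hL]; exact (h.norm_inv_compl_le (hx n) u).2
  have hκC := h.κ_mul_C
  have hκC0 : 0 ≤ κ * C := mul_nonneg h.κ_nonneg hC0
  have hLA : ∀ u, L (A (x n) u) = u - P (x n) u := fun u => by
    rw [hL, ← h.comm _ (hx n), ← map_sub, h.left_inv _ (hx n)]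
  -- the stable part
  have e1 : ‖P (x n) (A (x (n - 1)) (Δ (n - 1)))‖ ≤ d / 8 := by
    have h1 := hosc (n - 1) (A (x (n - 1)) (Δ (n - 1)))
    rw [sub_add_cancel, ← h.comm _ (hx (n - 1))] at h1
    have h2 := h.contract _ (hx (n - 1)) (Δ (n - 1))
    have h3 := h.norm_proj _ (hx (n - 1)) (Δ (n - 1))
    have h4 := norm_sub_norm_le (P (x n) (A (x (n - 1)) (Δ (n - 1))))
      (A (x (n - 1)) (P (x (n - 1)) (Δ (n - 1))))
    rw [norm_sub_rev] at h4
    have h5 : κ * ‖P (x (n - 1)) (Δ (n - 1))‖ ≤ 1 / 16 * d :=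
      calc _ ≤ κ * (C * d) := mul_le_mul_of_nonneg_left
              (h3.trans (mul_le_mul_of_nonneg_left (hd _) hC0)) h.κ_nonneg
        _ = κ * C * d := by ring
        _ ≤ _ := mul_le_mul_of_nonneg_right hκC hd0
    have h6 : σ * ‖A (x (n - 1)) (Δ (n - 1))‖ ≤ 1 / 16 * d :=
      calc _ ≤ σ * (M * d) := mul_le_mul_of_nonneg_left (hA _) h.σ_nonneg
        _ = σ * M * d := by ring
        _ ≤ _ := mul_le_mul_of_nonneg_right h.σ_small hd0
    linarith
  have e2 : ‖P (x n) (r (n - 1))‖ ≤ d / 16 :=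
    calc _ ≤ C * (θ * d) := (h.norm_proj _ (hx n) _).trans
            (mul_le_mul_of_nonneg_left (hrem _) hC0)
      _ = C * θ * d := by ring
      _ ≤ 1 / 16 * d := mul_le_mul_of_nonneg_right h.θ_small hd0
      _ = _ := by ring
  -- the unstable part
  have hLQ : ∀ u, ‖L (u - P (x (n + 1)) u)‖ ≤ 1 / 16 * ‖u‖ := fun u =>
    calc _ ≤ κ * C * (C * ‖u‖) := (hLn _).trans
            (mul_le_mul_of_nonneg_left (h.norm_compl _ (hx _) u) hκC0)
      _ = κ * C ^ 2 * ‖u‖ := by ring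
      _ ≤ _ := mul_le_mul_of_nonneg_right h.κ_small (norm_nonneg _)
  have e3 : ‖L (Δ (n + 1) - P (x (n + 1)) (Δ (n + 1)))‖ ≤ d / 16 := by
    have h1 := hLQ (Δ (n + 1))
    have h2 := hd (n + 1)
    simp only [hΔ] at h1 ⊢
    linarith
  have e4 : ‖L (r n - P (x (n + 1)) (r n))‖ ≤ d / 16 := by
    have h1 := hLQ (r n)
    have h2 := hrem n
    have h3 : θ * d ≤ 1 / 16 * d := by
      refine mul_le_mul_of_nonneg_right ?_ hd0
      nlinarith [h.θ_small, h.θ_nonneg]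
    simp only [hr] at h1 ⊢
    linarith
  have e5 : ‖L (P (g (x n)) (A (x n) (Δ n)) - P (x (n + 1)) (A (x n) (Δ n)))‖ ≤ d / 16 := by
    have h1 := hLn (P (g (x n)) (A (x n) (Δ n)) - P (x (n + 1)) (A (x n) (Δ n)))
    have h2 := hosc n (A (x n) (Δ n))
    have h3 : σ * ‖A (x n) (Δ n)‖ ≤ 1 / 16 * d :=
      calc _ ≤ σ * (M * d) := mul_le_mul_of_nonneg_left (hA _) h.σ_nonneg
        _ = σ * M * d := by ring
        _ ≤ _ := mul_le_mul_of_nonneg_right h.σ_small hd0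
    calc _ ≤ _ := h1
      _ ≤ 1 / 16 * (1 / 16 * d) := mul_le_mul hκC (h2.trans h3) (norm_nonneg _) (by norm_num)
      _ ≤ _ := by linarith
  have hLid : L (A (x n) (Δ n) - P (x (n + 1)) (A (x n) (Δ n))) =
      (Δ n - P (x n) (Δ n)) +
        L (P (g (x n)) (A (x n) (Δ n)) - P (x (n + 1)) (A (x n) (Δ n))) := by
    have h1 : L (P (g (x n)) (A (x n) (Δ n))) = 0 := by
      rw [hL, h.idem _ (h.mapsTo _ (hx n)), sub_self, map_zero]
    rw [map_sub L, map_sub L, h1, hLA]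
    abel
  have hsplit : shadowOp g P B x n v - shadowOp g P B x n w =
      P (x n) (A (x (n - 1)) (Δ (n - 1))) + P (x n) (r (n - 1)) +
      L (Δ (n + 1) - P (x (n + 1)) (Δ (n + 1))) - L (r n - P (x (n + 1)) (r n)) -
      L (P (g (x n)) (A (x n) (Δ n)) - P (x (n + 1)) (A (x n) (Δ n))) := by
    have h1 : shadowOp g P B x n v - shadowOp g P B x n w =
        P (x n) (A (x (n - 1)) (Δ (n - 1)) + r (n - 1)) +
        L ((Δ (n + 1) - A (x n) (Δ n) - r n) -
          P (x (n + 1)) (Δ (n + 1) - A (x n) (Δ n) - r n)) + (Δ n - P (x n) (Δ n)) := by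
      have e : ∀ a b : E, P (x n) a - P (x n) b = P (x n) (a - b) := fun a b => (map_sub _ a b).symm
      simp only [shadowOp, hr, hΔ]
      simp only [← hL]
      simp only [map_sub, map_add]
      abel
    have h2 : (Δ (n + 1) - A (x n) (Δ n) - r n) -
          P (x (n + 1)) (Δ (n + 1) - A (x n) (Δ n) - r n) =
        (Δ (n + 1) - P (x (n + 1)) (Δ (n + 1))) -
        (A (x n) (Δ n) - P (x (n + 1)) (A (x n) (Δ n))) - (r n - P (x (n + 1)) (r n)) := by
      simp only [map_sub]
      abel
    rw [h1, h2, map_sub L, map_sub L, hLid, map_add]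
    abel
  rw [hsplit]
  refine (norm_sub_le _ _).trans ?_
  refine (add_le_add_left (norm_sub_le _ _) _).trans ?_
  refine (add_le_add_left (add_le_add_left (norm_add_le _ _) _) _).trans ?_
  refine (add_le_add_left (add_le_add_left (add_le_add_left (norm_add_le _ _) _) _) _).trans ?_
  linarith

theorem norm_shadowOp_zero_le (h : AdaptedSplitting g S P A B C M κ σ θ ε δ) {x : ℤ → E}
    (hx : ∀ n, x n ∈ S) {ρ : ℝ} (hjump : ∀ n, dist (g (x n)) (x (n + 1)) ≤ ρ) (n : ℤ) :
    ‖shadowOp g P B x n 0‖ ≤ 2 * C * ρ := by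
  have hC := h.one_le
  have hC0 : 0 ≤ C := by linarith
  have hρ : 0 ≤ ρ := dist_nonneg.trans (hjump 0)
  have h1 : ‖g (x (n - 1)) - x n‖ ≤ ρ := by
    have := hjump (n - 1)
    rwa [sub_add_cancel, dist_eq_norm] at this
  set e : E := 0 - (g (x n) - x (n + 1)) with he
  have h2 : ‖e‖ ≤ ρ := by
    have := hjump n
    rwa [dist_eq_norm, ← norm_neg, ← zero_sub] at this
  have h3 : ‖P (x n) (g (x (n - 1)) - x n)‖ ≤ C * ρ :=
    (h.norm_proj _ (hx n) _).trans (mul_le_mul_of_nonneg_left h1 hC0)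
  have h4 := (h.norm_inv_compl_le (hx n) (e - P (x (n + 1)) e)).2
  have h5 : ‖e - P (x (n + 1)) e‖ ≤ C * ρ :=
    (h.norm_compl _ (hx _) _).trans (mul_le_mul_of_nonneg_left h2 hC0)
  have h6 : κ * C * ‖e - P (x (n + 1)) e‖ ≤ 1 * (C * ρ) :=
    mul_le_mul (by linarith [h.κ_mul_C]) h5 (norm_nonneg _) (by norm_num)
  have h7 : shadowOp g P B x n 0 = P (x n) (g (x (n - 1)) - x n) +
      B (x n) ((e - P (x (n + 1)) e) - P (g (x n)) (e - P (x (n + 1)) e)) := by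
    simp [shadowOp, he]
  rw [h7]
  refine (norm_add_le _ _).trans ?_
  linarith

theorem shadowOp_fixed_iff (h : AdaptedSplitting g S P A B C M κ σ θ ε δ) {x : ℤ → E}
    (hx : ∀ n, x n ∈ S) (hjump : ∀ n, dist (g (x n)) (x (n + 1)) ≤ δ) (v : ℤ → E) :
    (∀ n, shadowOp g P B x n v = v n) ↔ ∀ n, g (x n + v n) = x (n + 1) + v (n + 1) := by
  constructor
  · intro hf
    set e : ℤ → E := fun n => v (n + 1) - (g (x n + v n) - x (n + 1)) with he
    have hK : ∀ n, P (x n) (e (n - 1)) =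
        B (x n) ((e n - P (x (n + 1)) (e n)) - P (g (x n)) (e n - P (x (n + 1)) (e n))) := by
      intro n
      have h1 := hf n
      simp only [shadowOp] at h1
      have h2 : e (n - 1) = v n - (g (x (n - 1) + v (n - 1)) - x n) := by
        simp only [he, sub_add_cancel]
      rw [h2, map_sub, sub_eq_iff_eq_add]
      have aux : ∀ a b c d : E, a + b + (c - d) = c → d = b + a := fun a b c d hab => by
        rw [← sub_eq_zero, ← neg_eq_zero, ← sub_eq_zero.2 hab]
        abel
      exact aux _ _ _ _ h1
    have hPe : ∀ n, P (x n) (e (n - 1)) = 0 := fun n => by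
      have h1 := h.idem _ (hx n) (e (n - 1))
      rw [← h1, hK n]
      exact (h.norm_inv_compl_le (hx n) _).1
    have hQe : ∀ n, e n - P (x (n + 1)) (e n) = 0 := fun n => by
      set q := e n - P (x (n + 1)) (e n) with hq
      have h1 : B (x n) (q - P (g (x n)) q) = 0 := by rw [← hK n, hPe n]
      have h2 := congrArg (A (x n)) h1
      rw [h.right_inv _ (hx n), map_zero] at h2
      have h3 := h.osc_proj _ (h.mapsTo _ (hx n)) _ (hx (n + 1)) (hjump n) q
      have h4 : P (x (n + 1)) q = 0 := by
        rw [hq, map_sub, h.idem _ (hx _), sub_self]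
      rw [h4, sub_zero, ← sub_eq_zero.1 h2] at h3
      have h5 := h.σ_lt_one
      have h6 := norm_nonneg q
      exact norm_le_zero_iff.1 (by nlinarith)
    intro n
    have h1 := hPe (n + 1)
    rw [add_sub_cancel_right] at h1
    have h2 := hQe n
    rw [h1, sub_zero] at h2
    simp only [he, sub_eq_zero] at h2
    rw [h2]
    abel
  · intro ho n
    have h1 : g (x (n - 1) + v (n - 1)) - x n = v n := by
      rw [ho (n - 1), sub_add_cancel, add_sub_cancel_left]
    have h2 : v (n + 1) - (g (x n + v n) - x (n + 1)) = 0 := by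
      rw [ho n, add_sub_cancel_left, sub_self]
    simp only [shadowOp, h1, h2, map_zero, sub_zero]
    abel

/-- Shadowing lemma. -/
theorem exists_shadow [CompleteSpace E] (h : AdaptedSplitting g S P A B C M κ σ θ ε δ) {x : ℤ → E}
    (hx : ∀ n, x n ∈ S) {ρ ε' : ℝ} (hρ : ρ ≤ δ) (hε' : ε' ≤ ε) (hρε : 4 * C * ρ ≤ ε')
    (hjump : ∀ n, dist (g (x n)) (x (n + 1)) ≤ ρ) :
    ∃ y : ℤ → E, (∀ n, g (y n) = y (n + 1)) ∧ ∀ n, dist (y n) (x n) ≤ ε' := by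
  have hρ0 : 0 ≤ ρ := dist_nonneg.trans (hjump 0)
  have hC := h.one_le
  have hjump' : ∀ n, dist (g (x n)) (x (n + 1)) ≤ δ := fun n => (hjump n).trans hρ
  have hε0 : 0 ≤ ε' := le_trans (by positivity) hρε
  obtain ⟨v, hv, hfv⟩ := exists_seq_fixedPoint (Φ := shadowOp g P B x) hε0
    (fun n => (h.norm_shadowOp_zero_le hx hjump n).trans (by linarith))
    (fun v w hv hw => h.shadowOp_lipschitz hx hjump' v w (fun n => (hv n).trans hε')
      (fun n => (hw n).trans hε'))
  exact ⟨fun n => x n + v n, (h.shadowOp_fixed_iff hx hjump' v).1 hfv,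
    fun n => by simpa [dist_eq_norm] using hv n⟩

/-- Uniqueness in the shadowing lemma. -/
theorem shadow_unique (h : AdaptedSplitting g S P A B C M κ σ θ ε δ) {x : ℤ → E}
    (hx : ∀ n, x n ∈ S) (hjump : ∀ n, dist (g (x n)) (x (n + 1)) ≤ δ) {y z : ℤ → E}
    (hy : ∀ n, g (y n) = y (n + 1)) (hz : ∀ n, g (z n) = z (n + 1))
    (hyx : ∀ n, dist (y n) (x n) ≤ ε) (hzx : ∀ n, dist (z n) (x n) ≤ ε) : y = z := by
  have key := seq_fixedPoint_unique (Φ := shadowOp g P B x) (ε := ε)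
    (h.shadowOp_lipschitz hx hjump) (v := fun n => y n - x n) (w := fun n => z n - x n)
    (fun n => by simpa [dist_eq_norm] using hyx n) (fun n => by simpa [dist_eq_norm] using hzx n)
    ((h.shadowOp_fixed_iff hx hjump _).2 fun n => by simpa using hy n)
    ((h.shadowOp_fixed_iff hx hjump _).2 fun n => by simpa using hz n)
  funext n
  exact sub_left_injective (congrFun key n)

end AdaptedSplitting

end Shadowing

section Cones

variable {E : Type*} [NormedAddCommGroup E] [NormedSpace ℂ E]

/-- The linear map `A` maps the unstable cone of the projection `P` into that of `P'`, expanding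
its unstable part, and its inverse does the same for the stable cones. -/
def PreservesCones (P P' A : E →L[ℂ] E) : Prop :=
  (∀ v, ‖P v‖ ≤ ‖v - P v‖ →
    ‖P' (A v)‖ ≤ ‖A v - P' (A v)‖ ∧ 2 * ‖v - P v‖ ≤ ‖A v - P' (A v)‖) ∧
  ∀ v, ‖A v - P' (A v)‖ ≤ ‖P' (A v)‖ → ‖v - P v‖ ≤ ‖P v‖ ∧ 2 * ‖P' (A v)‖ ≤ ‖P v‖

theorem PreservesCones.comp {P P' P'' A A' : E →L[ℂ] E} (h' : PreservesCones P' P'' A')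
    (h : PreservesCones P P' A) : PreservesCones P P'' (A'.comp A) := by
  constructor
  · intro v hv
    obtain ⟨h1, h2⟩ := h.1 v hv
    obtain ⟨h3, h4⟩ := h'.1 _ h1
    refine ⟨h3, ?_⟩
    simp only [ContinuousLinearMap.comp_apply]
    linarith [norm_nonneg (v - P v)]
  · intro v hv
    obtain ⟨h1, h2⟩ := h'.2 _ hv
    obtain ⟨h3, h4⟩ := h.2 _ h1
    have h5 : 2 * ‖P'' (A' (A v))‖ ≤ ‖P' (A v)‖ := h2
    refine ⟨h3, ?_⟩
    simp only [ContinuousLinearMap.comp_apply]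
    linarith [norm_nonneg (P' (A v))]

theorem AdaptedSplitting.preservesCones {g : Equiv.Perm E} {S : Set E}
    {P A B : E → E →L[ℂ] E} {C M κ σ θ ε δ : ℝ} (h : AdaptedSplitting g S P A B C M κ σ θ ε δ)
    {x x' y : E} (hx : x ∈ S) (hx' : x' ∈ S) (hjump : dist (g x) x' ≤ δ) (hy : dist y x ≤ ε) :
    PreservesCones (P x) (P x') (fderiv ℂ g y) := by
  have hC := h.one_le
  have hC0 : 0 ≤ C := by linarith
  set D := fderiv ℂ g y with hD
  have hκ16 : κ ≤ 1 / 16 := by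
    have h1 : κ * 1 ≤ κ * C := mul_le_mul_of_nonneg_left hC h.κ_nonneg
    linarith [h.κ_mul_C]
  have hdiff : ∀ v, ‖D v - A x v‖ ≤ θ * ‖v‖ := fun v =>
    ((D - A x).le_opNorm v).trans
      (mul_le_mul_of_nonneg_right (h.osc_deriv x hx y hy) (norm_nonneg _))
  have hCθ : ∀ v : E, C * (θ * ‖v‖) ≤ 1 / 16 * ‖v‖ := fun v => by
    rw [← mul_assoc]; exact mul_le_mul_of_nonneg_right h.θ_small (norm_nonneg _)
  have hosc : ∀ v, ‖P (g x) (A x v) - P x' (A x v)‖ ≤ 1 / 16 * ‖v‖ := fun v =>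
    calc _ ≤ σ * ‖A x v‖ := h.osc_proj _ (h.mapsTo _ hx) _ hx' hjump _
      _ ≤ σ * (M * ‖v‖) := mul_le_mul_of_nonneg_left (h.norm_deriv _ hx v) h.σ_nonneg
      _ = σ * M * ‖v‖ := by ring
      _ ≤ _ := mul_le_mul_of_nonneg_right h.σ_small (norm_nonneg _)
  have hstab : ∀ v, ‖P x' (D v)‖ ≤ 1 / 16 * ‖P x v‖ + 1 / 8 * ‖v‖ := fun v => by
    have h1 : P x' (D v) = A x (P x v) + (P x' (D v - A x v) -
        (P (g x) (A x v) - P x' (A x v))) := by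
      rw [h.comm x hx, map_sub]; abel
    have h2 := (h.norm_proj x' hx' (D v - A x v)).trans
      ((mul_le_mul_of_nonneg_left (hdiff v) hC0).trans (hCθ v))
    have h3 := norm_sub_le (P x' (D v - A x v)) (P (g x) (A x v) - P x' (A x v))
    have h4 := norm_add_le (A x (P x v)) (P x' (D v - A x v) - (P (g x) (A x v) - P x' (A x v)))
    have h5 := (h.contract x hx v).trans (mul_le_mul_of_nonneg_right hκ16 (norm_nonneg _))
    rw [h1]
    linarith [hosc v]
  have hunst : ∀ v, 16 * ‖v - P x v‖ - 1 / 8 * ‖v‖ ≤ ‖D v - P x' (D v)‖ := fun v => by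
    have h1 : A x (v - P x v) = (D v - P x' (D v)) - (((D v - A x v) - P x' (D v - A x v)) +
        (P (g x) (A x v) - P x' (A x v))) := by
      rw [map_sub, h.comm x hx, map_sub]; abel
    have h2 := (h.norm_compl x' hx' (D v - A x v)).trans
      ((mul_le_mul_of_nonneg_left (hdiff v) hC0).trans (hCθ v))
    have h3 := norm_add_le ((D v - A x v) - P x' (D v - A x v)) (P (g x) (A x v) - P x' (A x v))
    have h4 := norm_sub_le (D v - P x' (D v)) (((D v - A x v) - P x' (D v - A x v)) +
        (P (g x) (A x v) - P x' (A x v)))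
    have h5 := (h.expand x hx v).trans (mul_le_mul_of_nonneg_right hκ16 (norm_nonneg _))
    rw [← h1] at h4
    linarith [hosc v]
  have hnorm : ∀ v, ‖v‖ ≤ ‖P x v‖ + ‖v - P x v‖ := fun v => by
    simpa using norm_add_le (P x v) (v - P x v)
  constructor
  · intro v hv
    have := hstab v
    have := hunst v
    have := hnorm v
    constructor <;> linarith [norm_nonneg (v - P x v), norm_nonneg (P x v)]
  · intro v hv
    have := hstab v
    have := hunst v
    have := hnorm v
    constructor <;> linarith [norm_nonneg (v - P x v), norm_nonneg (P x v)]

/-- A linear map with a forward orbit bounded away from zero has an eigenvalue outside the open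
unit disk. -/
theorem exists_eigenvector_one_le [FiniteDimensional ℂ E] (L : E →L[ℂ] E) {v : E} {c : ℝ}
    (hc : 0 < c) (hL : ∀ n : ℕ, c ≤ ‖(L ^ n) v‖) :
    ∃ (w : E) (μ : ℂ), w ≠ 0 ∧ L w = μ • w ∧ 1 ≤ ‖μ‖ := by
  have hv : v ≠ 0 := by
    rintro rfl
    have := hL 0
    simp only [map_zero, norm_zero] at this
    linarith
  have : Nontrivial E := ⟨v, 0, hv⟩
  have : CompleteSpace E := FiniteDimensional.complete ℂ E
  obtain ⟨μ, hμ, hμr⟩ := spectrum.exists_nnnorm_eq_spectralRadius L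
  have hμ1 : 1 ≤ ‖μ‖ := by
    by_contra! hlt
    obtain ⟨r, hr1, hr2⟩ := exists_between hlt
    have hr0 : 0 ≤ r := (norm_nonneg μ).trans hr1.le
    have hlim := spectrum.pow_norm_pow_one_div_tendsto_nhds_spectralRadius L
    have hlt' : spectralRadius ℂ L < ENNReal.ofReal r := by
      have hof : (‖μ‖₊ : ENNReal) = ENNReal.ofReal ‖μ‖ := (ofReal_norm μ).symm
      rw [← hμr, hof]
      exact (ENNReal.ofReal_lt_ofReal_iff (lt_of_le_of_lt (norm_nonneg μ) hr1)).2 hr1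
    have hev : ∀ᶠ n : ℕ in atTop, c ≤ r ^ n * ‖v‖ := by
      filter_upwards [hlim.eventually_lt_const hlt', eventually_gt_atTop 0] with n hn hn0
      have h1 := (ENNReal.ofReal_lt_ofReal_iff (lt_of_le_of_lt (norm_nonneg μ) hr1)).1 hn
      have h2 : ‖L ^ n‖ ≤ r ^ n := by
        have h3 := pow_le_pow_left₀ (by positivity) h1.le n
        rwa [← Real.rpow_natCast, ← Real.rpow_mul (norm_nonneg _), one_div,
          inv_mul_cancel₀ (by positivity), Real.rpow_one] at h3
      exact (hL n).trans (((L ^ n).le_opNorm v).trans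
        (mul_le_mul_of_nonneg_right h2 (norm_nonneg _)))
    have hz : Tendsto (fun n : ℕ => r ^ n * ‖v‖) atTop (𝓝 0) := by
      simpa using (tendsto_pow_atTop_nhds_zero_of_lt_one hr0 hr2).mul_const ‖v‖
    linarith [ge_of_tendsto hz hev]
  rw [ContinuousLinearMap.spectrum_eq, ← Module.End.hasEigenvalue_iff_mem_spectrum] at hμ
  obtain ⟨w, hw⟩ := hμ.exists_hasEigenvector
  exact ⟨w, μ, hw.2, hw.apply_eq_smul, hμ1⟩

/-- An invertible linear map preserving a pair of nontrivial cones is a saddle. -/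
theorem PreservesCones.exists_eigenvectors [FiniteDimensional ℂ E] {P M N : E →L[ℂ] E}
    (h : PreservesCones P P M) (hMN : ∀ v, M (N v) = v)
    {s u : E} (hs : s ≠ 0) (hPs : P s = s) (hu : u ≠ 0) (hPu : P u = 0) :
    ∃ (v₁ v₂ : E) (μ₁ μ₂ : ℂ), v₁ ≠ 0 ∧ v₂ ≠ 0 ∧ M v₁ = μ₁ • v₁ ∧ M v₂ = μ₂ • v₂ ∧
      ‖μ₁‖ < 1 ∧ 1 < ‖μ₂‖ := by
  have dich : ∀ (w : E) (μ : ℂ), w ≠ 0 → M w = μ • w → ‖μ‖ < 1 ∨ 1 < ‖μ‖ := by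
    intro w μ hw hMw
    have hsm : M w - P (M w) = μ • (w - P w) := by rw [hMw, map_smul, smul_sub]
    have hsm' : P (M w) = μ • P w := by rw [hMw, map_smul]
    rcases le_or_gt ‖P w‖ ‖w - P w‖ with hc | hc
    · right
      have h1 := (h.1 w hc).2
      rw [hsm, norm_smul] at h1
      have h2 : 0 < ‖w - P w‖ := by
        refine lt_of_le_of_ne (norm_nonneg _) fun h0 => hw ?_
        rw [← h0] at hc
        have h3 := norm_le_zero_iff.1 hc
        rw [h3, sub_zero] at h0
        exact norm_eq_zero.1 h0.symm
      nlinarith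
    · left
      have h1 := (h.2 w (by
        rw [hsm, hsm', norm_smul, norm_smul]
        exact mul_le_mul_of_nonneg_left hc.le (norm_nonneg _))).2
      rw [hsm', norm_smul] at h1
      have h2 : 0 < ‖P w‖ := (norm_nonneg _).trans_lt hc
      nlinarith
  have hunst : ∀ n : ℕ, ‖P ((M ^ n) u)‖ ≤ ‖(M ^ n) u - P ((M ^ n) u)‖ ∧
      ‖u‖ ≤ ‖(M ^ n) u - P ((M ^ n) u)‖ := by
    intro n
    induction n with
    | zero => simp [hPu]
    | succ n ih =>
      rw [pow_succ']
      obtain ⟨h1, h2⟩ := h.1 _ ih.1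
      refine ⟨h1, ?_⟩
      simp only [mul_apply_eq_comp]
      linarith [norm_nonneg u]
  have hstab : ∀ n : ℕ, ‖(N ^ n) s - P ((N ^ n) s)‖ ≤ ‖P ((N ^ n) s)‖ ∧
      ‖s‖ ≤ ‖P ((N ^ n) s)‖ := by
    intro n
    induction n with
    | zero => simp [hPs]
    | succ n ih =>
      rw [pow_succ']
      obtain ⟨h1, h2⟩ := h.2 (N ((N ^ n) s)) (by rw [hMN]; exact ih.1)
      rw [hMN] at h2
      refine ⟨h1, ?_⟩
      simp only [mul_apply_eq_comp]
      linarith [norm_nonneg s]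
  have hbound : ∀ (T : E →L[ℂ] E) (a z : E), a ≠ 0 → ‖a‖ ≤ ‖T z‖ → ‖a‖ / (‖T‖ + 1) ≤ ‖z‖ := by
    intro T a z _ haz
    rw [div_le_iff₀ (by positivity)]
    linarith [T.le_opNorm z, norm_nonneg z]
  obtain ⟨v₂, μ₂, hv₂, hMv₂, hμ₂⟩ := exists_eigenvector_one_le M (v := u)
    (c := ‖u‖ / (‖ContinuousLinearMap.id ℂ E - P‖ + 1))
    (div_pos (norm_pos_iff.2 hu) (by positivity)) fun n =>
      hbound (ContinuousLinearMap.id ℂ E - P) u _ hu (hunst n).2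
  obtain ⟨v₁, ν, hv₁, hNv₁, hν⟩ := exists_eigenvector_one_le N (v := s) (c := ‖s‖ / (‖P‖ + 1))
    (div_pos (norm_pos_iff.2 hs) (by positivity)) fun n => hbound P s _ hs (hstab n).2
  have hν0 : ν ≠ 0 := norm_pos_iff.1 (by linarith)
  have hMv₁ : M v₁ = ν⁻¹ • v₁ := by
    have h1 := congrArg M hNv₁
    rw [hMN, map_smul] at h1
    rw [eq_inv_smul_iff₀ hν0]
    exact h1.symm
  refine ⟨v₁, v₂, ν⁻¹, μ₂, hv₁, hv₂, hMv₁, hMv₂, ?_, ?_⟩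
  · have h1 : ‖ν⁻¹‖ ≤ 1 := by rw [norm_inv]; exact inv_le_one_of_one_le₀ hν
    exact (dich v₁ _ hv₁ hMv₁).resolve_right (not_lt.2 h1)
  · exact (dich v₂ _ hv₂ hMv₂).resolve_left (not_lt.2 hμ₂)

end Cones

section Projections

variable {E : Type*} [NormedAddCommGroup E] [NormedSpace ℂ E] [FiniteDimensional ℂ E]

/-- The projections of a continuous splitting over a compact set are uniformly bounded and
uniformly continuous. -/
theorem exists_projections {S : Set E} (hS : IsCompact S) {Es Eu : E → Submodule ℂ E}
    (hcompl : ∀ x ∈ S, IsCompl (Es x) (Eu x))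
    (hEs : IsClosed {q : E × E | q.1 ∈ S ∧ q.2 ∈ Es q.1})
    (hEu : IsClosed {q : E × E | q.1 ∈ S ∧ q.2 ∈ Eu q.1}) :
    ∃ (P : E → E →L[ℂ] E) (C : ℝ), 1 ≤ C ∧
      (∀ x ∈ S, ∀ v, P x v ∈ Es x) ∧ (∀ x ∈ S, ∀ v, v - P x v ∈ Eu x) ∧
      (∀ x ∈ S, ∀ v, ‖P x v‖ ≤ C * ‖v‖) ∧ (∀ x ∈ S, ∀ v, ‖v - P x v‖ ≤ C * ‖v‖) ∧
      ∀ σ > 0, ∃ δ > 0, ∀ x ∈ S, ∀ y ∈ S, dist x y ≤ δ → ∀ v, ‖P x v - P y v‖ ≤ σ * ‖v‖ := by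
  classical
  have : ProperSpace E := FiniteDimensional.proper ℂ E
  let P : E → E →L[ℂ] E := fun x =>
    if h : IsCompl (Es x) (Eu x) then
      LinearMap.toContinuousLinearMap ((Es x).projection (Eu x) h) else 0
  have hP : ∀ x (hx : x ∈ S) v, P x v = (Es x).projection (Eu x) (hcompl x hx) v := by
    intro x hx v
    simp [P, hcompl x hx]
  have hPs : ∀ x ∈ S, ∀ v, P x v ∈ Es x := fun x hx v => by
    rw [hP x hx]; exact Submodule.projection_apply_mem _ _
  have hPu : ∀ x ∈ S, ∀ v, v - P x v ∈ Eu x := fun x hx v => by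
    rw [hP x hx]; exact Submodule.sub_projection_mem _ _
  have hzero : ∀ x ∈ S, ∀ v, v ∈ Es x → v ∈ Eu x → v = 0 := fun x hx v h1 h2 =>
    Submodule.disjoint_def.1 (hcompl x hx).disjoint v h1 h2
  have hbound : ∃ C : ℝ, 0 ≤ C ∧ ∀ x ∈ S, ∀ v, ‖P x v‖ ≤ C * ‖v‖ := by
    by_contra! hcon
    choose x hx v hv using fun n : ℕ => hcon (n + 1) (by positivity)
    have hpos : ∀ n, 0 < ‖P (x n) (v n)‖ := fun n => lt_of_le_of_lt (by positivity) (hv n)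
    let t : ℕ → ℂ := fun n => ((‖P (x n) (v n)‖⁻¹ : ℝ) : ℂ)
    have ht : ∀ n, ‖t n‖ = ‖P (x n) (v n)‖⁻¹ := fun n => by simp [t]
    let a : ℕ → E := fun n => t n • P (x n) (v n)
    let b : ℕ → E := fun n => t n • v n
    have ha : ∀ n, ‖a n‖ = 1 := fun n => by
      simp only [a]; rw [norm_smul, ht, inv_mul_cancel₀ (hpos n).ne']
    have hb : ∀ n, ‖b n‖ ≤ 1 / ((n : ℝ) + 1) := fun n => by
      simp only [b]
      rw [norm_smul, ht, inv_mul_le_iff₀ (hpos n), mul_one_div, le_div_iff₀ (by positivity),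
        mul_comm]
      exact (hv n).le
    have hb0 : Tendsto b atTop (𝓝 0) :=
      squeeze_zero_norm hb tendsto_one_div_add_atTop_nhds_zero_nat
    obtain ⟨⟨y, c⟩, ⟨hy, -⟩, φ, hφ, hlim⟩ := (hS.prod (isCompact_closedBall (0 : E) 1)).tendsto_subseq
      (x := fun n => (x n, a n)) (fun n => ⟨hx n, by simpa using (ha n).le⟩)
    have hx' : Tendsto (fun n => x (φ n)) atTop (𝓝 y) := (Prod.tendsto_iff _ _).1 hlim |>.1
    have ha' : Tendsto (fun n => a (φ n)) atTop (𝓝 c) := (Prod.tendsto_iff _ _).1 hlim |>.2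
    have hba : Tendsto (fun n => b (φ n) - a (φ n)) atTop (𝓝 (0 - c)) :=
      (hb0.comp hφ.tendsto_atTop).sub ha'
    have h1 := (hEs.mem_of_tendsto hlim (Eventually.of_forall fun n =>
      ⟨hx _, (Es _).smul_mem _ (hPs _ (hx _) _)⟩)).2
    have h2 := (hEu.mem_of_tendsto (hx'.prodMk_nhds hba) (Eventually.of_forall fun n =>
      ⟨hx _, by
        simp only [a, b]; rw [← smul_sub]; exact (Eu _).smul_mem _ (hPu _ (hx _) _)⟩)).2
    have h3 : c = 0 := hzero y hy c h1 (by simpa using (Eu y).neg_mem h2)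
    have h4 := tendsto_nhds_unique (ha'.norm) (tendsto_const_nhds.congr fun n => (ha (φ n)).symm)
    rw [h3, norm_zero] at h4
    exact zero_ne_one h4
  obtain ⟨C, hC0, hC⟩ := hbound
  refine ⟨P, C + 1, by linarith, hPs, hPu, fun x hx v => (hC x hx v).trans ?_,
    fun x hx v => (norm_sub_le _ _).trans ?_, ?_⟩
  · nlinarith [norm_nonneg v]
  · linarith [hC x hx v]
  intro σ hσ
  by_contra! hcon
  choose x hx y hy hxy v hv using fun n : ℕ => hcon (1 / ((n : ℝ) + 1)) (by positivity)
  have hpos : ∀ n, 0 < ‖v n‖ := fun n => norm_pos_iff.2 fun h0 => by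
    have := hv n
    simp [h0] at this
  let t : ℕ → ℂ := fun n => ((‖v n‖⁻¹ : ℝ) : ℂ)
  have ht : ∀ n, ‖t n‖ = ‖v n‖⁻¹ := fun n => by simp [t]
  let w : ℕ → E := fun n => t n • v n
  have hw : ∀ n, ‖w n‖ = 1 := fun n => by
    simp only [w]; rw [norm_smul, ht, inv_mul_cancel₀ (hpos n).ne']
  have hσw : ∀ n, σ ≤ ‖P (x n) (w n) - P (y n) (w n)‖ := fun n => by
    simp only [w]
    rw [map_smul, map_smul, ← smul_sub, norm_smul, ht, inv_mul_eq_div, le_div_iff₀ (hpos n)]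
    exact (hv n).le
  have hCw : ∀ z ∈ S, ∀ n, P z (w n) ∈ closedBall (0 : E) C := fun z hz n => by
    have := hC z hz (w n)
    rw [hw, mul_one] at this
    simpa using this
  obtain ⟨⟨x', y', w', a, b⟩, ⟨hx', -⟩, φ, hφ, hlim⟩ :=
    (hS.prod (hS.prod ((isCompact_closedBall (0 : E) 1).prod ((isCompact_closedBall (0 : E) C).prod
      (isCompact_closedBall (0 : E) C))))).tendsto_subseq
      (x := fun n => (x n, y n, w n, P (x n) (w n), P (y n) (w n)))
      (fun n => ⟨hx n, hy n, by simpa using (hw n).le, hCw _ (hx n) n, hCw _ (hy n) n⟩)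
  simp only [Prod.tendsto_iff, Function.comp_def] at hlim
  obtain ⟨hlx, hly, hlw, hla, hlb⟩ := hlim
  have hxy' : y' = x' := by
    have h1 : Tendsto (fun n => dist (x (φ n)) (y (φ n))) atTop (𝓝 (dist x' y')) := hlx.dist hly
    have h2 : Tendsto (fun n => dist (x (φ n)) (y (φ n))) atTop (𝓝 0) :=
      (squeeze_zero (fun _ => dist_nonneg) hxy
        tendsto_one_div_add_atTop_nhds_zero_nat).comp hφ.tendsto_atTop
    exact (dist_eq_zero.1 (tendsto_nhds_unique h1 h2)).symm
  have h1 := (hEs.mem_of_tendsto (hlx.prodMk_nhds hla) (Eventually.of_forall fun n =>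
    ⟨hx _, hPs _ (hx _) _⟩)).2
  have h2 := (hEs.mem_of_tendsto (hly.prodMk_nhds hlb) (Eventually.of_forall fun n =>
    ⟨hy _, hPs _ (hy _) _⟩)).2
  have h3 := (hEu.mem_of_tendsto (hlx.prodMk_nhds (hlw.sub hla)) (Eventually.of_forall fun n =>
    ⟨hx _, hPu _ (hx _) _⟩)).2
  have h4 := (hEu.mem_of_tendsto (hly.prodMk_nhds (hlw.sub hlb)) (Eventually.of_forall fun n =>
    ⟨hy _, hPu _ (hy _) _⟩)).2
  simp only [hxy'] at h1 h2 h3 h4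
  have h5 : a - b = 0 := hzero x' hx' _ ((Es x').sub_mem h1 h2) (by
    simpa using (Eu x').sub_mem h4 h3)
  have h6 : σ ≤ ‖a - b‖ := ge_of_tendsto (hla.sub hlb).norm (Eventually.of_forall fun n => hσw _)
  rw [h5, norm_zero] at h6
  linarith

end Projections

section Splitting

variable {E : Type*} [NormedAddCommGroup E] [NormedSpace ℂ E]

theorem contDiff_iterate {f : E → E} (hf : ContDiff ℂ 1 f) (n : ℕ) : ContDiff ℂ 1 (f^[n]) := by
  induction n with
  | zero => exact contDiff_id
  | succ n ih => exact ih.comp hf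

theorem fderiv_iterate_mem {f : E → E} (hf : Differentiable ℂ f) {S : Set E}
    (hS : ∀ x ∈ S, f x ∈ S) {F : E → Submodule ℂ E}
    (hF : ∀ x ∈ S, ∀ v ∈ F x, fderiv ℂ f x v ∈ F (f x)) (n : ℕ) {x : E} (hx : x ∈ S) {v : E}
    (hv : v ∈ F x) : f^[n] x ∈ S ∧ fderiv ℂ (f^[n]) x v ∈ F (f^[n] x) := by
  induction n with
  | zero => simpa using ⟨hx, hv⟩
  | succ n ih =>
    rw [Function.iterate_succ', fderiv_comp x (hf _) (hf.iterate n x)]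
    exact ⟨hS _ ih.1, hF _ ih.1 _ ih.2⟩

/-- A sufficiently high iterate of a diffeomorphism which is uniformly hyperbolic on a compact set
admits an adapted splitting. -/
theorem exists_adaptedSplitting [FiniteDimensional ℂ E] (e : Equiv.Perm E) (he : ContDiff ℂ 1 e)
    (he' : ContDiff ℂ 1 e.symm) {S : Set E} (hS : IsCompact S) (heS : ∀ x ∈ S, e x ∈ S)
    {Es Eu : E → Submodule ℂ E} {c lam : ℝ} (hc : 0 < c) (hlam : 0 < lam) (hlam1 : lam < 1)
    (hEs1 : ∀ x ∈ S, Es x ≠ ⊥) (hEu1 : ∀ x ∈ S, Eu x ≠ ⊥)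
    (hcompl : ∀ x ∈ S, IsCompl (Es x) (Eu x))
    (hEs : IsClosed {q : E × E | q.1 ∈ S ∧ q.2 ∈ Es q.1})
    (hEu : IsClosed {q : E × E | q.1 ∈ S ∧ q.2 ∈ Eu q.1})
    (hDEs : ∀ x ∈ S, ∀ v ∈ Es x, fderiv ℂ e x v ∈ Es (e x))
    (hDEu : ∀ x ∈ S, ∀ v ∈ Eu x, fderiv ℂ e x v ∈ Eu (e x))
    (hcontr : ∀ x ∈ S, ∀ v ∈ Es x, ∀ n : ℕ, 1 ≤ n →
      ‖fderiv ℂ (e^[n]) x v‖ ≤ (lam ^ n / c) * ‖v‖)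
    (hexp : ∀ x ∈ S, ∀ v ∈ Eu x, ∀ n : ℕ, 1 ≤ n →
      ‖fderiv ℂ (e^[n]) x v‖ ≥ (c / lam ^ n) * ‖v‖) :
    ∃ (m : ℕ) (P A B : E → E →L[ℂ] E) (C M κ σ θ ε δ : ℝ), 1 ≤ m ∧ 0 < ε ∧ 0 < δ ∧
      AdaptedSplitting (e ^ m) S P A B C M κ σ θ ε δ ∧
      ∀ x ∈ S, (∃ s, s ≠ 0 ∧ P x s = s) ∧ ∃ u, u ≠ 0 ∧ P x u = 0 := by
  obtain ⟨P, C, hC, hPs, hPu, hPn, hQn, hosc⟩ := exists_projections hS hcompl hEs hEu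
  have hC0 : 0 < C := by linarith
  have hzero : ∀ x ∈ S, ∀ v, v ∈ Es x → v ∈ Eu x → v = 0 := fun x hx v h1 h2 =>
    Submodule.disjoint_def.1 (hcompl x hx).disjoint v h1 h2
  have hPuniq : ∀ x ∈ S, ∀ v a, a ∈ Es x → v - a ∈ Eu x → P x v = a := by
    intro x hx v a ha hva
    refine sub_eq_zero.1 (hzero x hx _ ((Es x).sub_mem (hPs x hx v) ha) ?_)
    simpa using (Eu x).sub_mem hva (hPu x hx v)
  obtain ⟨κ, hκ0, hκ⟩ : ∃ κ : ℝ, 0 < κ ∧ κ * C ^ 2 ≤ 1 / 16 :=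
    ⟨1 / 16 / C ^ 2, by positivity, by rw [div_mul_cancel₀ _ (by positivity)]⟩
  obtain ⟨m, hm1, hm⟩ : ∃ m : ℕ, 1 ≤ m ∧ lam ^ m / c ≤ κ := by
    have h1 := (tendsto_pow_atTop_nhds_zero_of_lt_one hlam.le hlam1).div_const c
    rw [zero_div] at h1
    obtain ⟨m, h2, h3⟩ := ((h1.eventually_lt_const hκ0).and (eventually_ge_atTop 1)).exists
    exact ⟨m, h3, h2.le⟩
  set g : Equiv.Perm E := e ^ m with hg
  have hgi : ⇑g = e^[m] := (Equiv.Perm.iterate_eq_pow e m).symm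
  have hgi' : ⇑g.symm = e.symm^[m] := by
    have h1 : g.symm = e.symm ^ m := by
      change (e ^ m)⁻¹ = (e⁻¹) ^ m
      rw [inv_pow]
    rw [h1, Equiv.Perm.iterate_eq_pow]
  have hgd : ContDiff ℂ 1 g := by rw [hgi]; exact contDiff_iterate he m
  have hgd' : ContDiff ℂ 1 g.symm := by rw [hgi']; exact contDiff_iterate he' m
  have hgdiff : Differentiable ℂ g := hgd.differentiable one_ne_zero
  have hgdiff' : Differentiable ℂ g.symm := hgd'.differentiable one_ne_zero
  have hcont : Continuous (fderiv ℂ g) := hgd.continuous_fderiv one_ne_zero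
  have hediff : Differentiable ℂ e := he.differentiable one_ne_zero
  have hAs : ∀ x ∈ S, ∀ v ∈ Es x, g x ∈ S ∧ fderiv ℂ g x v ∈ Es (g x) := fun x hx v hv => by
    rw [hgi]; exact fderiv_iterate_mem hediff heS hDEs m hx hv
  have hAu : ∀ x ∈ S, ∀ v ∈ Eu x, g x ∈ S ∧ fderiv ℂ g x v ∈ Eu (g x) := fun x hx v hv => by
    rw [hgi]; exact fderiv_iterate_mem hediff heS hDEu m hx hv
  have hgS : ∀ x ∈ S, g x ∈ S := fun x hx => (hAs x hx 0 (Es x).zero_mem).1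
  obtain ⟨M, hM⟩ := hS.exists_bound_of_continuousOn hcont.continuousOn
  set M' := max M 0 with hM'
  have hM0 : 0 ≤ M' := le_max_right _ _
  obtain ⟨σ, hσ0, hσ1, hσM⟩ : ∃ σ : ℝ, 0 < σ ∧ σ < 1 ∧ σ * M' ≤ 1 / 16 := by
    refine ⟨1 / (16 * (M' + 1)), by positivity, ?_, ?_⟩
    · rw [div_lt_one (by positivity)]; linarith
    · rw [div_mul_eq_mul_div, div_le_div_iff₀ (by positivity) (by norm_num)]; linarith
  obtain ⟨δ, hδ, hδσ⟩ := hosc σ hσ0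
  obtain ⟨θ, hθ0, hθ⟩ : ∃ θ : ℝ, 0 < θ ∧ C * θ ≤ 1 / 16 :=
    ⟨1 / 16 / C, by positivity, by rw [mul_div_cancel₀ _ hC0.ne']⟩
  obtain ⟨ε, hε, hεθ⟩ : ∃ ε > 0, ∀ x ∈ S, ∀ y, dist y x ≤ ε →
      ‖fderiv ℂ g y - fderiv ℂ g x‖ ≤ θ := by
    have h1 := hS.uniformContinuousAt_of_continuousAt (fderiv ℂ g)
      (fun x _ => hcont.continuousAt) (dist_mem_uniformity hθ0)
    obtain ⟨ε, hε, h2⟩ := mem_uniformity_dist.1 h1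
    refine ⟨ε / 2, by positivity, fun x hx y hyx => ?_⟩
    have h3 : dist x y < ε := by rw [dist_comm]; linarith
    have h4 : dist (fderiv ℂ g x) (fderiv ℂ g y) < θ := h2 h3 hx
    rw [dist_comm, dist_eq_norm] at h4
    exact h4.le
  refine ⟨m, P, fderiv ℂ g, fun x => fderiv ℂ g.symm (g x), C, M', κ, σ, θ, ε, δ, hm1, hε, hδ,
    ?_, ?_⟩
  · have hBA : ∀ x, (fderiv ℂ g.symm (g x)).comp (fderiv ℂ g x) = ContinuousLinearMap.id ℂ E := by
      intro x
      rw [← fderiv_comp x (hgdiff' _) (hgdiff _), Equiv.symm_comp_self, fderiv_id]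
    have hAB : ∀ x, (fderiv ℂ g x).comp (fderiv ℂ g.symm (g x)) = ContinuousLinearMap.id ℂ E := by
      intro x
      have h1 := fderiv_comp (𝕜 := ℂ) (g x) (hgdiff (g.symm (g x))) (hgdiff' (g x))
      rw [Equiv.self_comp_symm, fderiv_id, Equiv.symm_apply_apply] at h1
      exact h1.symm
    refine
      { mapsTo := hgS
        idem := fun x hx v => hPuniq x hx _ _ (hPs x hx v) (by simp)
        comm := fun x hx v => (hPuniq _ (hgS x hx) _ _ (hAs x hx _ (hPs x hx v)).2 (by
          rw [← map_sub]; exact (hAu x hx _ (hPu x hx v)).2)).symm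
        left_inv := fun x _ v => congrArg (fun T : E →L[ℂ] E => T v) (hBA x)
        right_inv := fun x _ v => congrArg (fun T : E →L[ℂ] E => T v) (hAB x)
        contract := fun x hx v => ?_
        expand := fun x hx v => ?_
        norm_proj := hPn
        norm_compl := hQn
        norm_deriv := fun x hx v => ((fderiv ℂ g x).le_opNorm v).trans
          (mul_le_mul_of_nonneg_right ((hM x hx).trans (le_max_left _ _)) (norm_nonneg _))
        osc_proj := hδσ
        differentiable := hgdiff
        osc_deriv := hεθ
        one_le := hC
        M_nonneg := hM0
        κ_nonneg := hκ0.le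
        κ_small := hκ
        σ_nonneg := hσ0.le
        σ_small := hσM
        σ_lt_one := hσ1
        θ_nonneg := hθ0.le
        θ_small := hθ }
    · rw [hgi]
      exact (hcontr x hx _ (hPs x hx v) m hm1).trans
        (mul_le_mul_of_nonneg_right hm (norm_nonneg _))
    · have h1 := hexp x hx _ (hPu x hx v) m hm1
      rw [← hgi, ge_iff_le, div_mul_eq_mul_div, div_le_iff₀ (by positivity)] at h1
      have h2 : ‖v - P x v‖ ≤ lam ^ m / c * ‖fderiv ℂ g x (v - P x v)‖ := by
        rw [div_mul_eq_mul_div, le_div_iff₀ hc]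
        linarith
      exact h2.trans (mul_le_mul_of_nonneg_right hm (norm_nonneg _))
  · intro x hx
    obtain ⟨s, hs, hs0⟩ := Submodule.exists_mem_ne_zero_of_ne_bot (hEs1 x hx)
    obtain ⟨u, hu, hu0⟩ := Submodule.exists_mem_ne_zero_of_ne_bot (hEu1 x hx)
    exact ⟨⟨s, hs0, hPuniq x hx _ _ hs (by simp)⟩,
      ⟨u, hu0, hPuniq x hx _ _ (Es x).zero_mem (by simpa using hu)⟩⟩

end Splitting

section Henon

theorem ElemHenon.leftInverse (h : ElemHenon) : Function.LeftInverse h.invFun h.toFun := by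
  intro p
  have ha := h.ha
  have hb := h.hb
  simp [ElemHenon.invFun, ElemHenon.toFun, ha, hb]

theorem ElemHenon.rightInverse (h : ElemHenon) : Function.RightInverse h.invFun h.toFun := by
  intro p
  have ha := h.ha
  have hb := h.hb
  simp [ElemHenon.invFun, ElemHenon.toFun, mul_div_cancel₀, ha, hb]

theorem Polynomial.contDiff_eval_comp {E : Type*} [NormedAddCommGroup E] [NormedSpace ℂ E]
    (P : Polynomial ℂ) {f : E → ℂ} (hf : ContDiff ℂ 1 f) :
    ContDiff ℂ 1 fun x => P.eval (f x) := by
  have h := (Polynomial.contDiff_aeval (𝕜 := ℂ) (f := P) 1).comp hf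
  simpa [Function.comp_def] using h

theorem ElemHenon.contDiff_toFun (h : ElemHenon) : ContDiff ℂ 1 h.toFun :=
  ((h.P.contDiff_eval_comp contDiff_fst).add (contDiff_const.mul contDiff_snd)).prodMk
    (contDiff_const.mul contDiff_fst)

theorem ElemHenon.contDiff_invFun (h : ElemHenon) : ContDiff ℂ 1 h.invFun :=
  (contDiff_snd.div_const _).prodMk
    ((contDiff_fst.sub (h.P.contDiff_eval_comp (contDiff_snd.div_const _))).div_const _)

theorem foldl_invFun_comp (l : List ElemHenon) (f : ℂ × ℂ → ℂ × ℂ) :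
    l.foldl (fun f h => h.invFun ∘ f) f = l.foldl (fun f h => h.invFun ∘ f) id ∘ f := by
  induction l generalizing f with
  | nil => rfl
  | cons h l ih =>
    simp only [List.foldl_cons]
    rw [ih (h.invFun ∘ f), ih (h.invFun ∘ id)]
    rfl

theorem HenonMap.exists_perm (H : HenonMap) :
    ∃ e : Equiv.Perm (ℂ × ℂ), ⇑e = H.toFun ∧ ⇑e.symm = H.invFun ∧
      ContDiff ℂ 1 e ∧ ContDiff ℂ 1 e.symm := by
  obtain ⟨l, hl⟩ := H
  simp only [HenonMap.toFun, HenonMap.invFun]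
  clear hl
  induction l with
  | nil => exact ⟨Equiv.refl _, rfl, rfl, contDiff_id, contDiff_id⟩
  | cons h l ih =>
    obtain ⟨e, h1, h2, h3, h4⟩ := ih
    refine ⟨e.trans ⟨h.toFun, h.invFun, h.leftInverse, h.rightInverse⟩, ?_, ?_,
      h.contDiff_toFun.comp h3, h4.comp h.contDiff_invFun⟩
    · rw [List.foldr_cons, ← h1]; rfl
    · rw [List.foldl_cons, foldl_invFun_comp, ← h2]; rfl

end Henon

section Orbits

variable {α : Type*}

theorem eq_zpow_apply_of_orbit {g : Equiv.Perm α} {y : ℤ → α} (hy : ∀ n, g (y n) = y (n + 1))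
    (n : ℤ) : y n = (g ^ n) (y 0) := by
  induction n using Int.induction_on with
  | zero => simp
  | succ n ih => rw [← hy, ih, ← Equiv.Perm.mul_apply, mul_self_zpow, add_comm]
  | pred n ih =>
    apply g.injective
    rw [hy, sub_add_cancel, ih, ← Equiv.Perm.mul_apply, mul_self_zpow, sub_add_cancel]

theorem zpow_apply_mem {g : Equiv.Perm α} {S : Set α} (h : ∀ x ∈ S, g x ∈ S)
    (h' : ∀ x ∈ S, g.symm x ∈ S) (n : ℤ) {x : α} (hx : x ∈ S) : (g ^ n) x ∈ S := by
  induction n using Int.induction_on with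
  | zero => simpa
  | succ n ih => rw [add_comm, zpow_add, zpow_one, Equiv.Perm.mul_apply]; exact h _ ih
  | pred n ih =>
    have h1 : -(n : ℤ) - 1 = -1 + -n := by ring
    rw [h1, zpow_add, Equiv.Perm.mul_apply, zpow_neg_one]
    exact h' _ ih

theorem continuous_perm_zpow [TopologicalSpace α] {g : Equiv.Perm α} (h : Continuous g)
    (h' : Continuous g.symm) (n : ℤ) : Continuous ⇑(g ^ n) := by
  induction n using Int.induction_on with
  | zero => exact continuous_id
  | succ n ih => rw [add_comm, zpow_add, zpow_one]; exact h.comp ih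
  | pred n ih =>
    have h1 : -(n : ℤ) - 1 = -1 + -n := by ring
    rw [h1, zpow_add, zpow_neg_one]
    exact h'.comp ih

/-- For an expansive homeomorphism, orbits that stay close in the future are asymptotic. -/
theorem tendsto_dist_iterate_of_expansive [MetricSpace α] {e : Equiv.Perm α} (he : Continuous e)
    (he' : Continuous e.symm) {S : Set α} (hS : IsCompact S) (heS : ∀ x ∈ S, e x ∈ S) {ε : ℝ}
    (hexp : ∀ a ∈ S, ∀ b ∈ S, (∀ n : ℤ, dist ((e ^ n) a) ((e ^ n) b) ≤ ε) → a = b)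
    {y p : α} (hy : y ∈ S) (hp : p ∈ S) (hyp : ∀ n : ℕ, dist (e^[n] y) (e^[n] p) ≤ ε) :
    Tendsto (fun n : ℕ => dist (e^[n] y) (e^[n] p)) atTop (𝓝 0) := by
  have hmem : ∀ x ∈ S, ∀ n : ℕ, e^[n] x ∈ S := fun x hx n => MapsTo.iterate heS n hx
  refine tendsto_of_subseq_tendsto fun ns hns => ?_
  obtain ⟨⟨a, b⟩, hab, φ, hφ, hlim⟩ := (hS.prod hS).tendsto_subseq
    (x := fun k => (e^[ns k] y, e^[ns k] p)) fun k => ⟨hmem y hy _, hmem p hp _⟩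
  refine ⟨φ, ?_⟩
  have h1 := (Prod.tendsto_iff _ _).1 hlim
  have hnφ : Tendsto (fun k => ns (φ k)) atTop atTop := hns.comp hφ.tendsto_atTop
  have hab' : a = b := by
    refine hexp a hab.1 b hab.2 fun n => ?_
    have hc := continuous_perm_zpow he he' n
    refine le_of_tendsto (((hc.tendsto a).comp h1.1).dist ((hc.tendsto b).comp h1.2)) ?_
    filter_upwards [hnφ.eventually_ge_atTop n.natAbs] with k hk
    have h2 : ∀ x, (e ^ n) (e^[ns (φ k)] x) = e^[(n + ns (φ k)).toNat] x := fun x => by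
      rw [Equiv.Perm.iterate_eq_pow, Equiv.Perm.iterate_eq_pow, ← zpow_natCast, ← zpow_natCast,
        ← Equiv.Perm.mul_apply, ← zpow_add, Int.toNat_of_nonneg (by omega)]
    simp only [Function.comp_apply, h2]
    exact hyp _
  have h3 := h1.1.dist h1.2
  simp only [hab', dist_self] at h3
  exact h3

end Orbits

section PeriodicShadowing

variable {E : Type*} [NormedAddCommGroup E] [NormedSpace ℂ E]

/-- The point `p` is fixed by `f^[k]`, whose derivative at `p` has an eigenvalue inside and an
eigenvalue outside the unit circle. -/
def IsSaddle (f : E → E) (k : ℕ) (p : E) : Prop :=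
  f^[k] p = p ∧ ∃ (v₁ v₂ : E) (μ₁ μ₂ : ℂ), v₁ ≠ 0 ∧ v₂ ≠ 0 ∧
    fderiv ℂ (f^[k]) p v₁ = μ₁ • v₁ ∧ fderiv ℂ (f^[k]) p v₂ = μ₂ • v₂ ∧ ‖μ₁‖ < 1 ∧ 1 < ‖μ₂‖

namespace AdaptedSplitting

variable {g : Equiv.Perm E} {S : Set E} {P A B : E → E →L[ℂ] E} {C M κ σ θ ε δ : ℝ}

theorem exists_saddle_of_periodic [FiniteDimensional ℂ E]
    (h : AdaptedSplitting g S P A B C M κ σ θ ε δ) (hg' : Differentiable ℂ g.symm)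
    (hP : ∀ x ∈ S, (∃ s, s ≠ 0 ∧ P x s = s) ∧ ∃ u, u ≠ 0 ∧ P x u = 0)
    {x : ℤ → E} (hx : ∀ n, x n ∈ S) {L : ℕ} (hL : 1 ≤ L) (hper : ∀ n, x (n + L) = x n)
    {ρ ε' : ℝ} (hρ : ρ ≤ δ) (hε' : ε' ≤ ε) (hρε : 4 * C * ρ ≤ ε')
    (hjump : ∀ n, dist (g (x n)) (x (n + 1)) ≤ ρ) :
    ∃ y, IsSaddle g L y ∧ ∀ n : ℤ, dist ((g ^ n) y) (x n) ≤ ε' := by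
  have : CompleteSpace E := FiniteDimensional.complete ℂ E
  obtain ⟨y, hy, hyx⟩ := h.exists_shadow hx hρ hε' hρε hjump
  have hjδ : ∀ n, dist (g (x n)) (x (n + 1)) ≤ δ := fun n => (hjump n).trans hρ
  have hyε : ∀ n, dist (y n) (x n) ≤ ε := fun n => (hyx n).trans hε'
  have hyz := eq_zpow_apply_of_orbit hy
  have hyn : ∀ n : ℕ, g^[n] (y 0) = y n := fun n => by
    rw [hyz n, zpow_natCast, Equiv.Perm.iterate_eq_pow]
  have hshift : y = fun n => y (n + L) := by
    refine h.shadow_unique hx hjδ hy (fun n => ?_) hyε fun n => ?_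
    · rw [hy, add_right_comm]
    · simpa only [hper] using hyε (n + L)
  have hyL : g^[L] (y 0) = y 0 := by
    rw [hyn]
    simpa using (congrFun hshift 0).symm
  refine ⟨y 0, ⟨hyL, ?_⟩, fun n => by rw [← hyz]; exact hyx n⟩
  have hcone : ∀ k : ℕ, PreservesCones (P (x 0)) (P (x (k + 1 : ℕ)))
      (fderiv ℂ (g^[k + 1]) (y 0)) := by
    intro k
    induction k with
    | zero => simpa using h.preservesCones (hx 0) (hx 1) (by simpa using hjδ 0) (hyε 0)
    | succ k ih =>
      rw [Function.iterate_succ', fderiv_comp _ (h.differentiable _) (h.differentiable.iterate _ _)]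
      refine (h.preservesCones (hx _) (hx _) ?_ ?_).comp ih
      · exact_mod_cast hjδ (k + 1 : ℕ)
      · rw [hyn]; exact hyε _
  obtain ⟨k, rfl⟩ : ∃ k, L = k + 1 := ⟨L - 1, by omega⟩
  have hc := hcone k
  have hx0 : x (k + 1 : ℕ) = x 0 := by simpa using hper 0
  rw [hx0] at hc
  obtain ⟨⟨s, hs, hPs⟩, u, hu, hPu⟩ := hP _ (hx 0)
  have hli : Function.LeftInverse (g.symm^[k + 1]) (g^[k + 1]) := g.left_inv.iterate _
  have hri : Function.LeftInverse (g^[k + 1]) (g.symm^[k + 1]) := g.right_inv.iterate _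
  have hyL' : g.symm^[k + 1] (y 0) = y 0 := by
    conv_lhs => rw [← hyL]
    exact hli _
  refine hc.exists_eigenvectors (N := fderiv ℂ (g.symm^[k + 1]) (y 0)) (fun v => ?_) hs hPs hu hPu
  have h1 := fderiv_comp (𝕜 := ℂ) (y 0) (h.differentiable.iterate (k + 1) _)
    (hg'.iterate (k + 1) (y 0))
  rw [hri.comp_eq_id, fderiv_id, hyL'] at h1
  exact (congrArg (fun T : E →L[ℂ] E => T v) h1).symm

theorem exists_saddle_of_dist_le [FiniteDimensional ℂ E]
    (h : AdaptedSplitting g S P A B C M κ σ θ ε δ) (hg' : Differentiable ℂ g.symm)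
    (hgS' : ∀ x ∈ S, g.symm x ∈ S)
    (hP : ∀ x ∈ S, (∃ s, s ≠ 0 ∧ P x s = s) ∧ ∃ u, u ≠ 0 ∧ P x u = 0)
    {ρ ε' : ℝ} (hρ : ρ ≤ δ) (hε' : ε' ≤ ε) (hρε : 4 * C * ρ ≤ ε')
    {p q : E} (hp : p ∈ S) (hq : q ∈ S) (hpq : dist p q ≤ ρ) {N : ℕ} (hN : 1 ≤ N)
    (hpN : g^[N] p = p) (hqN : g^[N] q = q) :
    ∃ y, IsSaddle g (2 * N) y ∧
      (∀ n : ℤ, 0 ≤ n → n < N → dist ((g ^ n) y) ((g ^ n) p) ≤ ε') ∧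
      ∀ n : ℤ, n < 0 → -N ≤ n → dist ((g ^ n) y) ((g ^ n) q) ≤ ε' := by
  have hρ0 : 0 ≤ ρ := dist_nonneg.trans hpq
  have hmul : ∀ {a : E}, g^[N] a = a → ∀ k : ℤ, (g ^ ((N : ℤ) * k)) a = a := fun ha k => by
    rw [zpow_mul]
    refine Equiv.Perm.zpow_apply_eq_self_of_apply_eq_self ?_ k
    rwa [zpow_natCast, ← Equiv.Perm.iterate_eq_pow]
  have hdvd : ∀ {a : E}, g^[N] a = a → ∀ k : ℤ, (N : ℤ) ∣ k → (g ^ k) a = a := by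
    rintro a ha _ ⟨k, rfl⟩
    exact hmul ha k
  have hadd : ∀ {a : E}, g^[N] a = a → ∀ n k : ℤ, (N : ℤ) ∣ k → (g ^ (n + k)) a = (g ^ n) a :=
    fun ha n k hk => by rw [zpow_add, Equiv.Perm.mul_apply, hdvd ha k hk]
  have hsucc : ∀ (a : E) (n : ℤ), g ((g ^ n) a) = (g ^ (n + 1)) a := fun a n => by
    rw [← Equiv.Perm.mul_apply, mul_self_zpow, add_comm]
  obtain ⟨y, hy, hyx⟩ := h.exists_saddle_of_periodic hg' hP
    (x := fun n => if n % (2 * N) < N then (g ^ n) p else (g ^ n) q) (L := 2 * N) (ρ := ρ)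
    (ε' := ε') (fun n => by
      split_ifs
      · exact zpow_apply_mem h.mapsTo hgS' n hp
      · exact zpow_apply_mem h.mapsTo hgS' n hq) (by omega)
    (fun n => by
      have h1 : (N : ℤ) ∣ (2 * N : ℕ) := ⟨2, by push_cast; ring⟩
      have h2 : (n + (2 * N : ℕ)) % (2 * N : ℤ) = n % (2 * N) := by push_cast; simp
      rw [hadd hpN _ _ h1, hadd hqN _ _ h1, h2])
    hρ hε' hρε (fun n => by
      by_cases hd : (N : ℤ) ∣ n + 1
      · split_ifs <;> simp only [hsucc, hdvd hpN _ hd, hdvd hqN _ hd, dist_self, hρ0, hpq]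
        rwa [dist_comm]
      · have hiff : n % (2 * N : ℤ) < N ↔ (n + 1) % (2 * N : ℤ) < N := by
          have hN' : (0 : ℤ) < 2 * N := by omega
          have h1 := Int.emod_nonneg n hN'.ne'
          have h2 := Int.emod_lt_of_pos n hN'
          have h3 : (n + 1) % (2 * N : ℤ) = (n % (2 * N) + 1) % (2 * N) := by simp
          have h4 : n = 2 * N * (n / (2 * N)) + n % (2 * N) := (Int.mul_ediv_add_emod n _).symm
          have h5 : n % (2 * N : ℤ) + 1 ≠ N := fun h6 => hd ⟨2 * (n / (2 * N)) + 1, by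
            linear_combination h4 + h6⟩
          have h6 : n % (2 * N : ℤ) + 1 ≠ 2 * N := fun h6 => hd ⟨2 * (n / (2 * N)) + 2, by
            linear_combination h4 + h6⟩
          rw [h3, Int.emod_eq_of_lt (a := n % (2 * N : ℤ) + 1) (by omega) (by omega)]
          omega
        simp only [hiff]
        split_ifs <;> simp only [hsucc, dist_self, hρ0])
  refine ⟨y, hy, fun n h0 hn => ?_, fun n h0 hn => ?_⟩
  · have h1 := hyx n
    rwa [Int.emod_eq_of_lt h0 (by omega), if_pos hn] at h1
  · have h1 := hyx n
    have h2 : n % (2 * N : ℤ) = n + 2 * N := by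
      rw [← Int.add_emod_right]
      exact Int.emod_eq_of_lt (by omega) (by omega)
    rwa [h2, if_neg (by omega)] at h1

end AdaptedSplitting

end PeriodicShadowing

section LocalProduct

variable {E : Type*} [NormedAddCommGroup E] [NormedSpace ℂ E]

theorem AdaptedSplitting.exists_mem_dist_le [FiniteDimensional ℂ E] {g : Equiv.Perm E} {S : Set E}
    {P A B : E → E →L[ℂ] E} {C M κ σ θ ε δ : ℝ} (h : AdaptedSplitting g S P A B C M κ σ θ ε δ)
    (hg' : Differentiable ℂ g.symm) (hS : IsCompact S) (hgS' : ∀ x ∈ S, g.symm x ∈ S)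
    (hP : ∀ x ∈ S, (∃ s, s ≠ 0 ∧ P x s = s) ∧ ∃ u, u ≠ 0 ∧ P x u = 0)
    (hper : S ⊆ closure {p ∈ S | ∃ k, 1 ≤ k ∧ g^[k] p = p})
    (hsaddle : ∀ k y, 1 ≤ k → IsSaddle g k y → y ∈ S)
    {ρ ε' : ℝ} (hρ : ρ ≤ δ) (hε' : ε' ≤ ε) (hρε : 4 * C * ρ ≤ ε')
    {p q : E} (hp : p ∈ S) (hq : q ∈ S) (hpq : dist p q < ρ) :
    ∃ y ∈ S, (∀ n : ℤ, 0 ≤ n → dist ((g ^ n) y) ((g ^ n) p) ≤ ε') ∧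
      ∀ n : ℤ, n < 0 → dist ((g ^ n) y) ((g ^ n) q) ≤ ε' := by
  have happrox : ∀ k : ℕ, ∃ p' q' y : E, dist p p' < 1 / ((k : ℝ) + 1) ∧
      dist q q' < 1 / ((k : ℝ) + 1) ∧ y ∈ S ∧
      (∀ n : ℤ, 0 ≤ n → n ≤ k → dist ((g ^ n) y) ((g ^ n) p') ≤ ε') ∧
      ∀ n : ℤ, n < 0 → -k ≤ n → dist ((g ^ n) y) ((g ^ n) q') ≤ ε' := by
    intro k
    have hη : 0 < min (1 / ((k : ℝ) + 1)) ((ρ - dist p q) / 2) :=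
      lt_min (by positivity) (by linarith)
    obtain ⟨p', ⟨hp', a, ha, hpa⟩, hpp'⟩ := Metric.mem_closure_iff.1 (hper hp) _ hη
    obtain ⟨q', ⟨hq', b, hb, hqb⟩, hqq'⟩ := Metric.mem_closure_iff.1 (hper hq) _ hη
    obtain ⟨hp1, hp2⟩ := lt_min_iff.1 hpp'
    obtain ⟨hq1, hq2⟩ := lt_min_iff.1 hqq'
    have hpq' : dist p' q' ≤ ρ := by
      have h1 := dist_triangle4 p' p q q'
      rw [dist_comm p' p] at h1
      linarith
    have hN : k + 1 ≤ a * b * (k + 1) :=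
      Nat.le_mul_of_pos_left _ (Nat.mul_pos (by omega) (by omega))
    have hpN : g^[a * b * (k + 1)] p' = p' := by
      rw [mul_assoc, Function.iterate_mul]
      exact Function.iterate_fixed hpa _
    have hqN : g^[a * b * (k + 1)] q' = q' := by
      rw [mul_comm a b, mul_assoc, Function.iterate_mul]
      exact Function.iterate_fixed hqb _
    obtain ⟨y, hy, hyp, hyq⟩ := h.exists_saddle_of_dist_le hg' hgS' hP hρ hε' hρε hp' hq' hpq'
      (by omega) hpN hqN
    exact ⟨p', q', y, hp1, hq1, hsaddle _ y (by omega) hy,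
      fun n h0 hn => hyp n h0 (by omega), fun n h0 hn => hyq n h0 (by omega)⟩
  choose p' q' y hp' hq' hyS hyp hyq using happrox
  obtain ⟨z, hz, φ, hφ, hlim⟩ := hS.tendsto_subseq hyS
  have hone : Tendsto (fun k : ℕ => 1 / ((k : ℝ) + 1)) atTop (𝓝 0) :=
    tendsto_one_div_add_atTop_nhds_zero_nat
  have happ : ∀ (a : E) (a' : ℕ → E), (∀ k, dist a (a' k) < 1 / ((k : ℝ) + 1)) →
      Tendsto (fun k => a' (φ k)) atTop (𝓝 a) := fun a a' ha => by
    refine Tendsto.comp (tendsto_iff_dist_tendsto_zero.2 ?_) hφ.tendsto_atTop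
    exact squeeze_zero (fun _ => dist_nonneg) (fun k => by rw [dist_comm]; exact (ha k).le) hone
  have hclose : ∀ (a : E) (a' : ℕ → E), (∀ k, dist a (a' k) < 1 / ((k : ℝ) + 1)) → ∀ n : ℤ,
      (∀ k : ℕ, n.natAbs ≤ k → dist ((g ^ n) (y k)) ((g ^ n) (a' k)) ≤ ε') →
      dist ((g ^ n) z) ((g ^ n) a) ≤ ε' := by
    intro a a' ha n hn
    have hc := continuous_perm_zpow h.differentiable.continuous hg'.continuous n
    refine le_of_tendsto
      (((hc.tendsto z).comp hlim).dist ((hc.tendsto a).comp (happ a a' ha))) ?_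
    filter_upwards [hφ.tendsto_atTop.eventually_ge_atTop n.natAbs] with k hk
    exact hn _ hk
  exact ⟨z, hz, fun n hn => hclose p p' hp' n fun k hk => hyp k n hn (by omega),
    fun n hn => hclose q q' hq' n fun k hk => hyq k n hn (by omega)⟩

/-- Iterates of a continuous map are equicontinuous near a compact set over finitely many times. -/
theorem exists_dist_iterate_le {α : Type*} [PseudoMetricSpace α] {f : α → α} (hf : Continuous f)
    {S : Set α} (hS : IsCompact S) {ε : ℝ} (hε : 0 < ε) (m : ℕ) :
    ∃ η > 0, ∀ a ∈ S, ∀ b, dist b a ≤ η → ∀ j ≤ m, dist (f^[j] b) (f^[j] a) ≤ ε := by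
  induction m with
  | zero =>
    refine ⟨ε, hε, fun a _ b hb j hj => ?_⟩
    rw [Nat.le_zero.1 hj]
    exact hb
  | succ m ih =>
    obtain ⟨η, hη, h1⟩ := ih
    have h2 := hS.uniformContinuousAt_of_continuousAt (f^[m + 1])
      (fun x _ => (hf.iterate (m + 1)).continuousAt) (dist_mem_uniformity hε)
    obtain ⟨η', hη', h3⟩ := mem_uniformity_dist.1 h2
    refine ⟨min η (η' / 2), lt_min hη (by positivity), fun a ha b hb j hj => ?_⟩
    obtain ⟨hb1, hb2⟩ := le_min_iff.1 hb
    rcases Nat.le_succ_iff.1 hj with hj | rfl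
    · exact h1 a ha b hb1 j hj
    · have h4 : dist a b < η' := by rw [dist_comm]; linarith
      have h5 : dist (f^[m + 1] a) (f^[m + 1] b) < ε := h3 h4 ha
      rw [dist_comm]
      exact h5.le

theorem dist_iterate_le_of_dist_iterate_pow_le {α : Type*} [PseudoMetricSpace α] {f : α → α}
    {S : Set α} (hfS : ∀ x ∈ S, f x ∈ S) {m : ℕ} (hm : 1 ≤ m) {ε η : ℝ}
    (h : ∀ a ∈ S, ∀ b, dist b a ≤ η → ∀ j ≤ m, dist (f^[j] b) (f^[j] a) ≤ ε) {x p : α}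
    (hp : p ∈ S) (hxp : ∀ k : ℕ, dist ((f^[m])^[k] x) ((f^[m])^[k] p) ≤ η) (n : ℕ) :
    dist (f^[n] x) (f^[n] p) ≤ ε := by
  have h1 : ∀ y, f^[n] y = f^[n % m] ((f^[m])^[n / m] y) := fun y => by
    rw [← Function.iterate_mul, ← Function.iterate_add_apply, Nat.mod_add_div]
  have h2 : (f^[m])^[n / m] p ∈ S := MapsTo.iterate (MapsTo.iterate hfS m) _ hp
  rw [h1, h1]
  exact h _ h2 _ (hxp _) _ (Nat.mod_lt _ hm).le

/-- Points in the intersection of a local stable and a local unstable set are unique. -/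
theorem AdaptedSplitting.eq_of_dist_le {g : Equiv.Perm E} {S : Set E}
    {P A B : E → E →L[ℂ] E} {C M κ σ θ ε δ : ℝ} (h : AdaptedSplitting g S P A B C M κ σ θ ε δ)
    (hδ : 0 ≤ δ) (hgS' : ∀ x ∈ S, g.symm x ∈ S) {p q : E} (hp : p ∈ S) (hq : q ∈ S)
    (hpq : dist p q ≤ δ) {x y : E}
    (hxp : ∀ n : ℤ, 0 ≤ n → dist ((g ^ n) x) ((g ^ n) p) ≤ ε)
    (hxq : ∀ n : ℤ, n < 0 → dist ((g ^ n) x) ((g ^ n) q) ≤ ε)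
    (hyp : ∀ n : ℤ, 0 ≤ n → dist ((g ^ n) y) ((g ^ n) p) ≤ ε)
    (hyq : ∀ n : ℤ, n < 0 → dist ((g ^ n) y) ((g ^ n) q) ≤ ε) : x = y := by
  have hsucc : ∀ (a : E) (n : ℤ), g ((g ^ n) a) = (g ^ (n + 1)) a := fun a n => by
    rw [← Equiv.Perm.mul_apply, mul_self_zpow, add_comm]
  have h1 := h.shadow_unique (x := fun n : ℤ => if 0 ≤ n then (g ^ n) p else (g ^ n) q)
    (y := fun n => (g ^ n) x) (z := fun n => (g ^ n) y) (fun n => ?_) (fun n => ?_)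
    (hsucc x) (hsucc y) (fun n => ?_) (fun n => ?_)
  · simpa using congrFun h1 0
  · split_ifs
    · exact zpow_apply_mem h.mapsTo hgS' n hp
    · exact zpow_apply_mem h.mapsTo hgS' n hq
  · rcases lt_trichotomy n (-1) with hn | rfl | hn
    · rw [if_neg (by omega), if_neg (by omega), hsucc, dist_self]
      exact hδ
    · simpa [dist_comm] using hpq
    · rw [if_pos (by omega), if_pos (by omega), hsucc, dist_self]
      exact hδ
  · split_ifs with hn
    · exact hxp n hn
    · exact hxq n (by omega)
  · split_ifs with hn
    · exact hyp n hn
    · exact hyq n (by omega)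

end LocalProduct

theorem IsSaddle.isSaddlePeriodic {H : HenonMap} {m k : ℕ} (hm : 1 ≤ m) (hk : 1 ≤ k) {y : ℂ × ℂ}
    (h : IsSaddle (H.toFun^[m]) k y) : IsSaddlePeriodic H y := by
  refine ⟨m * k, Nat.mul_pos hm hk, ?_⟩
  rw [Function.iterate_mul]
  exact h

/-- If `H` is uniformly hyperbolic on `J*`, then `J*` has local product structure. -/
theorem Jstar_local_product_structure (H : HenonMap)
    (hhyp : UniformlyHyperbolicOn H (Jstar H)) :
    ∃ ε > (0 : ℝ), ∃ δ > (0 : ℝ), ∀ p ∈ Jstar H, ∀ q ∈ Jstar H, dist p q < δ →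
      ∃ x : ℂ × ℂ, WsLoc H ε p ∩ WuLoc H ε q = {x} ∧ x ∈ Jstar H := by
  obtain ⟨e, heH, heH', he, he'⟩ := H.exists_perm
  obtain ⟨hS, himage, Es, Eu, c, lam, hc, hlam, hlam1, hEs1, hEu1, hcompl, hEs, hEu, hDEs, hDEu,
    hcontr, hexp⟩ := hhyp
  rw [← heH] at himage hDEs hDEu hcontr hexp
  have heS : ∀ x ∈ Jstar H, e x ∈ Jstar H := fun x hx => himage ▸ mem_image_of_mem e hx
  have heS' : ∀ x ∈ Jstar H, e.symm x ∈ Jstar H := fun x hx => by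
    rw [← himage] at hx
    obtain ⟨y, hy, rfl⟩ := hx
    rwa [e.symm_apply_apply]
  have hbot : ∀ F : Submodule ℂ (ℂ × ℂ), Module.finrank ℂ F = 1 → F ≠ ⊥ := by
    rintro F hF rfl
    simp at hF
  obtain ⟨m, P, A, B, C, M, κ, σ, θ, ε, δ, hm, hε, hδ, h, hP⟩ :=
    exists_adaptedSplitting e he he' hS heS hc hlam hlam1 (fun x hx => hbot _ (hEs1 x hx))
      (fun x hx => hbot _ (hEu1 x hx)) hcompl hEs hEu
      (fun x hx v hv => hDEs x hx ▸ Submodule.mem_map_of_mem (p := Es x) hv)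
      (fun x hx v hv => hDEu x hx ▸ Submodule.mem_map_of_mem (p := Eu x) hv) hcontr hexp
  have hC : 0 < C := lt_of_lt_of_le one_pos h.one_le
  have hpos : ∀ (k : ℕ) (x : ℂ × ℂ), ((e ^ m) ^ (k : ℤ)) x = (e^[m])^[k] x := fun k x => by
    rw [zpow_natCast, Equiv.Perm.iterate_eq_pow, Equiv.Perm.iterate_eq_pow]
  have hinv : (e ^ m).symm = e.symm ^ m := by
    change (e ^ m)⁻¹ = (e⁻¹) ^ m
    rw [inv_pow]
  have hneg : ∀ (k : ℕ) (x : ℂ × ℂ), ((e ^ m) ^ (-k : ℤ)) x = (e.symm^[m])^[k] x := fun k x => by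
    rw [zpow_neg, zpow_natCast, ← inv_pow, Equiv.Perm.iterate_eq_pow, Equiv.Perm.iterate_eq_pow,
      ← hinv]
    rfl
  have hgS' : ∀ x ∈ Jstar H, (e ^ m).symm x ∈ Jstar H := fun x hx => by
    rw [hinv, ← Equiv.Perm.iterate_eq_pow]
    exact MapsTo.iterate heS' m hx
  have hg' : Differentiable ℂ (e ^ m).symm := by
    rw [hinv, ← Equiv.Perm.iterate_eq_pow]
    exact (he'.differentiable one_ne_zero).iterate m
  have hsaddle : ∀ k y, 1 ≤ k → IsSaddle (e ^ m) k y → y ∈ Jstar H := fun k y hk hy => by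
    rw [← Equiv.Perm.iterate_eq_pow, heH] at hy
    exact subset_closure (hy.isSaddlePeriodic hm hk)
  have hper : Jstar H ⊆ closure {p ∈ Jstar H | ∃ k, 1 ≤ k ∧ (e ^ m)^[k] p = p} := by
    refine closure_mono fun p hp => ⟨subset_closure hp, ?_⟩
    obtain ⟨k, hk, hkp, -⟩ := hp
    refine ⟨k, hk, ?_⟩
    rw [← Equiv.Perm.iterate_eq_pow, ← Function.iterate_mul, mul_comm, Function.iterate_mul, heH]
    exact Function.iterate_fixed hkp m
  have hexpansive : ∀ a ∈ Jstar H, ∀ b ∈ Jstar H,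
      (∀ n : ℤ, dist ((e ^ n) a) ((e ^ n) b) ≤ ε) → a = b := fun a ha b hb hab => by
    have h1 : ∀ n : ℤ, dist (((e ^ m) ^ n) a) (((e ^ m) ^ n) b) ≤ ε := fun n => by
      rw [← zpow_natCast, ← zpow_mul]
      exact hab _
    have h2 : ∀ n : ℤ, dist (((e ^ m) ^ n) b) (((e ^ m) ^ n) b) ≤ ε := fun n => by
      rw [dist_self]
      exact hε.le
    exact h.eq_of_dist_le hδ.le hgS' hb hb (by rw [dist_self]; exact hδ.le) (fun n _ => h1 n)
      (fun n _ => h1 n) (fun n _ => h2 n) fun n _ => h2 n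
  have hexpansive' : ∀ a ∈ Jstar H, ∀ b ∈ Jstar H,
      (∀ n : ℤ, dist ((e.symm ^ n) a) ((e.symm ^ n) b) ≤ ε) → a = b := fun a ha b hb hab => by
    refine hexpansive a ha b hb fun n => ?_
    have h1 : e ^ n = e.symm ^ (-n) := by
      change e ^ n = (e⁻¹) ^ (-n)
      rw [inv_zpow, zpow_neg, inv_inv]
    rw [h1]
    exact hab _
  obtain ⟨η, hη, hclose⟩ := exists_dist_iterate_le he.continuous hS hε m
  obtain ⟨η', hη', hclose'⟩ := exists_dist_iterate_le he'.continuous hS hε m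
  obtain ⟨r, hr, hrε, hrη, hrη'⟩ : ∃ r > 0, r ≤ ε ∧ r ≤ η ∧ r ≤ η' :=
    ⟨min ε (min η η'), lt_min hε (lt_min hη hη'), min_le_left _ _,
      (min_le_right _ _).trans (min_le_left _ _), (min_le_right _ _).trans (min_le_right _ _)⟩
  obtain ⟨ρ, hρ, hρδ, hρr, hρC⟩ : ∃ ρ > 0, ρ ≤ δ ∧ ρ ≤ r / 2 ∧ 4 * C * ρ ≤ r / 2 := by
    refine ⟨min δ (min (r / 2) (r / 2 / (4 * C))), lt_min hδ (lt_min (by positivity)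
      (by positivity)), min_le_left _ _, (min_le_right _ _).trans (min_le_left _ _), ?_⟩
    have h1 : min δ (min (r / 2) (r / 2 / (4 * C))) ≤ r / 2 / (4 * C) :=
      (min_le_right _ _).trans (min_le_right _ _)
    rw [le_div_iff₀ (by positivity)] at h1
    linarith
  refine ⟨ε, hε, ρ, hρ, fun p hp q hq hpq => ?_⟩
  obtain ⟨y, hy, hyp, hyq⟩ := h.exists_mem_dist_le hg' hS hgS' hP hper hsaddle hρδ
    (by linarith : r / 2 ≤ ε) hρC hp hq hpq
  have hfwd : ∀ n : ℕ, dist (e^[n] y) (e^[n] p) ≤ ε := by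
    refine dist_iterate_le_of_dist_iterate_pow_le heS hm hclose hp fun k => ?_
    rw [← hpos, ← hpos]
    linarith [hyp k (by omega)]
  have hbwd : ∀ n : ℕ, dist (e.symm^[n] y) (e.symm^[n] q) ≤ ε := by
    refine dist_iterate_le_of_dist_iterate_pow_le heS' hm hclose' hq fun k => ?_
    rcases Nat.eq_zero_or_pos k with rfl | hk
    · have h1 : dist y p ≤ r / 2 := by simpa using hyp 0 le_rfl
      have h2 : dist y q ≤ η' := by linarith [dist_triangle y p q]
      simpa using h2
    · rw [← hneg, ← hneg]
      linarith [hyq (-k) (by omega)]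
  refine ⟨y, Subset.antisymm ?_ ?_, hy⟩
  · rintro x ⟨⟨hxp, -⟩, ⟨hxq, -⟩⟩
    rw [← heH] at hxp
    rw [← heH'] at hxq
    refine h.eq_of_dist_le hδ.le hgS' hp hq (hpq.le.trans hρδ) (fun n hn => ?_) (fun n hn => ?_)
      (fun n hn => (hyp n hn).trans (by linarith)) fun n hn => (hyq n hn).trans (by linarith)
    · lift n to ℕ using hn
      rw [hpos, hpos, ← Function.iterate_mul]
      exact hxp _
    · obtain ⟨k, rfl⟩ : ∃ k : ℕ, n = -k := ⟨n.natAbs, by omega⟩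
      rw [hneg, hneg, ← Function.iterate_mul]
      exact hxq _
  · rintro _ rfl
    refine ⟨⟨?_, ?_⟩, ⟨?_, ?_⟩⟩
    · rw [← heH]
      exact hfwd
    · rw [← heH]
      exact tendsto_dist_iterate_of_expansive he.continuous he'.continuous hS heS hexpansive hy hp
        hfwd
    · rw [← heH']
      exact hbwd
    · rw [← heH']
      exact tendsto_dist_iterate_of_expansive (e := e.symm) he'.continuous he.continuous hS heS'
        hexpansive' hy hq hbwd

end
end

section
/- Let H be a complex Hénon map which is uniformly hyperbolic on J*, let p ∈ J* with Φ^s_p a parametrization of the stable manifold W^s_p, and let V be a nonempty connected component of ℂ ∖ J*_{p,s} on which G⁻ ∘ Φ^s_p vanishes identically. Then V is simply connected. -/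
open Filter Metric Topology Set

noncomputable section

/-- A `G`-valued edge function on the lattice `ℤ²` (with `a` on horizontal and `b` on vertical
edges)
has trivial holonomy around the unit square with lower left corner `Q`. -/
def FlatAt {G : Type*} [Group G] (a b : ℤ × ℤ → G) (Q : ℤ × ℤ) : Prop :=
  a Q * b (Q.1 + 1, Q.2) = b Q * a (Q.1, Q.2 + 1)

/-- Every edge separating a square of `F` from a square outside `F` belongs to `TH`
(horizontal edges) or `TV` (vertical edges). -/
def BoundaryEdgesIn (F : Finset (ℤ × ℤ)) (TH TV : Set (ℤ × ℤ)) : Prop :=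
  ∀ Q ∈ F, ((Q.1, Q.2 - 1) ∉ F → Q ∈ TH) ∧ ((Q.1, Q.2 + 1) ∉ F → (Q.1, Q.2 + 1) ∈ TH) ∧
    ((Q.1 - 1, Q.2) ∉ F → Q ∈ TV) ∧ ((Q.1 + 1, Q.2) ∉ F → (Q.1 + 1, Q.2) ∈ TV)

/-- A property of edge functions depending only on the edges in `TH`, `TV` and implied by flatness
on finitely many squares is implied by flatness on a finite set of squares bounded by these edges. -/
theorem exists_finset_boundaryEdgesIn {G : Type*} [Group G] (TH TV : Set (ℤ × ℤ))
    (P : (ℤ × ℤ → G) → (ℤ × ℤ → G) → Prop)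
    (hP : ∀ a b a' b', (∀ e ∈ TH, a e = a' e) → (∀ e ∈ TV, b e = b' e) → P a' b' → P a b)
    (F₀ : Finset (ℤ × ℤ)) (hF₀ : ∀ a b, (∀ Q ∈ F₀, FlatAt a b Q) → P a b) :
    ∃ F : Finset (ℤ × ℤ), BoundaryEdgesIn F TH TV ∧ ∀ a b, (∀ Q ∈ F, FlatAt a b Q) → P a b := by
  induction hn : F₀.card using Nat.strong_induction_on generalizing F₀ with
  | _ n ih =>
  by_cases hB : BoundaryEdgesIn F₀ TH TV
  · exact ⟨F₀, hB, hF₀⟩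
  have key : ∃ Q ∈ F₀, ∀ a b : ℤ × ℤ → G, (∀ R ∈ F₀.erase Q, FlatAt a b R) →
      ∃ a' b', (∀ e ∈ TH, a e = a' e) ∧ (∀ e ∈ TV, b e = b' e) ∧
        ∀ R ∈ F₀, FlatAt a' b' R := by
    simp only [BoundaryEdgesIn, not_forall] at hB
    obtain ⟨Q, hQ, hB⟩ := hB
    refine ⟨Q, hQ, fun a b hab => ?_⟩
    simp only [Classical.not_and_iff_not_or_not, Classical.not_imp] at hB
    have hne : ∀ R ∈ F₀, R ≠ Q → FlatAt a b R :=
      fun R hR hRQ => hab R (Finset.mem_erase.2 ⟨hRQ, hR⟩)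
    rcases hB with ⟨h1, h2⟩ | ⟨h1, h2⟩ | ⟨h1, h2⟩ | ⟨h1, h2⟩
    · refine ⟨Function.update a Q (b Q * a (Q.1, Q.2 + 1) * (b (Q.1 + 1, Q.2))⁻¹), b,
        fun e he => ?_, fun _ _ => rfl, fun R hR => ?_⟩
      · rw [Function.update_of_ne]; rintro rfl; exact h2 he
      · by_cases hRQ : R = Q
        · subst hRQ
          simp [FlatAt, Prod.ext_iff]
        · have h3 : (R.1, R.2 + 1) ≠ Q := by
            rintro rfl; apply h1; simpa using hR
          have := hne R hR hRQ
          simpa [FlatAt, Function.update_of_ne, hRQ, h3] using this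
    · refine ⟨Function.update a (Q.1, Q.2 + 1) ((b Q)⁻¹ * (a Q * b (Q.1 + 1, Q.2))), b,
        fun e he => ?_, fun _ _ => rfl, fun R hR => ?_⟩
      · rw [Function.update_of_ne]; rintro rfl; exact h2 he
      · by_cases hRQ : R = Q
        · subst hRQ
          simp [FlatAt, Prod.ext_iff]
        · have h3 : R ≠ (Q.1, Q.2 + 1) := by
            rintro rfl; exact h1 hR
          have h4 : (R.1, R.2 + 1) ≠ (Q.1, Q.2 + 1) := by
            intro h; apply hRQ; simpa [Prod.ext_iff] using h
          have := hne R hR hRQ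
          simpa only [FlatAt, Function.update_of_ne h3, Function.update_of_ne h4] using this
    · refine ⟨a, Function.update b Q (a Q * b (Q.1 + 1, Q.2) * (a (Q.1, Q.2 + 1))⁻¹),
        fun _ _ => rfl, fun e he => ?_, fun R hR => ?_⟩
      · rw [Function.update_of_ne]; rintro rfl; exact h2 he
      · by_cases hRQ : R = Q
        · subst hRQ
          simp [FlatAt, Prod.ext_iff]
        · have h3 : (R.1 + 1, R.2) ≠ Q := by
            rintro rfl; apply h1; simpa using hR
          have := hne R hR hRQ
          simpa [FlatAt, Function.update_of_ne, hRQ, h3] using this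
    · refine ⟨a, Function.update b (Q.1 + 1, Q.2) ((a Q)⁻¹ * (b Q * a (Q.1, Q.2 + 1))),
        fun _ _ => rfl, fun e he => ?_, fun R hR => ?_⟩
      · rw [Function.update_of_ne]; rintro rfl; exact h2 he
      · by_cases hRQ : R = Q
        · subst hRQ
          simp [FlatAt, Prod.ext_iff]
        · have h3 : R ≠ (Q.1 + 1, Q.2) := by
            rintro rfl; exact h1 hR
          have h4 : (R.1 + 1, R.2) ≠ (Q.1 + 1, Q.2) := by
            intro h; apply hRQ; simpa [Prod.ext_iff] using h
          have := hne R hR hRQ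
          simpa only [FlatAt, Function.update_of_ne h3, Function.update_of_ne h4] using this
  obtain ⟨Q, hQ, hQ'⟩ := key
  refine ih _ (by rw [← hn]; exact Finset.card_erase_lt_of_mem hQ) (F₀.erase Q) ?_ rfl
  intro a b hab
  obtain ⟨a', b', h1, h2, h3⟩ := hQ' a b hab
  exact hP a b a' b' h1 h2 (hF₀ a' b' h3)

theorem exists_int_telescope {G : Type*} [Group G] (b : ℤ → G) :
    ∃ k : ℤ → G, ∀ n, b n = (k n)⁻¹ * k (n + 1) := by
  let u : ℕ → G := fun n => ((List.range n).map fun i : ℕ => b (i : ℤ)).prod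
  let w : ℕ → G := fun n => ((List.range n).map fun i : ℕ => (b (-(i : ℤ) - 1))⁻¹).prod
  refine ⟨fun n => if 0 ≤ n then u n.toNat else w (-n).toNat, fun n => ?_⟩
  rcases n with n | n
  · have h1 : (0 : ℤ) ≤ n := by positivity
    have h2 : (0 : ℤ) ≤ n + 1 := by positivity
    have h3 : ((n : ℤ) + 1).toNat = n + 1 := by omega
    simp [h2, h3, u, List.range_succ]
  · rcases n with _ | n
    · simp [u, w]
    · have h1 : ¬ (0 : ℤ) ≤ Int.negSucc (n + 1) := by omega
      have h2 : ¬ (0 : ℤ) ≤ Int.negSucc (n + 1) + 1 := by omega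
      have h3 : (-Int.negSucc (n + 1)).toNat = n + 1 + 1 := by omega
      have h4 : (-(Int.negSucc (n + 1) + 1)).toNat = n + 1 := by omega
      have h5 : -((n + 1 : ℕ) : ℤ) - 1 = Int.negSucc (n + 1) := by omega
      simp only [h1, h2, h3, h4, if_false, w]
      rw [List.range_succ (n := n + 1)]
      simp only [List.map_append, List.prod_append, List.map_cons, List.map_nil, List.prod_cons,
        List.prod_nil, h5]
      group

/-- An edge function which is flat on a box of squares is the coboundary of a vertex function. -/
theorem exists_gauge_of_flatAt_box {G : Type*} [Group G] (N : ℤ) (a b : ℤ × ℤ → G)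
    (hab : ∀ m n, -N ≤ m → m ≤ N → -N ≤ n → n ≤ N → FlatAt a b (m, n)) :
    ∃ h : ℤ × ℤ → G, (∀ m n, b (m, n) = (h (m, n))⁻¹ * h (m, n + 1)) ∧
      ∀ m n, -N ≤ m → m ≤ N → -N ≤ n → n ≤ N → a (m, n) = (h (m, n))⁻¹ * h (m + 1, n) := by
  choose k hk using fun m : ℤ => exists_int_telescope fun n => b (m, n)
  have hc : ∀ m, -N ≤ m → m ≤ N → ∀ i : ℕ, -N + i ≤ N →
      k m (-N + i) * a (m, -N + i) * (k (m + 1) (-N + i))⁻¹ =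
        k m (-N) * a (m, -N) * (k (m + 1) (-N))⁻¹ := by
    intro m h1 h2 i
    induction i with
    | zero => intro _; simp
    | succ i ih =>
      intro hi
      push_cast at hi ⊢
      rw [← ih (by omega)]
      have := hab m (-N + i) h1 h2 (by omega) (by omega)
      simp only [FlatAt, hk] at this
      rw [← add_assoc, show a (m, -N + i + 1) = ((k m (-N + i))⁻¹ * k m (-N + i + 1))⁻¹ *
        (a (m, -N + i) * ((k (m + 1) (-N + i))⁻¹ * k (m + 1) (-N + i + 1))) by
          rw [this]; group]
      group
  obtain ⟨l, hl⟩ := exists_int_telescope fun m => k m (-N) * a (m, -N) * (k (m + 1) (-N))⁻¹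
  refine ⟨fun v => l v.1 * k v.1 v.2, fun m n => ?_, fun m n h1 h2 h3 h4 => ?_⟩
  · simp only [hk]; group
  · have h5 := hc m h1 h2 (n + N).toNat (by omega)
    rw [show -N + ((n + N).toNat : ℤ) = n by omega, hl] at h5
    have : a (m, n) = (k m n)⁻¹ * (k m n * a (m, n) * (k (m + 1) n)⁻¹) * k (m + 1) n := by group
    rw [this, h5]
    group

/-- The value of an edge function along a step between lattice points at sup-distance at most one,
first horizontally and then vertically. -/
def stepVal {G : Type*} [Group G] (a b : ℤ × ℤ → G) (u w : ℤ × ℤ) : G :=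
  (if w.1 = u.1 + 1 then a u else if u.1 = w.1 + 1 then (a (w.1, u.2))⁻¹ else 1) *
    (if w.2 = u.2 + 1 then b (w.1, u.2) else if u.2 = w.2 + 1 then (b w)⁻¹ else 1)

/-- The lattice points `u`, `w` are at sup-distance at most one and the edges used to go from `u`
to `w` belong to `TH`, `TV`. -/
def StepIn (TH TV : Set (ℤ × ℤ)) (u w : ℤ × ℤ) : Prop :=
  |w.1 - u.1| ≤ 1 ∧ |w.2 - u.2| ≤ 1 ∧
    (w.1 = u.1 + 1 → u ∈ TH) ∧ (u.1 = w.1 + 1 → (w.1, u.2) ∈ TH) ∧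
    (w.2 = u.2 + 1 → (w.1, u.2) ∈ TV) ∧ (u.2 = w.2 + 1 → w ∈ TV)

theorem List.prod_range_telescope {G : Type*} [Group G] (h : ℕ → G) (L : ℕ) :
    ((List.range L).map fun i => (h i)⁻¹ * h (i + 1)).prod = (h 0)⁻¹ * h L := by
  induction L with
  | zero => simp
  | succ L ih => simp [List.range_succ, ih]

/-- The holonomy of a closed lattice path is trivial as soon as the edge function is flat on a
suitable finite set of squares bounded by edges of the path. -/
theorem exists_finset_prod_stepVal_eq_one {G : Type*} [Group G] (TH TV : Set (ℤ × ℤ))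
    (v : ℕ → ℤ × ℤ) (L : ℕ) (hv : v 0 = v L) (hT : ∀ i < L, StepIn TH TV (v i) (v (i + 1))) :
    ∃ F : Finset (ℤ × ℤ), BoundaryEdgesIn F TH TV ∧ ∀ a b : ℤ × ℤ → G,
      (∀ Q ∈ F, FlatAt a b Q) →
        ((List.range L).map fun i => stepVal a b (v i) (v (i + 1))).prod = 1 := by
  obtain ⟨N, hN⟩ : ∃ N : ℤ, ∀ i ≤ L, |(v i).1| ≤ N ∧ |(v i).2| ≤ N := by
    refine ⟨∑ i ∈ Finset.range (L + 1), (|(v i).1| + |(v i).2|), fun i hi => ?_⟩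
    have := Finset.single_le_sum (f := fun i => |(v i).1| + |(v i).2|)
      (fun _ _ => by positivity) (Finset.mem_range.2 (Nat.lt_succ_of_le hi))
    have h1 := abs_nonneg (v i).1
    have h2 := abs_nonneg (v i).2
    constructor <;> linarith
  refine exists_finset_boundaryEdgesIn TH TV _ ?_
    (Finset.Icc (-N) N ×ˢ Finset.Icc (-N) N) ?_
  · intro a b a' b' ha hb h
    rw [← h]
    congr 1
    refine List.map_congr_left fun i hi => ?_
    obtain ⟨-, -, h1, h2, h3, h4⟩ := hT i (List.mem_range.1 hi)
    unfold stepVal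
    congr 1
    · split_ifs with h5 h6
      · exact ha _ (h1 h5)
      · rw [ha _ (h2 h6)]
      · rfl
    · split_ifs with h5 h6
      · exact hb _ (h3 h5)
      · rw [hb _ (h4 h6)]
      · rfl
  · intro a b hab
    obtain ⟨h, hb, ha⟩ := exists_gauge_of_flatAt_box N a b
      fun m n h1 h2 h3 h4 => hab (m, n) (by simp [*])
    have hs : ∀ i ∈ List.range L, stepVal a b (v i) (v (i + 1)) =
        (h (v i))⁻¹ * h (v (i + 1)) := by
      intro i hi
      have hi := List.mem_range.1 hi
      obtain ⟨h1, h2, -⟩ := hT i hi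
      obtain ⟨h3, h4⟩ := hN i hi.le
      obtain ⟨h5, h6⟩ := hN (i + 1) hi
      generalize v i = u at *
      generalize v (i + 1) = w at *
      obtain ⟨m, n⟩ := u
      obtain ⟨m', n'⟩ := w
      simp only [abs_le] at h1 h2 h3 h4 h5 h6
      have e1 : (if m' = m + 1 then a (m, n) else if m = m' + 1 then (a (m', n))⁻¹ else 1) =
          (h (m, n))⁻¹ * h (m', n) := by
        split_ifs with h7 h8
        · rw [h7, ha _ _ h3.1 h3.2 h4.1 h4.2]
        · rw [h8, ha _ _ h5.1 h5.2 h4.1 h4.2]; group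
        · rw [show m' = m by omega]; group
      have e2 : (if n' = n + 1 then b (m', n) else if n = n' + 1 then (b (m', n'))⁻¹ else 1) =
          (h (m', n))⁻¹ * h (m', n') := by
        split_ifs with h7 h8
        · rw [h7, hb]
        · rw [h8, hb]; group
        · rw [show n' = n by omega]; group
      simp only [stepVal, e1, e2]
      group
    rw [List.map_congr_left hs, List.prod_range_telescope (fun i => h (v i)), hv]
    group

theorem Path.homotopic_of_mem_convex {V C : Set ℂ} (hC : Convex ℝ C) (hCV : C ⊆ V) {x y : V}
    (p q : Path x y) (hp : ∀ t, (p t : ℂ) ∈ C) (hq : ∀ t, (q t : ℂ) ∈ C) : p.Homotopic q := by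
  have hmem : ∀ st : unitInterval × unitInterval,
      (1 - (st.1 : ℝ)) • (p st.2 : ℂ) + (st.1 : ℝ) • (q st.2 : ℂ) ∈ C := fun st =>
    hC (hp _) (hq _) (by linarith [st.1.2.2]) st.1.2.1 (by ring)
  exact ⟨{
    toFun := fun st => ⟨_, hCV (hmem st)⟩
    continuous_toFun := by fun_prop
    map_zero_left := fun t => by simp
    map_one_left := fun t => by simp
    prop' := fun s t ht => by
      rcases ht with rfl | rfl
      · ext1; simp; ring
      · ext1; simp; ring }⟩

/-- The segment from `a` to `b` as a path in a set containing it. -/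
def segmentPath {V : Set ℂ} (a b : ℂ) (h : segment ℝ a b ⊆ V) :
    Path (⟨a, h (left_mem_segment ℝ a b)⟩ : V) ⟨b, h (right_mem_segment ℝ a b)⟩ where
  toFun t := ⟨(1 - (t : ℝ)) • a + (t : ℝ) • b,
    h ⟨1 - (t : ℝ), t, by linarith [t.2.2], t.2.1, by ring, rfl⟩⟩
  continuous_toFun := by fun_prop
  source' := by simp
  target' := by simp

theorem segmentPath_mem {V : Set ℂ} {a b : ℂ} (h : segment ℝ a b ⊆ V) {C : Set ℂ}
    (hC : Convex ℝ C) (ha : a ∈ C) (hb : b ∈ C) (t : unitInterval) :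
    (segmentPath a b h t : ℂ) ∈ C :=
  hC ha hb (by linarith [t.2.2]) t.2.1 (by ring)

section LoopClass

open Path.Homotopic.Quotient

variable {X : Type*} [TopologicalSpace X] [PathConnectedSpace X] (x₀ : X)

/-- The inverse of the class of the loop obtained from `p` by joining its endpoints to the
base point. -/
def loopClass {x y : X} (p : Path x y) : FundamentalGroup X x₀ :=
  FundamentalGroup.fromPath
    ((mk (PathConnectedSpace.somePath x₀ y)).trans
      ((mk p).symm.trans (mk (PathConnectedSpace.somePath x₀ x)).symm))

theorem loopClass_congr {x y : X} {p q : Path x y} (h : p.Homotopic q) :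
    loopClass x₀ p = loopClass x₀ q := by
  rw [loopClass, loopClass, Path.Homotopic.Quotient.eq.2 h]

theorem loopClass_trans {x y z : X} (p : Path x y) (q : Path y z) :
    loopClass x₀ (p.trans q) = loopClass x₀ p * loopClass x₀ q := by
  have h : (mk (p.trans q)).symm = (mk q).symm.trans (mk p).symm := by
    rw [← mk_symm, ← mk_symm, ← mk_symm, ← mk_trans, Path.trans_symm]
  have h' : ∀ (u : Path.Homotopic.Quotient x₀ y) {w : X} (v : Path.Homotopic.Quotient y w),
      u.symm.trans (u.trans v) = v := fun u w v => by
    rw [← trans_assoc, symm_trans, refl_trans]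
  change _ = Path.Homotopic.Quotient.trans _ _
  simp only [loopClass, h, trans_assoc, h']

theorem loopClass_cast {x y x' y' : X} (p : Path x y) (hx : x' = x) (hy : y' = y) :
    loopClass x₀ (p.cast hx hy) = loopClass x₀ p := by
  subst hx hy; rfl

theorem homotopic_refl_of_loopClass_eq_one (p : Path x₀ x₀) (h : loopClass x₀ p = 1) :
    p.Homotopic (Path.refl x₀) := by
  set u := mk (PathConnectedSpace.somePath x₀ x₀)
  have h : u.trans ((mk p).symm.trans u.symm) = refl x₀ := h
  have h2 : (mk p).symm = refl x₀ := by
    have := congrArg (fun w => u.symm.trans (w.trans u)) h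
    simpa [trans_assoc, ← trans_assoc u.symm] using this
  rw [← mk_symm] at h2
  have h3 := (Path.Homotopic.Quotient.exact (h2.trans (mk_refl x₀).symm)).symm₂
  simpa using h3

end LoopClass

/-- For every base point there is a locally defined additive `G`-valued function of two points
whose products along partitions detect whether a loop is null-homotopic. -/
theorem exists_local_cocycle {V : Set ℂ} [PathConnectedSpace V] (x₀ : V) :
    ∃ (G : Type) (_ : Group G) (g : ℂ → ℂ → G),
      (∀ C ⊆ V, Convex ℝ C → ∀ a ∈ C, ∀ b ∈ C, ∀ c ∈ C, g a b * g b c = g a c) ∧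
      ∀ (γ : Path x₀ x₀) (L : ℕ) (s : ℕ → unitInterval), Monotone s → s 0 = 0 → s L = 1 →
        (∀ i < L, ∃ C ⊆ V, Convex ℝ C ∧ ∀ t ∈ Icc (s i) (s (i + 1)), (γ t : ℂ) ∈ C) →
        ((List.range L).map fun i => g (γ (s i)) (γ (s (i + 1)))).prod = 1 →
        γ.Homotopic (Path.refl x₀) := by
  classical
  have hg : ∀ {x y : V} (p : Path x y) {C : Set ℂ}, C ⊆ V → Convex ℝ C →
      (∀ t, (p t : ℂ) ∈ C) →
      (if h : segment ℝ (x : ℂ) y ⊆ V then loopClass x₀ (segmentPath _ _ h) else 1) =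
        loopClass x₀ p := by
    intro x y p C hCV hC hp
    have hx : (x : ℂ) ∈ C := by simpa using hp 0
    have hy : (y : ℂ) ∈ C := by simpa using hp 1
    rw [dif_pos ((hC.segment_subset hx hy).trans hCV)]
    exact loopClass_congr x₀ (Path.homotopic_of_mem_convex hC hCV _ _
      (segmentPath_mem _ hC hx hy) hp)
  refine ⟨FundamentalGroup V x₀, inferInstance,
    fun a b => if h : segment ℝ a b ⊆ V then loopClass x₀ (segmentPath a b h) else 1, ?_, ?_⟩
  · intro C hCV hC a ha b hb c hc
    have h1 := (hC.segment_subset ha hb).trans hCV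
    have h2 := (hC.segment_subset hb hc).trans hCV
    have := hg ((segmentPath a b h1).trans (segmentPath b c h2)) hCV hC (fun t => by
      rw [Path.trans_apply]
      split_ifs
      · exact segmentPath_mem _ hC ha hb _
      · exact segmentPath_mem _ hC hb hc _)
    simp only [dif_pos h1, dif_pos h2]
    rw [← loopClass_trans]
    exact this.symm
  · intro γ L s hs h0 hL hC h1
    have hk : ∀ k ≤ L, ((List.range k).map fun i =>
        if h : segment ℝ (γ (s i) : ℂ) (γ (s (i + 1))) ⊆ V then
          loopClass x₀ (segmentPath _ _ h) else 1).prod =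
        loopClass x₀ (γ.subpath (s 0) (s k)) := by
      intro k
      induction k with
      | zero =>
        intro _
        have : loopClass x₀ (Path.refl (γ (s 0))) = 1 := by
          have h := loopClass_trans x₀ (Path.refl (γ (s 0))) (Path.refl (γ (s 0)))
          rw [Path.refl_trans_refl] at h
          exact mul_eq_left.1 h.symm
        simp [this]
      | succ k ih =>
        intro hk
        rw [List.range_succ, List.map_append, List.prod_append, ih (by omega)]
        obtain ⟨C, hCV, hCc, hCt⟩ := hC k (by omega)
        have := hg (γ.subpath (s k) (s (k + 1))) hCV hCc (fun t => by
          have : γ.subpath (s k) (s (k + 1)) t ∈ range (γ.subpath (s k) (s (k + 1))) := ⟨t, rfl⟩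
          rw [Path.range_subpath_of_le _ _ _ (hs k.le_succ)] at this
          obtain ⟨t', ht', h⟩ := this
          rw [← h]; exact hCt t' ht')
        simp only [List.map_cons, List.map_nil, List.prod_cons, List.prod_nil, mul_one, this]
        rw [← loopClass_trans]
        exact loopClass_congr _ ⟨Path.Homotopy.subpathTransSubpath γ _ _ _⟩
    have h2 := hk L le_rfl
    rw [h1, h0, hL, Path.subpath_zero_one, loopClass_cast] at h2
    exact homotopic_refl_of_loopClass_eq_one x₀ γ h2.symm

/-- The lattice point of mesh `δ` with integer coordinates `e`. -/
def latticePt (δ : ℝ) (e : ℤ × ℤ) : ℂ := ⟨δ * e.1, δ * e.2⟩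

/-- The closed square of mesh `δ` with lower left corner `latticePt δ Q`. -/
def latticeSquare (δ : ℝ) (Q : ℤ × ℤ) : Set ℂ :=
  {z | Q.1 ≤ z.re / δ ∧ z.re / δ ≤ Q.1 + 1 ∧ Q.2 ≤ z.im / δ ∧ z.im / δ ≤ Q.2 + 1}

theorem latticeSquare_eq {δ : ℝ} (hδ : 0 < δ) (Q : ℤ × ℤ) :
    latticeSquare δ Q = Icc (δ * Q.1) (δ * (Q.1 + 1)) ×ℂ Icc (δ * Q.2) (δ * (Q.2 + 1)) := by
  ext z
  simp only [latticeSquare, mem_ofPred_eq, Complex.mem_reProdIm, mem_Icc, le_div_iff₀ hδ,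
    div_le_iff₀ hδ, mul_comm δ, and_assoc]

theorem isCompact_latticeSquare {δ : ℝ} (hδ : 0 < δ) (Q : ℤ × ℤ) :
    IsCompact (latticeSquare δ Q) := by
  rw [latticeSquare_eq hδ]
  exact isCompact_Icc.reProdIm isCompact_Icc

theorem convex_latticeSquare {δ : ℝ} (hδ : 0 < δ) (Q : ℤ × ℤ) :
    Convex ℝ (latticeSquare δ Q) := by
  rw [latticeSquare_eq hδ]
  exact ((convex_Icc _ _).linear_preimage Complex.reLm).inter
    ((convex_Icc _ _).linear_preimage Complex.imLm)

theorem latticePt_mem_latticeSquare {δ : ℝ} (hδ : 0 < δ) {e Q : ℤ × ℤ}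
    (h1 : Q.1 ≤ e.1) (h2 : e.1 ≤ Q.1 + 1) (h3 : Q.2 ≤ e.2) (h4 : e.2 ≤ Q.2 + 1) :
    latticePt δ e ∈ latticeSquare δ Q := by
  have h5 : ∀ x : ℝ, δ * x / δ = x := fun x => by field_simp
  simp only [latticeSquare, latticePt, mem_ofPred_eq, h5]
  refine ⟨?_, ?_, ?_, ?_⟩ <;> exact_mod_cast ‹_›

theorem mem_vertical_edge {δ : ℝ} (hδ : 0 < δ) {z : ℂ} {e : ℤ × ℤ} (h1 : z.re / δ = e.1)
    (h2 : e.2 ≤ z.im / δ) (h3 : z.im / δ ≤ e.2 + 1) :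
    z ∈ segment ℝ (latticePt δ e) (latticePt δ (e.1, e.2 + 1)) := by
  refine ⟨1 - (z.im / δ - e.2), z.im / δ - e.2, by linarith, by linarith, by ring, ?_⟩
  rw [div_eq_iff hδ.ne'] at h1
  apply Complex.ext
  · simp [latticePt, h1]; ring
  · simp [latticePt]; field_simp; ring

theorem mem_horizontal_edge {δ : ℝ} (hδ : 0 < δ) {z : ℂ} {e : ℤ × ℤ} (h1 : z.im / δ = e.2)
    (h2 : e.1 ≤ z.re / δ) (h3 : z.re / δ ≤ e.1 + 1) :
    z ∈ segment ℝ (latticePt δ e) (latticePt δ (e.1 + 1, e.2)) := by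
  refine ⟨1 - (z.re / δ - e.1), z.re / δ - e.1, by linarith, by linarith, by ring, ?_⟩
  rw [div_eq_iff hδ.ne'] at h1
  apply Complex.ext
  · simp [latticePt]; field_simp; ring
  · simp [latticePt, h1]; ring

theorem eventually_floor_le_le (u : ℝ) : ∀ᶠ y : ℝ in 𝓝 u, (⌊y⌋ : ℝ) ≤ u ∧ u ≤ ⌊y⌋ + 1 := by
  have h1 : ∀ᶠ y : ℝ in 𝓝 u, y < ⌊u⌋ + 1 := eventually_lt_nhds (Int.lt_floor_add_one u)
  have h2 : ∀ᶠ y : ℝ in 𝓝 u, (⌈u⌉ : ℝ) - 1 < y :=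
    eventually_gt_nhds (by linarith [Int.ceil_lt_add_one u])
  filter_upwards [h1, h2] with y h1 h2
  have h3 : ⌊y⌋ ≤ ⌊u⌋ := Int.lt_add_one_iff.1 (Int.floor_lt.2 (by exact_mod_cast h1))
  have h4 : ⌈u⌉ ≤ ⌊y⌋ + 1 := by
    have := Int.lt_floor_add_one y
    have h5 : (⌈u⌉ : ℝ) < ⌊y⌋ + 1 + 1 := by linarith
    exact Int.lt_add_one_iff.1 (by exact_mod_cast h5)
  constructor
  · exact le_trans (by exact_mod_cast h3) (Int.floor_le u)
  · exact le_trans (Int.le_ceil u) (by exact_mod_cast h4)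

theorem frontier_biUnion_latticeSquare_subset {δ : ℝ} (hδ : 0 < δ) {F : Finset (ℤ × ℤ)}
    {TH TV : Set (ℤ × ℤ)} (hF : BoundaryEdgesIn F TH TV) {V : Set ℂ}
    (hTH : ∀ e ∈ TH, segment ℝ (latticePt δ e) (latticePt δ (e.1 + 1, e.2)) ⊆ V)
    (hTV : ∀ e ∈ TV, segment ℝ (latticePt δ e) (latticePt δ (e.1, e.2 + 1)) ⊆ V) :
    frontier (⋃ Q ∈ F, latticeSquare δ Q) ⊆ V := by
  intro z hz
  by_contra hzV
  have hcl : IsClosed (⋃ Q ∈ F, latticeSquare δ Q) :=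
    (F.isCompact_biUnion fun Q _ => isCompact_latticeSquare hδ Q).isClosed
  have hzA : z ∈ ⋃ Q ∈ F, latticeSquare δ Q := hcl.frontier_subset hz
  obtain ⟨Q, hQ, hzQ⟩ := mem_iUnion₂.1 hzA
  have right : ∀ m n : ℤ, (m, n) ∈ F → z ∈ latticeSquare δ (m, n) →
      z ∈ latticeSquare δ (m + 1, n) → (m + 1, n) ∈ F := by
    rintro m n hR ⟨-, h2, h3, h4⟩ ⟨h5, -⟩
    by_contra hn
    push_cast at *
    exact hzV (hTV _ ((hF _ hR).2.2.2 hn) (mem_vertical_edge hδ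
      (by push_cast; linarith) h3 h4))
  have left : ∀ m n : ℤ, (m, n) ∈ F → z ∈ latticeSquare δ (m, n) →
      z ∈ latticeSquare δ (m - 1, n) → (m - 1, n) ∈ F := by
    rintro m n hR ⟨h1, h2, h3, h4⟩ ⟨-, h5, -⟩
    by_contra hn
    push_cast at *
    exact hzV (hTV _ ((hF _ hR).2.2.1 hn) (mem_vertical_edge hδ
      (by push_cast; linarith) h3 h4))
  have up : ∀ m n : ℤ, (m, n) ∈ F → z ∈ latticeSquare δ (m, n) →
      z ∈ latticeSquare δ (m, n + 1) → (m, n + 1) ∈ F := by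
    rintro m n hR ⟨h1, h2, h3, h4⟩ ⟨-, -, h5, -⟩
    by_contra hn
    push_cast at *
    exact hzV (hTH _ ((hF _ hR).2.1 hn) (mem_horizontal_edge hδ
      (by push_cast; linarith) h1 h2))
  have down : ∀ m n : ℤ, (m, n) ∈ F → z ∈ latticeSquare δ (m, n) →
      z ∈ latticeSquare δ (m, n - 1) → (m, n - 1) ∈ F := by
    rintro m n hR ⟨h1, h2, h3, h4⟩ ⟨-, -, -, h5⟩
    by_contra hn
    push_cast at *
    exact hzV (hTH _ ((hF _ hR).1 hn) (mem_horizontal_edge hδ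
      (by push_cast; linarith) h1 h2))
  have key : ∀ R : ℤ × ℤ, z ∈ latticeSquare δ R → R ∈ F := by
    rintro ⟨m', n'⟩ hR
    obtain ⟨m, n⟩ := Q
    have hcast : ∀ i j : ℤ, ∀ x : ℝ, (i : ℝ) ≤ x → x ≤ j + 1 → i ≤ j + 1 := fun i j x h1 h2 => by
      exact_mod_cast h1.trans h2
    have hm1 := hcast _ _ _ hzQ.1 hR.2.1
    have hm2 := hcast _ _ _ hR.1 hzQ.2.1
    have hn1 := hcast _ _ _ hzQ.2.2.1 hR.2.2.2
    have hn2 := hcast _ _ _ hR.2.2.1 hzQ.2.2.2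
    have hz' : z ∈ latticeSquare δ (m', n) := ⟨hR.1, hR.2.1, hzQ.2.2.1, hzQ.2.2.2⟩
    have h1 : (m', n) ∈ F := by
      rcases show m' = m ∨ m' = m + 1 ∨ m' = m - 1 by simp only at *; omega with rfl | rfl | rfl
      · exact hQ
      · exact right _ _ hQ hzQ hz'
      · exact left _ _ hQ hzQ hz'
    rcases show n' = n ∨ n' = n + 1 ∨ n' = n - 1 by simp only at *; omega with rfl | rfl | rfl
    · exact h1
    · exact up _ _ h1 hz' hR
    · exact down _ _ h1 hz' hR
  refine hz.2 (mem_interior_iff_mem_nhds.2 ?_)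
  have hre : ∀ᶠ y : ℂ in 𝓝 z, (⌊y.re / δ⌋ : ℝ) ≤ z.re / δ ∧ z.re / δ ≤ ⌊y.re / δ⌋ + 1 :=
    ((Complex.continuous_re.div_const δ).tendsto z).eventually (eventually_floor_le_le _)
  have him : ∀ᶠ y : ℂ in 𝓝 z, (⌊y.im / δ⌋ : ℝ) ≤ z.im / δ ∧ z.im / δ ≤ ⌊y.im / δ⌋ + 1 :=
    ((Complex.continuous_im.div_const δ).tendsto z).eventually (eventually_floor_le_le _)
  filter_upwards [hre, him] with y h1 h2
  refine mem_iUnion₂.2 ⟨(⌊y.re / δ⌋, ⌊y.im / δ⌋), key _ ⟨h1.1, h1.2, h2.1, h2.2⟩, ?_⟩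
  exact ⟨Int.floor_le _, (Int.lt_floor_add_one _).le, Int.floor_le _, (Int.lt_floor_add_one _).le⟩

theorem List.prod_range_conj {G : Type*} [Group G] (h s : ℕ → G) (L : ℕ) :
    ((List.range L).map fun i => h i * s i * (h (i + 1))⁻¹).prod =
      h 0 * ((List.range L).map s).prod * (h L)⁻¹ := by
  induction L with
  | zero => simp
  | succ L ih =>
    simp only [List.range_succ, List.map_append, List.prod_append, ih, List.map_cons, List.map_nil,
      List.prod_cons, List.prod_nil]
    group

/-- The lattice point of mesh `δ` at the lower left of `z`. -/
def latticeFloor (δ : ℝ) (z : ℂ) : ℤ × ℤ := (⌊z.re / δ⌋, ⌊z.im / δ⌋)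

theorem floor_div_mul_near {δ : ℝ} (hδ : 0 < δ) (x : ℝ) : |δ * ⌊x / δ⌋ - x| ≤ δ := by
  have h1 := Int.floor_le (x / δ)
  have h2 := (Int.lt_floor_add_one (x / δ)).le
  rw [le_div_iff₀ hδ] at h1
  rw [div_le_iff₀ hδ] at h2
  rw [abs_le]; constructor <;> nlinarith

theorem floor_div_sub_le {δ : ℝ} (hδ : 0 < δ) {x y : ℝ} (h : |y - x| < δ) :
    |⌊y / δ⌋ - ⌊x / δ⌋| ≤ 1 := by
  have h1 := Int.floor_le (x / δ)
  have h2 := Int.lt_floor_add_one (x / δ)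
  have h3 := Int.floor_le (y / δ)
  have h4 := Int.lt_floor_add_one (y / δ)
  have h5 : |y / δ - x / δ| < 1 := by
    rw [← sub_div, abs_div, abs_of_pos hδ, div_lt_one hδ]; exact h
  rw [abs_lt] at h5
  have h6 : ((⌊y / δ⌋ - ⌊x / δ⌋ : ℤ) : ℝ) < 2 := by push_cast; linarith
  have h7 : (-2 : ℝ) < ((⌊y / δ⌋ - ⌊x / δ⌋ : ℤ) : ℝ) := by push_cast; linarith
  have h8 : ⌊y / δ⌋ - ⌊x / δ⌋ < 2 := by exact_mod_cast h6
  have h9 : -2 < ⌊y / δ⌋ - ⌊x / δ⌋ := by exact_mod_cast h7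
  rw [abs_le]; omega

theorem mk_mem_ball {z : ℂ} {x y r s : ℝ} (hx : |x - z.re| ≤ r) (hy : |y - z.im| ≤ s) {t : ℝ}
    (h : r + s < t) : (⟨x, y⟩ : ℂ) ∈ ball z t := by
  rw [mem_ball, Complex.dist_eq]
  exact (Complex.norm_le_abs_re_add_abs_im _).trans_lt (by simp; linarith)

/-- The value of a local cocycle along a short lattice step is `stepVal`. -/
theorem stepVal_eq_of_cocycle {G : Type*} [Group G] {g : ℂ → ℂ → G} {C : Set ℂ}
    (hg : ∀ a ∈ C, ∀ b ∈ C, ∀ c ∈ C, g a b * g b c = g a c) {δ : ℝ} {u w : ℤ × ℤ}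
    (h1 : |w.1 - u.1| ≤ 1) (h2 : |w.2 - u.2| ≤ 1) (hu : latticePt δ u ∈ C)
    (huw : latticePt δ (w.1, u.2) ∈ C) (hw : latticePt δ w ∈ C) :
    stepVal (fun e => g (latticePt δ e) (latticePt δ (e.1 + 1, e.2)))
      (fun e => g (latticePt δ e) (latticePt δ (e.1, e.2 + 1))) u w =
      g (latticePt δ u) (latticePt δ w) := by
  have hone : ∀ a ∈ C, g a a = 1 := fun a ha => mul_eq_left.1 (hg a ha a ha a ha)
  have hinv : ∀ a ∈ C, ∀ b ∈ C, (g a b)⁻¹ = g b a := fun a ha b hb =>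
    inv_eq_of_mul_eq_one_right (by rw [hg a ha b hb a ha, hone a ha])
  obtain ⟨m, n⟩ := u
  obtain ⟨m', n'⟩ := w
  simp only [abs_le] at h1 h2 hu huw hw
  rw [← hg _ hu _ huw _ hw, stepVal]
  congr 1
  · simp only
    split_ifs with h3 h4
    · rw [h3]
    · rw [← h4, hinv _ huw _ hu]
    · obtain rfl : m' = m := by omega
      rw [hone _ hu]
  · simp only
    split_ifs with h3 h4
    · rw [h3]
    · rw [← h4, hinv _ hw _ huw]
    · obtain rfl : n' = n := by omega
      rw [hone _ hw]

/-- A plane domain containing every compact set whose frontier it contains is simply connected. -/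
theorem simplyConnectedSpace_of_forall_isCompact {V : Set ℂ} (hV : IsOpen V) (hVc : IsConnected V)
    (hfill : ∀ A : Set ℂ, IsCompact A → frontier A ⊆ V → A ⊆ V) : SimplyConnectedSpace V := by
  have : PathConnectedSpace V := isPathConnected_iff_pathConnectedSpace.1
    (hV.isConnected_iff_isPathConnected.1 hVc)
  rw [simply_connected_iff_loops_nullhomotopic]
  refine ⟨this, fun x₀ γ => ?_⟩
  obtain ⟨G, _, g, hg, hγ⟩ := exists_local_cocycle x₀
  have hcont : Continuous fun t => (γ t : ℂ) := by fun_prop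
  obtain ⟨ρ, hρ, hρV⟩ := (isCompact_range hcont).exists_thickening_subset_open hV
    (by rintro _ ⟨t, rfl⟩; exact (γ t).2)
  obtain ⟨δ, hδ, hδρ⟩ : ∃ δ > 0, 8 * δ = ρ := ⟨ρ / 8, by positivity, by ring⟩
  have hball : ∀ t, ball (γ t : ℂ) (8 * δ) ⊆ V := fun t => by
    rw [hδρ]
    exact (ball_subset_thickening (mem_range_self (f := fun t => (γ t : ℂ)) t) ρ).trans hρV
  obtain ⟨η, hη, hηδ⟩ := Metric.uniformContinuous_iff.1
    (CompactSpace.uniformContinuous_of_continuous hcont) δ hδ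
  obtain ⟨k, hk⟩ := exists_nat_one_div_lt hη
  set L := k + 1 with hL
  have hLpos : (0 : ℝ) < L := by positivity
  set s : ℕ → unitInterval := fun i => projIcc 0 1 zero_le_one (i / L) with hs
  have hsmono : Monotone s := fun i j hij => monotone_projIcc _ (by gcongr)
  have hs0 : s 0 = 0 := by simp [hs]
  have hsL : s L = 1 := by
    simp only [hs, div_self hLpos.ne']
    exact projIcc_right (zero_le_one (α := ℝ))
  have hsval : ∀ i ≤ L, (s i : ℝ) = i / L := fun i hi => by
    have : (i : ℝ) / L ∈ Icc (0 : ℝ) 1 :=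
      ⟨by positivity, (div_le_one hLpos).2 (by exact_mod_cast hi)⟩
    simp only [hs, projIcc_of_mem _ this]
  have hnear : ∀ i < L, ∀ t ∈ Icc (s i) (s (i + 1)), dist (γ t : ℂ) (γ (s i)) < δ := by
    intro i hi t ht
    apply hηδ
    have h1 : (s i : ℝ) ≤ t := ht.1
    have h2 : (t : ℝ) ≤ s (i + 1) := ht.2
    rw [hsval _ hi.le] at h1
    rw [hsval _ hi] at h2
    rw [Subtype.dist_eq, Real.dist_eq, hsval _ hi.le, abs_of_nonneg (by linarith)]
    refine lt_of_le_of_lt ?_ hk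
    calc (t : ℝ) - i / L ≤ ((i + 1 : ℕ) : ℝ) / L - i / L := by linarith
      _ = 1 / (k + 1) := by rw [← sub_div, hL]; push_cast; congr 1; ring
  set v : ℕ → ℤ × ℤ := fun i => latticeFloor δ (γ (s i)) with hv
  have hv0 : v 0 = v L := by simp [hv, hs0, hsL]
  -- the points involved in the `i`-th step lie in a small disk
  have hself : ∀ i, (γ (s i) : ℂ) ∈ ball (γ (s i) : ℂ) (8 * δ) := fun i =>
    mem_ball_self (by positivity)
  have hvi : ∀ i, latticePt δ (v i) ∈ ball (γ (s i) : ℂ) (8 * δ) := fun i =>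
    mk_mem_ball (floor_div_mul_near hδ _) (floor_div_mul_near hδ _) (by linarith)
  have hcoord : ∀ i < L, |(γ (s (i + 1)) : ℂ).re - (γ (s i) : ℂ).re| < δ ∧
      |(γ (s (i + 1)) : ℂ).im - (γ (s i) : ℂ).im| < δ := fun i hi => by
    have h := hnear i hi _ ⟨hsmono i.le_succ, le_rfl⟩
    rw [Complex.dist_eq] at h
    exact ⟨(Complex.abs_re_le_norm (_ - _)).trans_lt h, (Complex.abs_im_le_norm (_ - _)).trans_lt h⟩
  have htwo : ∀ {x y : ℝ}, |y - x| < δ → |δ * ⌊y / δ⌋ - x| ≤ 2 * δ := fun {x y} h => by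
    have h1 := floor_div_mul_near hδ y
    calc |δ * ⌊y / δ⌋ - x| = |(δ * ⌊y / δ⌋ - y) + (y - x)| := by ring_nf
      _ ≤ _ := abs_add_le _ _
      _ ≤ 2 * δ := by linarith
  have hvs : ∀ i < L, latticePt δ (v (i + 1)) ∈ ball (γ (s i) : ℂ) (8 * δ) := fun i hi =>
    mk_mem_ball (htwo (hcoord i hi).1) (htwo (hcoord i hi).2) (by linarith)
  have hvc : ∀ i < L, latticePt δ ((v (i + 1)).1, (v i).2) ∈ ball (γ (s i) : ℂ) (8 * δ) :=
    fun i hi => mk_mem_ball (htwo (hcoord i hi).1) (floor_div_mul_near hδ _) (by linarith)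
  have hstep : ∀ i < L, |(v (i + 1)).1 - (v i).1| ≤ 1 ∧ |(v (i + 1)).2 - (v i).2| ≤ 1 :=
    fun i hi => ⟨floor_div_sub_le hδ (hcoord i hi).1, floor_div_sub_le hδ (hcoord i hi).2⟩
  have hseg : ∀ i, ∀ x ∈ ball (γ (s i) : ℂ) (8 * δ), ∀ y ∈ ball (γ (s i) : ℂ) (8 * δ),
      segment ℝ x y ⊆ V := fun i x hx y hy =>
    ((convex_ball _ _).segment_subset hx hy).trans (hball _)
  obtain ⟨F, hF, hFflat⟩ := exists_finset_prod_stepVal_eq_one (G := G)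
    {e | segment ℝ (latticePt δ e) (latticePt δ (e.1 + 1, e.2)) ⊆ V}
    {e | segment ℝ (latticePt δ e) (latticePt δ (e.1, e.2 + 1)) ⊆ V} v L hv0 (by
      intro i hi
      have hA := hvi i
      have hB := hvc i hi
      have hC := hvs i hi
      have hS := hseg i
      refine ⟨(hstep i hi).1, (hstep i hi).2, ?_⟩
      generalize v i = u at *
      generalize v (i + 1) = w at *
      obtain ⟨m, n⟩ := u
      obtain ⟨m', n'⟩ := w
      simp only at hA hB hC ⊢
      refine ⟨?_, ?_, ?_, ?_⟩ <;> rintro rfl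
      · exact hS _ hA _ hB
      · exact hS _ hB _ hA
      · exact hS _ hB _ hC
      · exact hS _ hC _ hB)
  have hA : ∀ Q ∈ F, latticeSquare δ Q ⊆ V := fun Q hQ =>
    (subset_biUnion_of_mem (u := fun Q => latticeSquare δ Q) (show Q ∈ (F : Set _) from hQ)).trans
      (hfill _ (F.isCompact_biUnion fun Q _ => isCompact_latticeSquare hδ Q)
        (frontier_biUnion_latticeSquare_subset hδ hF (fun _ h => h) fun _ h => h))
  have hprod := hFflat (fun e => g (latticePt δ e) (latticePt δ (e.1 + 1, e.2)))
    (fun e => g (latticePt δ e) (latticePt δ (e.1, e.2 + 1))) (by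
      rintro ⟨m, n⟩ hQ
      have hsq := hg _ (hA _ hQ) (convex_latticeSquare hδ _)
      have h1 : latticePt δ (m, n) ∈ latticeSquare δ (m, n) := by
        apply latticePt_mem_latticeSquare hδ <;> simp
      have h2 : latticePt δ (m + 1, n) ∈ latticeSquare δ (m, n) := by
        apply latticePt_mem_latticeSquare hδ <;> simp
      have h3 : latticePt δ (m, n + 1) ∈ latticeSquare δ (m, n) := by
        apply latticePt_mem_latticeSquare hδ <;> simp
      have h4 : latticePt δ (m + 1, n + 1) ∈ latticeSquare δ (m, n) := by
        apply latticePt_mem_latticeSquare hδ <;> simp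
      simp only [FlatAt]
      rw [hsq _ h1 _ h2 _ h4, hsq _ h1 _ h3 _ h4])
  refine hγ γ L s hsmono hs0 hsL (fun i hi => ⟨_, hball (s i), convex_ball _ _, fun t ht => ?_⟩) ?_
  · exact mem_ball.2 ((hnear i hi t ht).trans (by linarith))
  · have hterm : ∀ i ∈ List.range L, g (γ (s i)) (γ (s (i + 1))) =
        g (γ (s i)) (latticePt δ (v i)) *
          stepVal (fun e => g (latticePt δ e) (latticePt δ (e.1 + 1, e.2)))
            (fun e => g (latticePt δ e) (latticePt δ (e.1, e.2 + 1))) (v i) (v (i + 1)) *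
          (g (γ (s (i + 1))) (latticePt δ (v (i + 1))))⁻¹ := by
      intro i hi
      have hi := List.mem_range.1 hi
      have hc := hg _ (hball (s i)) (convex_ball _ _)
      have hn : (γ (s (i + 1)) : ℂ) ∈ ball (γ (s i) : ℂ) (8 * δ) :=
        mem_ball.2 ((hnear i hi _ ⟨hsmono i.le_succ, le_rfl⟩).trans (by linarith))
      rw [stepVal_eq_of_cocycle hc (hstep i hi).1 (hstep i hi).2 (hvi i) (hvc i hi) (hvs i hi),
        hc _ (hself i) _ (hvi i) _ (hvs i hi), eq_mul_inv_iff_mul_eq,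
        hc _ (hself i) _ hn _ (hvs i hi)]
    rw [List.map_congr_left hterm,
      List.prod_range_conj (fun i => g (γ (s i)) (latticePt δ (v i))), hprod, ← hv0, hs0, hsL]
    simp

/-- The polynomial is comparable to its leading term near infinity. -/
theorem Polynomial.eventually_cobounded_norm_eval (P : Polynomial ℂ) (hP : P ≠ 0) :
    ∀ᶠ z in Bornology.cobounded ℂ,
      ‖P.leadingCoeff‖ / 2 * ‖z‖ ^ P.natDegree ≤ ‖P.eval z‖ ∧
        ‖P.eval z‖ ≤ 2 * ‖P.leadingCoeff‖ * ‖z‖ ^ P.natDegree := by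
  have hl : 0 < ‖P.leadingCoeff‖ := by simpa using hP
  have ht : Tendsto (fun z : ℂ => ‖P.reverse.eval z⁻¹‖) (Bornology.cobounded ℂ)
      (𝓝 ‖P.leadingCoeff‖) := by
    have h0 : ‖P.leadingCoeff‖ = ‖P.reverse.eval 0‖ := by
      rw [← Polynomial.coeff_zero_eq_eval_zero, Polynomial.coeff_zero_reverse]
    rw [h0]
    exact (P.reverse.continuous.norm.tendsto 0).comp tendsto_inv₀_cobounded
  filter_upwards [ht.eventually (lt_mem_nhds (half_lt_self hl)),
    ht.eventually (gt_mem_nhds (show ‖P.leadingCoeff‖ < 2 * ‖P.leadingCoeff‖ by linarith)),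
    (tendsto_norm_cobounded_atTop (E := ℂ)).eventually (eventually_gt_atTop 0)] with z h1 h2 h3
  have hz : z ≠ 0 := norm_pos_iff.1 h3
  have key : P.eval z = P.reverse.eval z⁻¹ * z ^ P.natDegree := by
    let : Invertible z := invertibleOfNonzero hz
    have := Polynomial.eval₂_reverse_mul_pow (RingHom.id ℂ) z P
    rw [invOf_eq_inv] at this
    exact this.symm
  rw [key, norm_mul, norm_pow]
  constructor <;> gcongr

/-- The cone-shaped neighbourhood of infinity in which forward orbits escape. -/
def escapeCone (M R : ℝ) : Set (ℂ × ℂ) := {x | R ≤ ‖x.1‖ ∧ ‖x.2‖ ≤ M * ‖x.1‖}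

/-- `F` maps the cone into itself, with growth factor `g` and growth of degree `d` up to `K`
on the logarithmic scale, and controls the second coordinate off the cone. -/
structure EscapesOn (M R g K : ℝ) (d : ℕ) (F : ℂ × ℂ → ℂ × ℂ) : Prop where
  mapsTo : ∀ x ∈ escapeCone M R, F x ∈ escapeCone M R
  growth : ∀ x ∈ escapeCone M R, g * ‖x.1‖ ≤ ‖(F x).1‖
  log_growth : ∀ x ∈ escapeCone M R, |Real.log ‖(F x).1‖ - d * Real.log ‖x.1‖| ≤ K
  snd_le : ∀ x, F x ∉ escapeCone M R → ‖(F x).2‖ ≤ max (M * R) ‖x.2‖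

theorem EscapesOn.id (M R : ℝ) : EscapesOn M R 1 0 1 id where
  mapsTo x hx := hx
  growth x _ := by simp
  log_growth x _ := by simp
  snd_le x _ := by simp

theorem EscapesOn.comp {M R g₁ g₂ K₁ K₂ : ℝ} {d₁ d₂ : ℕ} {F₁ F₂ : ℂ × ℂ → ℂ × ℂ} (hg : 0 ≤ g₁)
    (h₁ : EscapesOn M R g₁ K₁ d₁ F₁) (h₂ : EscapesOn M R g₂ K₂ d₂ F₂) :
    EscapesOn M R (g₁ * g₂) (K₁ + d₁ * K₂) (d₁ * d₂) (F₁ ∘ F₂) where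
  mapsTo x hx := h₁.mapsTo _ (h₂.mapsTo x hx)
  growth x hx := by
    rw [mul_assoc]
    exact (mul_le_mul_of_nonneg_left (h₂.growth x hx) hg).trans (h₁.growth _ (h₂.mapsTo x hx))
  log_growth x hx := by
    have e₁ := h₁.log_growth _ (h₂.mapsTo x hx)
    have e₂ := mul_le_mul_of_nonneg_left (h₂.log_growth x hx) (Nat.cast_nonneg (α := ℝ) d₁)
    rw [← abs_of_nonneg (Nat.cast_nonneg (α := ℝ) d₁), ← abs_mul,
      abs_of_nonneg (Nat.cast_nonneg (α := ℝ) d₁)] at e₂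
    have := (abs_add_le _ _).trans (add_le_add e₁ e₂)
    refine le_of_eq_of_le (congrArg _ ?_) this
    rw [Function.comp_apply]
    push_cast
    ring
  snd_le x hx := by
    have hx₂ : F₂ x ∉ escapeCone M R := fun h => hx (h₁.mapsTo _ h)
    exact (h₁.snd_le _ hx).trans (max_le (le_max_left _ _) (h₂.snd_le x hx₂))

theorem ElemHenon.exists_escapesOn (h : ElemHenon) {M : ℝ} (hM : 1 ≤ M) (hb : ‖h.b‖ ≤ M) :
    ∃ K, ∀ᶠ R in atTop, EscapesOn M R 2 K h.P.natDegree h.toFun := by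
  have hP : h.P ≠ 0 := by
    intro h0
    have := h.hdeg
    simp [h0] at this
  set l := ‖h.P.leadingCoeff‖ with hl
  set d := h.P.natDegree with hd
  have hd2 : 2 ≤ d := h.hdeg
  have hl0 : 0 < l := by simpa [hl] using hP
  refine ⟨|Real.log (l / 4)| + |Real.log (3 * l)|, ?_⟩
  obtain ⟨R₀, hR₀⟩ : ∃ R₀ : ℝ, ∀ z : ℂ, R₀ ≤ ‖z‖ →
      l / 2 * ‖z‖ ^ d ≤ ‖h.P.eval z‖ ∧ ‖h.P.eval z‖ ≤ 2 * l * ‖z‖ ^ d := by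
    have := h.P.eventually_cobounded_norm_eval hP
    rw [← comap_norm_atTop, eventually_comap, eventually_atTop] at this
    obtain ⟨R₀, hR₀⟩ := this
    exact ⟨R₀, fun z hz => hR₀ _ hz z rfl⟩
  filter_upwards [eventually_ge_atTop R₀, eventually_ge_atTop 1,
    eventually_ge_atTop (4 * (‖h.a‖ * M) / l), eventually_ge_atTop (8 / l)] with R h1 h2 h3 h4
  have key : ∀ x ∈ escapeCone M R, l / 4 * ‖x.1‖ ^ d ≤ ‖(h.toFun x).1‖ ∧
      ‖(h.toFun x).1‖ ≤ 3 * l * ‖x.1‖ ^ d ∧ 2 * ‖x.1‖ ≤ ‖(h.toFun x).1‖ := by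
    rintro ⟨z, w⟩ ⟨hz, hw⟩
    simp only at hz hw
    obtain ⟨p1, p2⟩ := hR₀ z (h1.trans hz)
    have hz1 : 1 ≤ ‖z‖ := h2.trans hz
    have hsq : ‖z‖ * ‖z‖ ≤ ‖z‖ ^ d := by
      rw [← pow_two]; exact pow_le_pow_right₀ hz1 hd2
    have haw : ‖h.a * w‖ ≤ l / 4 * ‖z‖ ^ d := by
      have : 4 * (‖h.a‖ * M) ≤ ‖z‖ * l := (div_le_iff₀ hl0).1 (h3.trans hz)
      rw [norm_mul]
      calc ‖h.a‖ * ‖w‖ ≤ ‖h.a‖ * (M * ‖z‖) := by gcongr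
        _ ≤ l / 4 * (‖z‖ * ‖z‖) := by nlinarith
        _ ≤ _ := by gcongr
    have hlow : l / 4 * ‖z‖ ^ d ≤ ‖h.P.eval z + h.a * w‖ := by
      have := norm_sub_le_norm_add (h.P.eval z) (h.a * w)
      linarith
    have hpos : 0 ≤ l * ‖z‖ ^ d := by positivity
    refine ⟨hlow, ?_, ?_⟩
    · have := norm_add_le (h.P.eval z) (h.a * w)
      simp only [ElemHenon.toFun]
      linarith
    · have : 8 ≤ ‖z‖ * l := (div_le_iff₀ hl0).1 (h4.trans hz)
      refine le_trans ?_ hlow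
      refine le_trans ?_ (mul_le_mul_of_nonneg_left hsq (by positivity))
      nlinarith
  refine ⟨fun x hx => ?_, fun x hx => (key x hx).2.2, fun x hx => ?_, fun x hx => ?_⟩
  · obtain ⟨-, -, k3⟩ := key x hx
    have hx0 := norm_nonneg x.1
    refine ⟨hx.1.trans (by linarith), ?_⟩
    simp only [ElemHenon.toFun, norm_mul] at k3 ⊢
    exact mul_le_mul hb (by linarith) hx0 (by linarith)
  · obtain ⟨k1, k2, -⟩ := key x hx
    have hx0 : 0 < ‖x.1‖ := by linarith [hx.1]
    have hp : 0 < ‖x.1‖ ^ d := by positivity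
    have l1 := Real.log_le_log (by positivity) k1
    have l2 := Real.log_le_log (lt_of_lt_of_le (by positivity) k1) k2
    rw [Real.log_mul (by positivity) hp.ne', Real.log_pow] at l1 l2
    have := neg_abs_le (Real.log (l / 4))
    have := le_abs_self (Real.log (3 * l))
    have := abs_nonneg (Real.log (l / 4))
    have := abs_nonneg (Real.log (3 * l))
    exact abs_le.2 ⟨by linarith, by linarith⟩
  · have hx' : x ∉ escapeCone M R := by
      intro hc
      obtain ⟨-, -, k3⟩ := key x hc
      have hx0 := norm_nonneg x.1
      refine hx ⟨hc.1.trans (by linarith), ?_⟩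
      simp only [ElemHenon.toFun, norm_mul] at k3 ⊢
      exact mul_le_mul hb (by linarith) hx0 (by linarith)
    have hle : ‖(h.toFun x).2‖ ≤ M * ‖x.1‖ := by
      simp only [ElemHenon.toFun, norm_mul]; gcongr
    by_cases hR : R ≤ ‖x.1‖
    · have : M * ‖x.1‖ < ‖x.2‖ := not_le.1 fun hc => hx' ⟨hR, hc⟩
      exact le_max_of_le_right (hle.trans this.le)
    · exact le_max_of_le_left (hle.trans (by gcongr; exact (not_le.1 hR).le))

theorem exists_escapesOn_foldr {M : ℝ} (hM : 1 ≤ M) (l : List ElemHenon)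
    (hl : ∀ h ∈ l, ‖h.b‖ ≤ M) :
    ∃ K, ∀ᶠ R in atTop, EscapesOn M R (2 ^ l.length) K (l.map fun h => h.P.natDegree).prod
      (l.foldr (fun h f => h.toFun ∘ f) id) := by
  induction l with
  | nil => exact ⟨0, Eventually.of_forall fun R => by simpa using EscapesOn.id M R⟩
  | cons h l ih =>
    obtain ⟨K₂, h₂⟩ := ih fun k hk => hl k (List.mem_cons_of_mem _ hk)
    obtain ⟨K₁, h₁⟩ := h.exists_escapesOn hM (hl h List.mem_cons_self)
    refine ⟨K₁ + h.P.natDegree * K₂, (h₁.and h₂).mono fun R hR => ?_⟩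
    have := hR.1.comp zero_le_two hR.2
    simpa [pow_succ'] using this

theorem HenonMap.two_le_deg (H : HenonMap) : 2 ≤ H.deg := by
  obtain ⟨l, hl⟩ := H
  cases l with
  | nil => exact absurd rfl hl
  | cons h l =>
    simp only [HenonMap.deg, List.map_cons, List.prod_cons]
    have : 1 ≤ (l.map fun h => h.P.natDegree).prod := by
      clear hl
      induction l with
      | nil => simp
      | cons k l ih =>
        simp only [List.map_cons, List.prod_cons]
        exact Nat.one_le_iff_ne_zero.2 (mul_ne_zero (by have := k.hdeg; omega) (by omega))
    nlinarith [h.hdeg]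

theorem HenonMap.exists_escapesOn (H : HenonMap) :
    ∃ M R K : ℝ, 1 ≤ M ∧ 1 ≤ R ∧ EscapesOn M R 2 K H.deg H.toFun := by
  obtain ⟨M, hM, hb⟩ : ∃ M : ℝ, 1 ≤ M ∧ ∀ h ∈ H.comps, ‖h.b‖ ≤ M := by
    have : ∀ᶠ M : ℝ in atTop, ∀ h ∈ {h | h ∈ H.comps}, ‖h.b‖ ≤ M :=
      (eventually_all_finite (List.finite_toSet _)).2 fun h _ => eventually_ge_atTop _
    obtain ⟨M, h1, h2⟩ := ((eventually_ge_atTop 1).and this).exists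
    exact ⟨M, h1, h2⟩
  obtain ⟨K, hK⟩ := exists_escapesOn_foldr hM H.comps hb
  obtain ⟨R, hR, hE⟩ := ((eventually_ge_atTop 1).and hK).exists
  refine ⟨M, R, K, hM, hR, hE.mapsTo, fun x hx => le_trans ?_ (hE.growth x hx), hE.log_growth,
    hE.snd_le⟩
  gcongr
  exact le_self_pow₀ one_le_two (List.length_pos_iff.2 H.ne).ne'

theorem EscapesOn.norm_iterate_le {M R g K : ℝ} {d : ℕ} {F : ℂ × ℂ → ℂ × ℂ} (hM : 1 ≤ M)
    (hR : 1 ≤ R) (hF : EscapesOn M R g K d F) {x : ℂ × ℂ}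
    (hx : ∀ n, F^[n] x ∉ escapeCone M R) (n : ℕ) : ‖F^[n] x‖ ≤ max (M * R) ‖x‖ := by
  have hsnd : ‖(F^[n] x).2‖ ≤ max (M * R) ‖x‖ := by
    induction n with
    | zero => exact le_max_of_le_right (norm_snd_le x)
    | succ n ih =>
      have hn := hx (n + 1)
      rw [Function.iterate_succ_apply'] at hn ⊢
      exact (hF.snd_le _ hn).trans (max_le (le_max_left _ _) ih)
  refine max_le ?_ hsnd
  by_cases h : R ≤ ‖(F^[n] x).1‖
  · have : M * ‖(F^[n] x).1‖ < ‖(F^[n] x).2‖ := not_le.1 fun hc => hx n ⟨h, hc⟩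
    nlinarith [norm_nonneg (F^[n] x).1]
  · exact le_max_of_le_left (by nlinarith)

theorem EscapesOn.tendsto_iterate {M R K : ℝ} {d : ℕ} {F : ℂ × ℂ → ℂ × ℂ} (hM : 1 ≤ M)
    (hR : 1 ≤ R) (hd : 2 ≤ d) (hF : EscapesOn M R 2 K d F) {x : ℂ × ℂ}
    (hx : x ∈ escapeCone M R) :
    Tendsto (fun n => ‖F^[n] x‖) atTop atTop ∧
      ∃ L > 0, Tendsto (fun n => Real.log (max ‖F^[n] x‖ 1) / (d : ℝ) ^ n) atTop (𝓝 L) := by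
  have hmem : ∀ n, F^[n] x ∈ escapeCone M R := fun n => by
    induction n with
    | zero => exact hx
    | succ n ih => rw [Function.iterate_succ_apply']; exact hF.mapsTo _ ih
  have hgr : ∀ n : ℕ, (2 : ℝ) ^ n ≤ ‖(F^[n] x).1‖ := fun n => by
    induction n with
    | zero => simpa using hR.trans hx.1
    | succ n ih =>
      have := hF.growth _ (hmem n)
      rw [Function.iterate_succ_apply', pow_succ']
      linarith
  have htop : Tendsto (fun n => ‖(F^[n] x).1‖) atTop atTop :=
    tendsto_atTop_mono hgr (tendsto_pow_atTop_atTop_of_one_lt one_lt_two)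
  refine ⟨tendsto_atTop_mono (fun n => norm_fst_le _) htop, ?_⟩
  have hd0 : (0 : ℝ) < d := by positivity
  have hd2 : (2 : ℝ) ≤ d := by exact_mod_cast hd
  have hK : 0 ≤ K := (abs_nonneg _).trans (hF.log_growth x hx)
  set a : ℕ → ℝ := fun n => Real.log ‖(F^[n] x).1‖ / (d : ℝ) ^ n with ha
  have hstep : ∀ n, dist (a n) (a (n + 1)) ≤ K * (d : ℝ)⁻¹ ^ n := fun n => by
    have h1 := hF.log_growth _ (hmem n)
    rw [← Function.iterate_succ_apply' F] at h1
    have h2 : a (n + 1) - a n = (Real.log ‖(F^[n + 1] x).1‖ - d * Real.log ‖(F^[n] x).1‖)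
        / (d : ℝ) ^ (n + 1) := by
      simp only [ha]; field_simp; ring
    rw [dist_comm, Real.dist_eq, h2, abs_div, abs_of_pos (pow_pos hd0 (n + 1)),
      div_le_iff₀ (pow_pos hd0 _), inv_pow, mul_assoc]
    have : ((d : ℝ) ^ n)⁻¹ * (d : ℝ) ^ (n + 1) = d := by rw [pow_succ]; field_simp
    rw [this]
    nlinarith
  have hr : (d : ℝ)⁻¹ < 1 := inv_lt_one_of_one_lt₀ (by linarith)
  obtain ⟨L, hL⟩ := cauchySeq_tendsto_of_complete (cauchySeq_of_le_geometric _ _ hr hstep)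
  refine ⟨L, ?_, ?_⟩
  · obtain ⟨n, hn⟩ := ((Real.tendsto_log_atTop.comp htop).eventually
      (eventually_gt_atTop (K / (1 - (d : ℝ)⁻¹)))).exists
    have h1 := dist_le_of_le_geometric_of_tendsto _ _ hr hstep hL n
    rw [Real.dist_eq] at h1
    have h2 := (abs_le.1 h1).2
    have h3 : K * (d : ℝ)⁻¹ ^ n / (1 - (d : ℝ)⁻¹) < a n := by
      simp only [ha, Function.comp] at hn ⊢
      rw [inv_pow, ← div_eq_mul_inv, div_right_comm]
      gcongr
    linarith
  · have hdiff : Tendsto (fun n => Real.log (max ‖F^[n] x‖ 1) / (d : ℝ) ^ n - a n) atTop (𝓝 0) := by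
      have hlim : Tendsto (fun n : ℕ => Real.log M * (d : ℝ)⁻¹ ^ n) atTop (𝓝 0) := by
        simpa using (tendsto_pow_atTop_nhds_zero_of_lt_one (by positivity) hr).const_mul
          (Real.log M)
      refine squeeze_zero (fun n => ?_) (fun n => ?_) hlim
      · have h1 : 0 < ‖(F^[n] x).1‖ := lt_of_lt_of_le (by linarith) (hmem n).1
        refine sub_nonneg.2 (div_le_div_of_nonneg_right (Real.log_le_log h1 ?_) (by positivity))
        exact le_max_of_le_left (norm_fst_le _)
      · have h1 : 1 ≤ ‖(F^[n] x).1‖ := hR.trans (hmem n).1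
        have h2 : max ‖F^[n] x‖ 1 ≤ M * ‖(F^[n] x).1‖ :=
          max_le (max_le (by nlinarith) (hmem n).2) (by nlinarith)
        have h3 := Real.log_le_log (by positivity) h2
        rw [Real.log_mul (by positivity) (by positivity)] at h3
        simp only [ha]
        rw [← sub_div, inv_pow, ← div_eq_mul_inv]
        gcongr
        linarith
    simpa using hdiff.add hL

/-- Orbits on which the escape rate vanishes or which are bounded obey a uniform bound. -/
theorem HenonMap.exists_norm_iterate_le (H : HenonMap) :
    ∃ B : ℝ, ∀ x, (Gplus H x = 0 ∨ Bornology.IsBounded (range fun n => H.toFun^[n] x)) →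
      ∀ n, ‖H.toFun^[n] x‖ ≤ max B ‖x‖ := by
  obtain ⟨M, R, K, hM, hR, hE⟩ := H.exists_escapesOn
  refine ⟨M * R, fun x hx => hE.norm_iterate_le hM hR fun m hm => ?_⟩
  obtain ⟨h1, L, hL, h2⟩ := hE.tendsto_iterate hM hR H.two_le_deg hm
  rcases hx with hx | hx
  · have h3 : Tendsto (fun n => Real.log (max ‖H.toFun^[n] x‖ 1) / (H.deg : ℝ) ^ n) atTop
        (𝓝 (L / (H.deg : ℝ) ^ m)) := by
      refine (tendsto_add_atTop_iff_nat m).1 ((h2.div_const _).congr fun n => ?_)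
      rw [Function.iterate_add_apply, pow_add, div_div]
    have h4 : Gplus H x = L / (H.deg : ℝ) ^ m := h3.limUnder_eq
    have h5 : (0 : ℝ) < H.deg := by have := H.two_le_deg; positivity
    have : 0 < L / (H.deg : ℝ) ^ m := by positivity
    linarith
  · obtain ⟨C, hC⟩ := hx.exists_norm_le
    obtain ⟨n, hn⟩ := (h1.eventually (eventually_gt_atTop C)).exists
    rw [← Function.iterate_add_apply] at hn
    exact absurd (hC _ (mem_range_self (n + m))) (not_le.2 hn)

/-- The elementary Hénon map conjugate to the inverse of `h` by the coordinate swap. -/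
def ElemHenon.dual (h : ElemHenon) : ElemHenon where
  P := Polynomial.C (-h.a⁻¹) * h.P.comp (Polynomial.C h.b⁻¹ * Polynomial.X)
  a := h.a⁻¹
  b := h.b⁻¹
  ha := inv_ne_zero h.ha
  hb := inv_ne_zero h.hb
  hdeg := by
    rw [Polynomial.natDegree_C_mul (neg_ne_zero.2 (inv_ne_zero h.ha)), Polynomial.natDegree_comp,
      Polynomial.natDegree_C_mul_X _ (inv_ne_zero h.hb), mul_one]
    exact h.hdeg

theorem ElemHenon.natDegree_dual (h : ElemHenon) : h.dual.P.natDegree = h.P.natDegree := by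
  rw [ElemHenon.dual, Polynomial.natDegree_C_mul (neg_ne_zero.2 (inv_ne_zero h.ha)),
    Polynomial.natDegree_comp, Polynomial.natDegree_C_mul_X _ (inv_ne_zero h.hb), mul_one]

theorem ElemHenon.invFun_eq_dual (h : ElemHenon) (x : ℂ × ℂ) :
    h.invFun x = (h.dual.toFun x.swap).swap := by
  ext
  · simp [ElemHenon.invFun, ElemHenon.toFun, ElemHenon.dual, div_eq_inv_mul]
  · simp [ElemHenon.invFun, ElemHenon.toFun, ElemHenon.dual, div_eq_inv_mul]
    ring

/-- The Hénon map conjugate to the inverse of `H` by the coordinate swap. -/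
def HenonMap.dual (H : HenonMap) : HenonMap where
  comps := (H.comps.map ElemHenon.dual).reverse
  ne := by simpa using H.ne

theorem HenonMap.deg_dual (H : HenonMap) : H.dual.deg = H.deg := by
  simp only [HenonMap.deg, HenonMap.dual, List.map_reverse, List.prod_reverse, List.map_map]
  congr 2
  exact funext ElemHenon.natDegree_dual

theorem HenonMap.invFun_eq_dual (H : HenonMap) (x : ℂ × ℂ) :
    H.invFun x = (H.dual.toFun x.swap).swap := by
  have key : ∀ (l : List ElemHenon) (f g : ℂ × ℂ → ℂ × ℂ), (∀ x, f x = (g x.swap).swap) → ∀ x,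
      l.foldl (fun f h => h.invFun ∘ f) f x =
        (l.foldl (fun f h => h.dual.toFun ∘ f) g x.swap).swap := by
    intro l
    induction l with
    | nil => exact fun f g h => h
    | cons k l ih =>
      refine fun f g h => ih _ _ fun x => ?_
      simp only [Function.comp_apply]
      rw [k.invFun_eq_dual, h, Prod.swap_swap]
  rw [HenonMap.invFun, key H.comps id id fun x => by simp]
  simp only [HenonMap.toFun, HenonMap.dual, List.foldr_reverse, List.foldl_map]

theorem HenonMap.iterate_invFun_eq_dual (H : HenonMap) (n : ℕ) (x : ℂ × ℂ) :
    H.invFun^[n] x = (H.dual.toFun^[n] x.swap).swap := by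
  induction n with
  | zero => simp
  | succ n ih =>
    rw [Function.iterate_succ_apply', Function.iterate_succ_apply', ih, H.invFun_eq_dual,
      Prod.swap_swap]

theorem Prod.norm_swap {E F : Type*} [Norm E] [Norm F] (x : E × F) : ‖x.swap‖ = ‖x‖ := by
  simp [Prod.norm_def, max_comm]

theorem HenonMap.Gminus_eq_Gplus_dual (H : HenonMap) (x : ℂ × ℂ) :
    Gminus H x = Gplus H.dual x.swap := by
  simp only [Gminus, Gplus, H.iterate_invFun_eq_dual, Prod.norm_swap, H.deg_dual]

/-- Backward orbits on which the escape rate vanishes obey a uniform bound. -/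
theorem HenonMap.exists_norm_iterate_invFun_le (H : HenonMap) :
    ∃ B : ℝ, ∀ x, Gminus H x = 0 → ∀ n, ‖H.invFun^[n] x‖ ≤ max B ‖x‖ := by
  obtain ⟨B, hB⟩ := H.dual.exists_norm_iterate_le
  refine ⟨B, fun x hx n => ?_⟩
  rw [H.iterate_invFun_eq_dual, Prod.norm_swap, ← Prod.norm_swap x]
  exact hB _ (Or.inl (H.Gminus_eq_Gplus_dual x ▸ hx)) n

theorem HenonMap.differentiable_toFun (H : HenonMap) : Differentiable ℂ H.toFun := by
  unfold HenonMap.toFun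
  induction H.comps with
  | nil => exact differentiable_id
  | cons h l ih =>
    have hh : Differentiable ℂ h.toFun := by
      have := h.P.differentiable
      unfold ElemHenon.toFun
      fun_prop
    exact hh.comp ih

theorem HenonMap.differentiable_invFun (H : HenonMap) : Differentiable ℂ H.invFun := by
  have hswap : Differentiable ℂ (Prod.swap : ℂ × ℂ → ℂ × ℂ) :=
    differentiable_snd.prodMk differentiable_fst
  have : H.invFun = Prod.swap ∘ H.dual.toFun ∘ Prod.swap := funext H.invFun_eq_dual
  rw [this]
  exact hswap.comp (H.dual.differentiable_toFun.comp hswap)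

theorem ElemHenon.invFun_toFun (h : ElemHenon) (x : ℂ × ℂ) : h.invFun (h.toFun x) = x := by
  have := h.ha
  have := h.hb
  ext <;> simp [ElemHenon.invFun, ElemHenon.toFun] <;> field_simp
  ring

theorem ElemHenon.toFun_invFun (h : ElemHenon) (x : ℂ × ℂ) : h.toFun (h.invFun x) = x := by
  have := h.ha
  have := h.hb
  ext <;> simp [ElemHenon.invFun, ElemHenon.toFun] <;> field_simp
  ring

theorem foldl_invFun_apply (l : List ElemHenon) (g : ℂ × ℂ → ℂ × ℂ) (x : ℂ × ℂ) :
    l.foldl (fun f h => h.invFun ∘ f) g x = l.foldl (fun f h => h.invFun ∘ f) id (g x) := by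
  induction l generalizing g x with
  | nil => rfl
  | cons h l ih =>
    rw [List.foldl_cons, List.foldl_cons, ih, ih (h.invFun ∘ id)]
    rfl

theorem HenonMap.leftInverse (H : HenonMap) : Function.LeftInverse H.invFun H.toFun := by
  intro x
  unfold HenonMap.toFun HenonMap.invFun
  induction H.comps with
  | nil => rfl
  | cons h l ih =>
    rw [List.foldl_cons, foldl_invFun_apply, List.foldr_cons]
    simpa [h.invFun_toFun] using ih

theorem HenonMap.rightInverse (H : HenonMap) : Function.RightInverse H.invFun H.toFun := by
  intro x
  unfold HenonMap.toFun HenonMap.invFun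
  induction H.comps generalizing x with
  | nil => rfl
  | cons h l ih =>
    rw [List.foldl_cons, foldl_invFun_apply, List.foldr_cons, Function.comp_apply, ih]
    exact h.toFun_invFun x

theorem fderiv_iterate_succ_apply {f : ℂ × ℂ → ℂ × ℂ} (hf : Differentiable ℂ f) (n : ℕ)
    (x v : ℂ × ℂ) : fderiv ℂ (f^[n + 1]) x v = fderiv ℂ f (f^[n] x) (fderiv ℂ (f^[n]) x v) := by
  rw [Function.iterate_succ', fderiv_comp _ hf.differentiableAt (hf.iterate n).differentiableAt]
  rfl

theorem fderiv_apply_fderiv_of_rightInverse {f g : ℂ × ℂ → ℂ × ℂ} (hf : Differentiable ℂ f)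
    (hg : Differentiable ℂ g) (h : Function.RightInverse g f) (x v : ℂ × ℂ) :
    fderiv ℂ f (g x) (fderiv ℂ g x v) = v := by
  have h1 := fderiv_comp x hf.differentiableAt hg.differentiableAt
  rw [h.comp_eq_id, fderiv_id] at h1
  exact (DFunLike.congr_fun h1 v).symm

/-- A vector whose forward images are bounded lies in the contracted subspace. -/
theorem mem_of_forall_norm_le {Es Eu : Submodule ℂ (ℂ × ℂ)} (hE : IsCompl Es Eu)
    {T : ℕ → (ℂ × ℂ) →L[ℂ] (ℂ × ℂ)} {c lam : ℝ} (hc : 0 < c) (hl0 : 0 < lam) (hl1 : lam < 1)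
    (hs : ∀ v ∈ Es, ∀ n : ℕ, 1 ≤ n → ‖T n v‖ ≤ (lam ^ n / c) * ‖v‖)
    (hu : ∀ v ∈ Eu, ∀ n : ℕ, 1 ≤ n → ‖T n v‖ ≥ (c / lam ^ n) * ‖v‖)
    {v : ℂ × ℂ} {B : ℝ} (hv : ∀ n, ‖T n v‖ ≤ B) : v ∈ Es := by
  obtain ⟨vs, hvs, vu, hvu, rfl⟩ := Submodule.mem_sup.1
    (hE.sup_eq_top ▸ Submodule.mem_top : v ∈ Es ⊔ Eu)
  have hbound : ∀ᶠ n : ℕ in atTop, ‖vu‖ ≤ (B + ‖vs‖ / c) / c * lam ^ n := by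
    filter_upwards [eventually_ge_atTop 1] with n hn
    have hp : 0 < lam ^ n := pow_pos hl0 n
    have h1 : ‖T n vs‖ ≤ ‖vs‖ / c := by
      refine (hs vs hvs n hn).trans ?_
      rw [div_mul_eq_mul_div]
      gcongr
      exact mul_le_of_le_one_left (norm_nonneg _) (pow_le_one₀ hl0.le hl1.le)
    have h2 : ‖T n vu‖ ≤ B + ‖vs‖ / c := by
      have : T n vu = T n (vs + vu) - T n vs := by simp
      rw [this]
      exact (norm_sub_le _ _).trans (add_le_add (hv n) h1)
    have h3 := (hu vu hvu n hn).le.trans h2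
    rw [div_mul_eq_mul_div, div_le_iff₀ hp] at h3
    rw [div_mul_eq_mul_div, le_div_iff₀ hc]
    linarith
  have hlim : Tendsto (fun n : ℕ => (B + ‖vs‖ / c) / c * lam ^ n) atTop (𝓝 0) := by
    simpa using (tendsto_pow_atTop_nhds_zero_of_lt_one hl0.le hl1).const_mul
      ((B + ‖vs‖ / c) / c)
  have : vu = 0 := norm_le_zero_iff.1 (ge_of_tendsto hlim hbound)
  simpa [this] using hvs

theorem isBounded_range_iterate_of_mem_Ws {H : HenonMap} {S : Set (ℂ × ℂ)}
    (hS : Bornology.IsBounded S) (hmap : MapsTo H.toFun S S) {p x : ℂ × ℂ} (hp : p ∈ S)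
    (hx : x ∈ Ws H p) : Bornology.IsBounded (range fun n => H.toFun^[n] x) := by
  obtain ⟨C₁, hC₁⟩ := hS.exists_norm_le
  obtain ⟨C₂, hC₂⟩ := Tendsto.bddAbove_range (show Tendsto _ _ _ from hx)
  refine isBounded_iff_forall_norm_le.2 ⟨C₂ + C₁, ?_⟩
  rintro _ ⟨n, rfl⟩
  have h1 := hC₁ _ (hmap.iterate n hp)
  have h2 : dist (H.toFun^[n] x) (H.toFun^[n] p) ≤ C₂ := hC₂ (mem_range_self n)
  rw [dist_eq_norm] at h2
  have h3 := norm_add_le (H.toFun^[n] x - H.toFun^[n] p) (H.toFun^[n] p)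
  rw [sub_add_cancel] at h3
  linarith

/-- Cauchy estimate for the derivative of a curve along an iterate. -/
theorem norm_fderiv_deriv_le {F : ℂ × ℂ → ℂ × ℂ} (hF : Differentiable ℂ F) {Φ : ℂ → ℂ × ℂ}
    (hΦ : Differentiable ℂ Φ) {q : ℂ} {r B : ℝ} (hr : 0 < r)
    (hB : ∀ z ∈ sphere q r, ‖F (Φ z)‖ ≤ B) : ‖fderiv ℂ F (Φ q) (deriv Φ q)‖ ≤ B / r := by
  have := Complex.norm_deriv_le_of_forall_mem_sphere_norm_le hr
    (hF.comp hΦ).diffContOnCl hB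
  rwa [fderiv_comp_deriv q hF.differentiableAt hΦ.differentiableAt] at this

/-- No compact set whose frontier is sent into the zero set of `G⁻` has an interior point on the
hyperbolic set. -/
theorem notMem_of_mem_interior {H : HenonMap} {S : Set (ℂ × ℂ)} (hhyp : UniformlyHyperbolicOn H S)
    {p : ℂ × ℂ} (hp : p ∈ S) {Φ : ℂ → ℂ × ℂ} (hΦ : IsStableParam H p Φ) {A : Set ℂ}
    (hA : IsCompact A) (hG : ∀ z ∈ frontier A, Gminus H (Φ z) = 0) {q : ℂ} (hq : q ∈ interior A) :
    Φ q ∉ S := by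
  intro hqS
  obtain ⟨hcpt, himg, Es, Eu, c, lam, hc, hl0, hl1, -, -, hE, -, -, hEs, -, hcon, hexp⟩ := hhyp
  obtain ⟨hd, -, hne, -, hrange⟩ := hΦ
  have hmap : MapsTo H.toFun S S := fun x hx => himg ▸ mem_image_of_mem _ hx
  have hmem : deriv Φ q ∈ Es (Φ q) := by
    obtain ⟨B, hB⟩ := H.exists_norm_iterate_le
    obtain ⟨C, hC⟩ := (isCompact_sphere q 1).exists_bound_of_continuousOn hd.continuous.continuousOn
    refine mem_of_forall_norm_le (hE _ hqS) hc hl0 hl1 (hcon _ hqS) (hexp _ hqS) fun n =>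
      norm_fderiv_deriv_le (B := max B C) (H.differentiable_toFun.iterate n) hd one_pos
        fun z hz => ?_
    refine (hB _ (Or.inr ?_) n).trans (max_le_max le_rfl (hC z hz))
    exact isBounded_range_iterate_of_mem_Ws hcpt.isBounded hmap hp (hrange ▸ mem_range_self z)
  have hinv : MapsTo H.invFun S S := fun x hx => by
    obtain ⟨y, hy, rfl⟩ := himg.symm ▸ hx
    rwa [H.leftInverse y]
  have hback : ∀ n : ℕ, fderiv ℂ (H.invFun^[n]) (Φ q) (deriv Φ q) ∈ Es (H.invFun^[n] (Φ q)) := by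
    intro n
    induction n with
    | zero => simpa using hmem
    | succ n ih =>
      have hy := hinv.iterate n hqS
      have hy' := hinv hy
      rw [fderiv_iterate_succ_apply H.differentiable_invFun, Function.iterate_succ_apply']
      generalize fderiv ℂ (H.invFun^[n]) (Φ q) (deriv Φ q) = v at ih ⊢
      generalize H.invFun^[n] (Φ q) = y at *
      obtain ⟨x, rfl⟩ : ∃ x, H.toFun x = y := ⟨_, H.rightInverse y⟩
      rw [H.leftInverse x] at hy' ⊢
      rw [← hEs _ hy'] at ih
      obtain ⟨e, he, rfl⟩ := ih
      have := fderiv_apply_fderiv_of_rightInverse H.differentiable_invFun H.differentiable_toFun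
        H.leftInverse x e
      simpa [this] using he
  obtain ⟨r, hr, hball⟩ := nhds_basis_closedBall.mem_iff.1 (isOpen_interior.mem_nhds hq)
  obtain ⟨B, hB⟩ : ∃ B, ∀ n : ℕ, ‖fderiv ℂ (H.invFun^[n]) (Φ q) (deriv Φ q)‖ ≤ B := by
    obtain ⟨B, hB⟩ := H.exists_norm_iterate_invFun_le
    obtain ⟨C, hC⟩ := hA.exists_bound_of_continuousOn hd.continuous.continuousOn
    refine ⟨max B C / r, fun n => norm_fderiv_deriv_le (H.differentiable_invFun.iterate n) hd hr
      fun z hz => ?_⟩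
    refine Complex.norm_le_of_forall_mem_frontier_norm_le
      (f := fun z => H.invFun^[n] (Φ z)) (hA.isBounded.subset interior_subset)
      ((H.differentiable_invFun.iterate n).comp hd).diffContOnCl (fun w hw => ?_)
      (subset_closure (hball (sphere_subset_closedBall hz)))
    have hw := frontier_interior_subset hw
    exact (hB _ (hG w hw) n).trans
      (max_le_max le_rfl (hC w (hA.isClosed.frontier_subset hw)))
  have hbound : ∀ᶠ n : ℕ in atTop, ‖deriv Φ q‖ ≤ B / c * lam ^ n := by
    filter_upwards [eventually_ge_atTop 1] with n hn
    have h1 := hcon _ (hinv.iterate n hqS) _ (hback n) n hn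
    rw [fderiv_apply_fderiv_of_rightInverse (H.differentiable_toFun.iterate n)
      (H.differentiable_invFun.iterate n) (H.rightInverse.iterate n)] at h1
    refine h1.trans ?_
    rw [div_mul_eq_mul_div, div_mul_eq_mul_div, mul_comm]
    gcongr
    exact hB n
  have hlim : Tendsto (fun n : ℕ => B / c * lam ^ n) atTop (𝓝 0) := by
    simpa using (tendsto_pow_atTop_nhds_zero_of_lt_one hl0.le hl1).const_mul (B / c)
  exact hne q (norm_le_zero_iff.1 (ge_of_tendsto hlim hbound))

/-- A component of an open plane set contains each compact subset whose frontier it contains. -/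
theorem subset_connectedComponentIn_of_frontier_subset {U A : Set ℂ} {z₀ : ℂ} (hU : IsOpen U)
    (hA : IsCompact A) (hAU : A ⊆ U) (hfr : frontier A ⊆ connectedComponentIn U z₀) :
    A ⊆ connectedComponentIn U z₀ := by
  set V := connectedComponentIn U z₀ with hVdef
  have hV : IsOpen V := hU.connectedComponentIn
  have hrest : IsOpen (U \ V) := by
    refine isOpen_iff_forall_mem_open.2 fun x hx =>
      ⟨connectedComponentIn U x, fun y hy => ⟨connectedComponentIn_subset _ _ hy, fun hyV => ?_⟩,
        hU.connectedComponentIn, mem_connectedComponentIn hx.1⟩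
    have h : V = connectedComponentIn U x :=
      (connectedComponentIn_eq hyV).trans (connectedComponentIn_eq hy).symm
    exact hx.2 (h ▸ mem_connectedComponentIn hx.1)
  have heq : A \ V = interior A ∩ (U \ V) := by
    ext x
    refine ⟨fun hx => ⟨?_, hAU hx.1, hx.2⟩, fun hx => ⟨interior_subset hx.1, hx.2.2⟩⟩
    by_contra hi
    exact hx.2 (hfr (hA.isClosed.frontier_eq ▸ ⟨hx.1, hi⟩))
  have hclopen : IsClopen (A \ V) :=
    ⟨(hA.diff hV).isClosed, heq ▸ isOpen_interior.inter hrest⟩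
  rcases isClopen_iff.1 hclopen with h | h
  · exact sdiff_eq_empty.1 h
  · exact absurd (h ▸ hA.diff hV) (noncompact_univ ℂ)

/-- If `H` is uniformly hyperbolic on `J*` and `V` is a nonempty connected component of
`ℂ ∖ J*_{p,s}` on which `G⁻ ∘ Φ^s_p` vanishes identically, then `V` is simply connected. -/
theorem component_simplyConnected_of_Gminus_vanishes (H : HenonMap)
    (hhyp : UniformlyHyperbolicOn H (Jstar H))
    (p : ℂ × ℂ) (hp : p ∈ Jstar H)
    (Φ : ℂ → ℂ × ℂ) (hΦ : IsStableParam H p Φ)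
    (V : Set ℂ) (z₀ : ℂ) (hz₀ : z₀ ∈ V)
    (hV : V = connectedComponentIn (Φ ⁻¹' Jstar H)ᶜ z₀)
    (hG : ∀ z ∈ V, Gminus H (Φ z) = 0) :
    SimplyConnectedSpace V := by
  have hU : IsOpen (Φ ⁻¹' Jstar H)ᶜ := (hhyp.1.isClosed.preimage hΦ.1.continuous).isOpen_compl
  have hz : z₀ ∈ (Φ ⁻¹' Jstar H)ᶜ := connectedComponentIn_subset _ _ (hV ▸ hz₀)
  refine simplyConnectedSpace_of_forall_isCompact (hV ▸ hU.connectedComponentIn)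
    (hV ▸ isConnected_connectedComponentIn_iff.2 hz) fun A hA hfr => ?_
  have hAU : A ⊆ (Φ ⁻¹' Jstar H)ᶜ := fun x hx => by
    by_cases hi : x ∈ interior A
    · exact notMem_of_mem_interior hhyp hp hΦ hA (fun z hz => hG z (hfr hz)) hi
    · have : x ∈ V := hfr (hA.isClosed.frontier_eq ▸ ⟨hx, hi⟩)
      exact connectedComponentIn_subset _ _ (hV ▸ this)
  subst hV
  exact subset_connectedComponentIn_of_frontier_subset hU hA hAU hfr

end
end
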